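/- arXiv:1002.1540 — 3 statements merged into one kernel-verified Lean document; each statement's English description precedes it below -/
import Mathlib

section
/- For every α ∈ (1,2) and every integer N ≥ 1, h_α(x) − Σ_{n=1}^N α·x^{1/α+n−1}/(Γ(−αn)·Γ(1/α+n)) = O(x^{1/α+N}) as x → 0⁺; in particular h_α(x) ∼ α·x^{1/α}/(Γ(−α)·Γ(1+1/α)) as x → 0⁺. -/
open Real MeasureTheory Set Asymptotics Filter

/-- The density `h_α` of the first hitting time of level 1 by a normalized
spectrally positive `α`-stable Lévy process. -/
noncomputable def hittingDensity (α x : ℝ) : ℝ :=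
  (∑' n : ℕ, (-α) * x ^ (1 / α - ((n : ℝ) + 1) - 1) /
      (Real.Gamma (α * ((n : ℝ) + 1)) * Real.Gamma (1 / α - ((n : ℝ) + 1))))
  + ∑' n : ℕ, x ^ (-((n : ℝ) + 1) / α - 1) /
      (Real.Gamma (-((n : ℝ) + 1) / α) * (Nat.factorial (n + 1) : ℝ))

open scoped Topology

/-! ### Integration lemmas -/

/-- Termwise integration, when all partial sums of the norms are dominated by one integrable
function. -/
lemma hasSum_integral_of_sum_norm_le {X : Type*} [MeasurableSpace X] {μ : Measure X}
    {F : ℕ → X → ℂ} {g : X → ℝ} (hF : ∀ n, AEStronglyMeasurable (F n) μ) (hg : Integrable g μ)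
    (h : ∀ᵐ x ∂μ, ∀ s : Finset ℕ, ∑ n ∈ s, ‖F n x‖ ≤ g x) :
    HasSum (fun n => ∫ x, F n x ∂μ) (∫ x, ∑' n, F n x ∂μ) := by
  have hF' : ∀ n, Integrable (F n) μ := fun n =>
    hg.mono' (hF n) (h.mono fun x hx => by simpa using hx {n})
  refine hasSum_integral_of_summable_integral_norm hF' ?_
  refine summable_of_sum_le (c := ∫ x, g x ∂μ)
    (fun n => integral_nonneg fun x => norm_nonneg _) fun s => ?_
  rw [← integral_finsetSum s fun n _ => (hF' n).norm]
  exact integral_mono_ae (integrable_finsetSum s fun n _ => (hF' n).norm) hg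
    (h.mono fun x hx => hx s)

lemma image_exp_univ : Real.exp '' univ = Ioi 0 := by
  rw [image_univ, Real.range_exp]

lemma integral_comp_exp {E : Type*} [NormedAddCommGroup E] [NormedSpace ℝ E] (g : ℝ → E) :
    ∫ t, Real.exp t • g (Real.exp t) = ∫ s in Ioi (0 : ℝ), g s := by
  rw [← image_exp_univ]
  simpa [abs_of_pos (exp_pos _)] using (integral_image_eq_integral_abs_deriv_smul
      MeasurableSet.univ (fun x _ ↦ (Real.hasDerivAt_exp x).hasDerivWithinAt)
      (fun x _ y _ hxy ↦ Real.exp_injective hxy) g).symm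

lemma integrable_comp_exp {E : Type*} [NormedAddCommGroup E] [NormedSpace ℝ E] (g : ℝ → E) :
    Integrable (fun t => Real.exp t • g (Real.exp t)) ↔ IntegrableOn g (Ioi (0 : ℝ)) := by
  rw [← image_exp_univ]
  simpa [abs_of_pos (exp_pos _)] using (integrableOn_image_iff_integrableOn_abs_deriv_smul
      MeasurableSet.univ (fun x _ ↦ (Real.hasDerivAt_exp x).hasDerivWithinAt)
      (fun x _ y _ hxy ↦ Real.exp_injective hxy) g).symm

lemma integrable_exp_neg_mul_exp {q c : ℝ} (hq : 0 < q) (hc : 0 < c) :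
    Integrable fun t : ℝ => Real.exp (-(q * Real.exp t)) * Real.exp (c * t) := by
  have h := integrableOn_rpow_mul_exp_neg_mul_rpow (p := 1) (s := c - 1) (b := q)
    (by linarith) one_pos hq
  rw [← integrable_comp_exp] at h
  refine h.congr (ae_of_all _ fun t => ?_)
  simp only [smul_eq_mul, Real.rpow_one]
  rw [← Real.exp_mul, ← mul_assoc, ← Real.exp_add, ← Real.exp_add, ← Real.exp_add]
  ring_nf

lemma integrableOn_Ioi_exp_neg_mul_exp {q : ℝ} (hq : 0 < q) (c b : ℝ) :
    IntegrableOn (fun t : ℝ => Real.exp (-(q * Real.exp t)) * Real.exp (c * t)) (Ioi b) := by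
  have h := ((integrable_exp_neg_mul_exp hq
    (lt_of_lt_of_le one_pos (le_max_left 1 c))).integrableOn (s := Ioi b)).const_mul
      (Real.exp ((c - max 1 c) * b))
  refine h.mono' (by fun_prop) ?_
  refine (ae_restrict_iff' measurableSet_Ioi).2 (ae_of_all _ fun t ht => ?_)
  rw [Real.norm_of_nonneg (by positivity), ← Real.exp_add, ← Real.exp_add, ← Real.exp_add]
  apply Real.exp_le_exp.2
  nlinarith [le_max_right 1 c, mem_Ioi.1 ht]

/-! ### Contour integrals over rectangles in a strip -/

lemma integral_strip_boundary {g : ℂ → ℂ} {y₁ y₂ : ℝ}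
    (hg : DifferentiableOn ℂ g {w | w.im ∈ uIcc y₁ y₂}) (a b : ℝ) :
    ((∫ t in a..b, g (t + y₁ * Complex.I)) - ∫ t in a..b, g (t + y₂ * Complex.I)) =
      Complex.I * (∫ φ in y₁..y₂, g (a + φ * Complex.I)) -
        Complex.I * ∫ φ in y₁..y₂, g (b + φ * Complex.I) := by
  have h := Complex.integral_boundary_rect_eq_zero_of_differentiableOn g
    (a + y₁ * Complex.I) (b + y₂ * Complex.I) (hg.mono ?_)
  · simp at h
    linear_combination h
  · intro w hw
    have := (Complex.mem_reProdIm.1 hw).2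
    simpa using this

lemma norm_exp_neg_exp (z : ℂ) :
    ‖Complex.exp (-Complex.exp z)‖ = Real.exp (-(Real.exp z.re * Real.cos z.im)) := by
  rw [Complex.norm_exp]; simp [Complex.exp_re]

lemma tendsto_exp_neg_mul_exp_atTop {q : ℝ} (hq : 0 < q) (c : ℝ) :
    Tendsto (fun t : ℝ => Real.exp (-(q * Real.exp t)) * Real.exp (c * t)) atTop (𝓝 0) := by
  have h := (tendsto_rpow_mul_exp_neg_mul_atTop_nhds_zero c q hq).comp Real.tendsto_exp_atTop
  refine h.congr fun t => ?_
  simp only [Function.comp]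
  rw [← Real.exp_mul]; ring_nf

lemma tendsto_exp_neg_mul_exp_atBot {q c : ℝ} (hq : 0 < q) (hc : 0 < c) :
    Tendsto (fun t : ℝ => Real.exp (-(q * Real.exp t)) * Real.exp (c * t)) atBot (𝓝 0) := by
  have h : Tendsto (fun t : ℝ => Real.exp (c * t)) atBot (𝓝 0) :=
    Real.tendsto_exp_atBot.comp (tendsto_id.const_mul_atBot hc)
  refine squeeze_zero (fun t => by positivity) (fun t => ?_) h
  exact mul_le_of_le_one_left (by positivity) (Real.exp_le_one_iff.2 (by simp; positivity))

/-- The Gamma integral along a rotated ray, in logarithmic coordinates. -/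
lemma integral_exp_neg_exp_add {θ c : ℝ} (hθ : |θ| < π / 2) (hc : 0 < c) :
    ∫ t : ℝ, Complex.exp (-Complex.exp (t + θ * Complex.I)) * Complex.exp (c * (t + θ * Complex.I))
      = Real.Gamma c := by
  set g : ℂ → ℂ := fun w => Complex.exp (-Complex.exp w) * Complex.exp (c * w) with hgdef
  have hcos : 0 < Real.cos θ := Real.cos_pos_of_mem_Ioo (by rw [abs_lt] at hθ; exact hθ)
  have hcy : ∀ y ∈ uIcc 0 θ, Real.cos θ ≤ Real.cos y := fun y hy => by
    have h1 : |y| ≤ |θ| := by simpa using abs_sub_left_of_mem_uIcc hy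
    rw [← Real.cos_abs θ, ← Real.cos_abs y]
    exact Real.cos_le_cos_of_nonneg_of_le_pi (abs_nonneg _) (by linarith [Real.pi_pos]) h1
  have hnorm : ∀ t : ℝ, ∀ y ∈ uIcc 0 θ, ‖g (t + y * Complex.I)‖ ≤
      Real.exp (-(Real.cos θ * Real.exp t)) * Real.exp (c * t) := fun t y hy => by
    simp only [hgdef]
    rw [norm_mul, norm_exp_neg_exp, Complex.norm_exp]
    simp only [Complex.add_re, Complex.ofReal_re, Complex.mul_re, Complex.I_re, mul_zero,
      Complex.ofReal_im, Complex.I_im, mul_one, sub_zero, add_zero, Complex.add_im,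
      Complex.mul_im, zero_add, zero_mul]
    refine mul_le_mul_of_nonneg_right (Real.exp_le_exp.2 ?_) (Real.exp_pos _).le
    nlinarith [hcy y hy, Real.exp_pos t]
  have hgd : Differentiable ℂ g := by simp only [hgdef]; fun_prop
  have hint : ∀ y ∈ uIcc 0 θ, Integrable fun t : ℝ => g (t + y * Complex.I) := fun y hy =>
    (integrable_exp_neg_mul_exp hcos hc).mono'
      (hgd.continuous.comp (by fun_prop)).aestronglyMeasurable
      (ae_of_all _ fun t => hnorm t y hy)
  have hvert : ∀ l : Filter ℝ, Tendsto (fun t : ℝ => Real.exp (-(Real.cos θ * Real.exp t)) *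
      Real.exp (c * t)) l (𝓝 0) →
      Tendsto (fun t : ℝ => Complex.I * ∫ φ in (0 : ℝ)..θ, g (t + φ * Complex.I)) l (𝓝 0) := by
    intro l hl
    rw [tendsto_zero_iff_norm_tendsto_zero]
    refine squeeze_zero (fun _ => norm_nonneg _) (fun t => ?_) (by simpa using hl.mul_const |θ|)
    have := intervalIntegral.norm_integral_le_of_norm_le_const (a := 0) (b := θ)
      (f := fun φ : ℝ => g (t + φ * Complex.I)) (C := Real.exp (-(Real.cos θ * Real.exp t)) *
      Real.exp (c * t)) (fun y hy => hnorm t y (uIoc_subset_uIcc hy))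
    simpa using this
  have h1 : Tendsto (fun T : ℝ => (∫ t in (-T)..T, g (t + (0 : ℝ) * Complex.I)) -
      ∫ t in (-T)..T, g (t + θ * Complex.I)) atTop
      (𝓝 ((∫ t : ℝ, g (t + (0 : ℝ) * Complex.I)) - ∫ t : ℝ, g (t + θ * Complex.I))) :=
    (intervalIntegral_tendsto_integral (hint 0 left_mem_uIcc) tendsto_neg_atTop_atBot
      tendsto_id).sub (intervalIntegral_tendsto_integral (hint θ right_mem_uIcc)
        tendsto_neg_atTop_atBot tendsto_id)
  have h2 : Tendsto (fun T : ℝ => (∫ t in (-T)..T, g (t + (0 : ℝ) * Complex.I)) -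
      ∫ t in (-T)..T, g (t + θ * Complex.I)) atTop (𝓝 0) := by
    have hA := (hvert atBot (tendsto_exp_neg_mul_exp_atBot hcos hc)).comp tendsto_neg_atTop_atBot
    have hB := hvert atTop (tendsto_exp_neg_mul_exp_atTop hcos c)
    have := hA.sub hB
    rw [sub_zero] at this
    refine this.congr fun T => ?_
    rw [integral_strip_boundary hgd.differentiableOn]
    simp [Function.comp]
  have h3 := sub_eq_zero.1 (tendsto_nhds_unique h1 h2)
  rw [← h3]
  have h4 : (Real.Gamma c : ℂ) = Complex.Gamma c := (Complex.Gamma_ofReal c).symm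
  rw [h4, Complex.Gamma_eq_integral (by simpa using hc), Complex.GammaIntegral,
    ← integral_comp_exp]
  refine integral_congr_ae (ae_of_all _ fun t => ?_)
  simp only [hgdef]
  rw [Complex.real_smul, Complex.ofReal_exp, Complex.ofReal_exp, Complex.cpow_def_of_ne_zero
    (Complex.exp_ne_zero _), ← Complex.ofReal_exp, ← Complex.ofReal_log (Real.exp_pos _).le,
    Real.log_exp, Complex.ofReal_exp, ← Complex.exp_add, ← Complex.exp_add, ← Complex.exp_add]
  push_cast
  ring_nf

lemma exp_re_pos {u : ℂ} (hu : |u.im| < π / 2) : 0 < (Complex.exp u).re := by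
  rw [Complex.exp_re]
  exact mul_pos (Real.exp_pos _) (Real.cos_pos_of_mem_Ioo (by rw [abs_lt] at hu; exact hu))

lemma norm_exp_neg_mul_ofReal (p : ℂ) (s : ℝ) :
    ‖Complex.exp (-(p * s))‖ = Real.exp (-(p.re * s)) := by
  rw [Complex.norm_exp]; simp

lemma norm_exp_real_mul (c t : ℝ) : ‖Complex.exp (c * t)‖ = Real.exp (c * t) := by
  rw [Complex.norm_exp]; simp

lemma integrable_cexp_neg_mul_exp {p : ℂ} (hp : 0 < p.re) {c : ℝ} (hc : 0 < c) :
    Integrable fun t : ℝ => Complex.exp (-(p * Real.exp t)) * Complex.exp (c * t) := by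
  refine (integrable_exp_neg_mul_exp hp hc).mono' (by fun_prop) (ae_of_all _ fun t => ?_)
  rw [norm_mul, norm_exp_neg_mul_ofReal, norm_exp_real_mul]

lemma integrableOn_Ioi_cexp_neg_mul_exp {p : ℂ} (hp : 0 < p.re) (c b : ℝ) :
    IntegrableOn (fun t : ℝ => Complex.exp (-(p * Real.exp t)) * Complex.exp (c * t)) (Ioi b) := by
  refine (integrableOn_Ioi_exp_neg_mul_exp hp c b).mono' (by fun_prop) (ae_of_all _ fun t => ?_)
  rw [norm_mul, norm_exp_neg_mul_ofReal, norm_exp_real_mul]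

lemma integral_cexp_neg_mul_exp {u : ℂ} (hu : |u.im| < π / 2) {c : ℝ} (hc : 0 < c) :
    ∫ t : ℝ, Complex.exp (-(Complex.exp u * Real.exp t)) * Complex.exp (c * t)
      = Real.Gamma c * Complex.exp (-(c * u)) := by
  have h := integral_exp_neg_exp_add hu hc
  rw [← integral_add_right_eq_self _ u.re] at h
  rw [← h, ← integral_mul_const]
  refine integral_congr_ae (ae_of_all _ fun t => ?_)
  have e : ((t + u.re : ℝ) : ℂ) + u.im * Complex.I = t + u := by
    conv_rhs => rw [← Complex.re_add_im u]
    push_cast; ring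
  simp only [e]
  rw [mul_assoc, ← Complex.exp_add, Complex.ofReal_exp, ← Complex.exp_add u]
  rw [add_comm u, ← Complex.exp_add, ← Complex.exp_add]
  ring_nf

lemma cexp_sub_pi_mul_I (t : ℝ) : Complex.exp (t + (-π : ℝ) * Complex.I) = -(Real.exp t : ℂ) := by
  rw [Complex.exp_add]; simp [Complex.exp_neg]

lemma cexp_add_pi_mul_I (t : ℝ) : Complex.exp (t + (π : ℝ) * Complex.I) = -(Real.exp t : ℂ) := by
  rw [Complex.exp_add]; simp

lemma cexp_sub_cexp_neg (c : ℝ) :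
    Complex.exp (-(c * π * Complex.I)) - Complex.exp (c * π * Complex.I) =
      -(2 * Complex.I * Real.sin (c * π)) := by
  rw [Complex.ofReal_sin, Complex.sin]
  push_cast
  ring_nf
  simp
  ring

lemma sin_mul_Gamma_one_sub {s : ℝ} (hs1 : s < 1) :
    Real.sin (π * s) * Real.Gamma (1 - s) = π / Real.Gamma s := by
  have h := Real.Gamma_mul_Gamma_one_sub s
  have hG1 : Real.Gamma (1 - s) ≠ 0 := (Real.Gamma_pos_of_pos (by linarith)).ne'
  by_cases hs : Real.sin (π * s) = 0
  · rw [hs, div_zero] at h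
    have hG := (mul_eq_zero.1 h).resolve_right hG1
    rw [hs, hG]; simp
  · have hG : Real.Gamma s ≠ 0 := fun h0 => by
      rw [h0, zero_mul] at h
      exact (div_ne_zero Real.pi_ne_zero hs) h.symm
    rw [eq_div_iff hs] at h
    rw [eq_div_iff hG]
    linarith

/-! ### The Hankel contour -/

/-- Hankel's formula for `1 / Γ`: the circular arc and the two sides of the cut. -/
lemma hankel_base {u : ℂ} (hu : |u.im| < π / 2) (b : ℝ) {β : ℝ} (hβ : β < 1) :
    (∫ φ in -π..π, Complex.exp (Complex.exp u * Complex.exp (b + φ * Complex.I)) *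
        Complex.exp ((1 - β : ℝ) * (b + φ * Complex.I))) +
      2 * Real.sin (β * π) * ∫ t in Ioi b, Complex.exp (-(Complex.exp u * Real.exp t)) *
        Complex.exp ((1 - β : ℝ) * t) =
      2 * π * (Complex.exp ((β - 1) * u) / Real.Gamma β) := by
  set p := Complex.exp u with hpdef
  have hp : 0 < p.re := exp_re_pos hu
  have hc : 0 < 1 - β := by linarith
  set c := 1 - β with hcdef
  set g : ℂ → ℂ := fun w => Complex.exp (p * Complex.exp w) * Complex.exp (c * w) with hgdef
  set d : ℝ → ℂ := fun t => Complex.exp (-(p * Real.exp t)) * Complex.exp (c * t) with hddef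
  have hgd : Differentiable ℂ g := by simp only [hgdef]; fun_prop
  have hd : Integrable d := integrable_cexp_neg_mul_exp hp hc
  have hsinc : Real.sin (c * π) = Real.sin (β * π) := by
    rw [hcdef, show (1 - β) * π = π - β * π by ring, Real.sin_pi_sub]
  have hdiff : ∀ t : ℝ, g (t + (-π : ℝ) * Complex.I) - g (t + (π : ℝ) * Complex.I) =
      -(2 * Complex.I * Real.sin (β * π)) * d t := fun t => by
    simp only [hgdef, hddef, cexp_sub_pi_mul_I, cexp_add_pi_mul_I]
    rw [← hsinc, ← cexp_sub_cexp_neg, mul_add, mul_add, Complex.exp_add, Complex.exp_add]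
    push_cast
    ring_nf
  have hstrip : ∀ a : ℝ, -(2 * Complex.I * Real.sin (β * π)) * (∫ t in a..b, d t) =
      Complex.I * (∫ φ in -π..π, g (a + φ * Complex.I)) -
        Complex.I * ∫ φ in -π..π, g (b + φ * Complex.I) := fun a => by
    rw [← integral_strip_boundary hgd.differentiableOn, ← intervalIntegral.integral_const_mul,
      ← intervalIntegral.integral_sub]
    · exact intervalIntegral.integral_congr fun t _ => (hdiff t).symm
    · exact (hgd.continuous.comp (by fun_prop)).intervalIntegrable _ _
    · exact (hgd.continuous.comp (by fun_prop)).intervalIntegrable _ _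
  have hleft : Tendsto (fun a : ℝ => Complex.I * ∫ φ in -π..π, g (a + φ * Complex.I))
      atBot (𝓝 0) := by
    rw [tendsto_zero_iff_norm_tendsto_zero]
    have hlim : Tendsto (fun a : ℝ => Real.exp (‖p‖ * Real.exp a) * Real.exp (c * a) * |π - -π|)
        atBot (𝓝 (Real.exp (‖p‖ * 0) * 0 * |π - -π|)) := by
      refine Tendsto.mul_const _ (Tendsto.mul ?_ ?_)
      · exact (Real.continuous_exp.tendsto _).comp (Real.tendsto_exp_atBot.const_mul _)
      · exact Real.tendsto_exp_atBot.comp (tendsto_id.const_mul_atBot hc)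
    refine squeeze_zero (fun _ => norm_nonneg _) (fun a => ?_) (by simpa using hlim)
    rw [norm_mul, Complex.norm_I, one_mul]
    refine (intervalIntegral.norm_integral_le_of_norm_le_const
      (C := Real.exp (‖p‖ * Real.exp a) * Real.exp (c * a)) fun φ _ => ?_).trans_eq (by simp)
    simp only [hgdef]
    rw [norm_mul]
    refine mul_le_mul ((Complex.norm_exp_le_exp_norm _).trans_eq ?_) ?_ (norm_nonneg _)
      (Real.exp_pos _).le
    · simp [Complex.norm_exp]
    · rw [Complex.norm_exp]; simp
  have h1 := ((intervalIntegral_tendsto_integral_Iic b hd.integrableOn tendsto_id).const_mul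
    (-(2 * Complex.I * (Real.sin (β * π) : ℂ))))
  have h2 := hleft.sub_const (Complex.I * ∫ φ in -π..π, g (b + φ * Complex.I))
  have h3 := tendsto_nhds_unique (h1.congr fun a => hstrip a) h2
  have h4 : (∫ t in Iic b, d t) + ∫ t in Ioi b, d t = Real.Gamma c * Complex.exp (-(c * u)) := by
    rw [intervalIntegral.integral_Iic_add_Ioi hd.integrableOn hd.integrableOn]
    exact integral_cexp_neg_mul_exp hu hc
  have h5 : (Real.sin (β * π) : ℂ) * Real.Gamma c = π / Real.Gamma β := by
    have := sin_mul_Gamma_one_sub hβ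
    rw [mul_comm π] at this
    exact_mod_cast this
  have h6 : Complex.exp ((β - 1) * u) = Complex.exp (-(c * u)) := by
    rw [hcdef]; push_cast; ring_nf
  rw [h6]
  change (∫ φ in -π..π, g (b + φ * Complex.I)) + 2 * Real.sin (β * π) * (∫ t in Ioi b, d t) = _
  generalize (∫ φ in -π..π, g (b + φ * Complex.I)) = A at h3 ⊢
  generalize (∫ t in Iic b, d t) = L at h3 h4
  linear_combination -Complex.I * h3 + (A - 2 * Real.sin (β * π) * L) * Complex.I_mul_I +
    2 * Real.sin (β * π) * h4 + 2 * Complex.exp (-(c * u)) * h5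

lemma integral_arc_cexp (p : ℂ) (b : ℝ) :
    ∫ φ in -π..π, Complex.exp (p * Complex.exp (b + φ * Complex.I)) = 2 * π := by
  set F : ℝ → ℂ := fun r => ∫ φ in -π..π, Complex.exp (p * (r * Complex.exp (φ * Complex.I)))
    with hF
  have hFc : Continuous F :=
    intervalIntegral.continuous_parametric_intervalIntegral_of_continuous' (by fun_prop) _ _
  set g : ℂ → ℂ := fun w => Complex.exp (p * Complex.exp w) with hgdef
  have hgd : Differentiable ℂ g := by simp only [hgdef]; fun_prop
  have hFg : ∀ a : ℝ, F (Real.exp a) = ∫ φ in -π..π, g (a + φ * Complex.I) := fun a => by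
    simp only [hF, hgdef]
    refine intervalIntegral.integral_congr fun φ _ => ?_
    simp only [Complex.exp_add, Complex.ofReal_exp]
  have hconst : ∀ a : ℝ, F (Real.exp a) = F (Real.exp b) := fun a => by
    have h := integral_strip_boundary (y₁ := -π) (y₂ := π) hgd.differentiableOn a b
    rw [← hFg, ← hFg] at h
    have h0 : ∀ t : ℝ, g (t + (-π : ℝ) * Complex.I) = g (t + (π : ℝ) * Complex.I) := fun t => by
      simp only [hgdef, cexp_sub_pi_mul_I, cexp_add_pi_mul_I]
    simp only [h0, sub_self] at h
    exact mul_left_cancel₀ Complex.I_ne_zero (sub_eq_zero.1 h.symm)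
  have h1 : Tendsto (fun a : ℝ => F (Real.exp a)) atBot (𝓝 (F 0)) :=
    (hFc.tendsto 0).comp Real.tendsto_exp_atBot
  have h2 : F (Real.exp b) = F 0 :=
    tendsto_nhds_unique (tendsto_const_nhds.congr fun a => (hconst a).symm) h1
  rw [hFg] at h2
  rw [h2]
  simp [hF]
  ring

/-- One integration by parts along the Hankel contour. -/
lemma hankel_step {p : ℂ} (hp : 0 < p.re) (b β : ℝ) :
    β * ((∫ φ in -π..π, Complex.exp (p * Complex.exp (b + φ * Complex.I)) *
        Complex.exp ((1 - (β + 1) : ℝ) * (b + φ * Complex.I))) +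
      2 * Real.sin ((β + 1) * π) * ∫ t in Ioi b, Complex.exp (-(p * Real.exp t)) *
        Complex.exp ((1 - (β + 1) : ℝ) * t)) =
    p * ((∫ φ in -π..π, Complex.exp (p * Complex.exp (b + φ * Complex.I)) *
        Complex.exp ((1 - β : ℝ) * (b + φ * Complex.I))) +
      2 * Real.sin (β * π) * ∫ t in Ioi b, Complex.exp (-(p * Real.exp t)) *
        Complex.exp ((1 - β : ℝ) * t)) := by
  set G : ℂ → ℂ := fun w => Complex.exp (p * Complex.exp w) * Complex.exp (-β * w) with hG
  set A₁ : ℂ → ℂ := fun w => Complex.exp (p * Complex.exp w) * Complex.exp ((1 - β : ℝ) * w)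
    with hA₁
  set A₂ : ℂ → ℂ := fun w => Complex.exp (p * Complex.exp w) * Complex.exp ((1 - (β + 1) : ℝ) * w)
    with hA₂
  have hA₁c : Continuous A₁ := by simp only [hA₁]; fun_prop
  have hA₂c : Continuous A₂ := by simp only [hA₂]; fun_prop
  have hGd : ∀ w, HasDerivAt G (p * A₁ w - β * A₂ w) w := fun w => by
    have h := ((((Complex.hasDerivAt_exp w).const_mul p).cexp)).mul
      (((hasDerivAt_id w).const_mul (-β : ℂ)).cexp)
    refine h.congr_deriv ?_
    simp only [hA₁, hA₂, id]
    rw [show ((1 - β : ℝ) : ℂ) * w = w + -β * w by push_cast; ring,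
      show ((1 - (β + 1) : ℝ) : ℂ) * w = -β * w by push_cast; ring, Complex.exp_add]
    ring
  have harc : p * (∫ φ in -π..π, A₁ (b + φ * Complex.I)) -
      β * (∫ φ in -π..π, A₂ (b + φ * Complex.I)) =
      -Complex.I * (G (b + (π : ℝ) * Complex.I) - G (b + (-π : ℝ) * Complex.I)) := by
    have hder : ∀ φ : ℝ, HasDerivAt (fun φ : ℝ => -Complex.I * G (b + φ * Complex.I))
        (p * A₁ (b + φ * Complex.I) - β * A₂ (b + φ * Complex.I)) φ := fun φ => by
      have h1 : HasDerivAt (fun φ : ℝ => (b : ℂ) + φ * Complex.I) (1 * Complex.I) φ :=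
        ((Complex.ofRealCLM.hasDerivAt (x := φ)).mul_const Complex.I).const_add (b : ℂ)
      have h2 := ((hGd (b + φ * Complex.I)).comp φ h1).const_mul (-Complex.I)
      refine h2.congr_deriv ?_
      linear_combination -(p * A₁ (b + φ * Complex.I) - β * A₂ (b + φ * Complex.I)) *
        Complex.I_mul_I
    have h := intervalIntegral.integral_eq_sub_of_hasDerivAt (a := -π) (b := π)
      (fun φ _ => hder φ) (Continuous.intervalIntegrable (by fun_prop) _ _)
    rw [intervalIntegral.integral_sub, intervalIntegral.integral_const_mul,
      intervalIntegral.integral_const_mul] at h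
    · rw [h]; ring
    · exact Continuous.intervalIntegrable (by fun_prop) _ _
    · exact Continuous.intervalIntegrable (by fun_prop) _ _
  set d₁ : ℝ → ℂ := fun t => Complex.exp (-(p * Real.exp t)) * Complex.exp ((1 - β : ℝ) * t)
    with hd₁
  set d₂ : ℝ → ℂ := fun t => Complex.exp (-(p * Real.exp t)) * Complex.exp ((1 - (β + 1) : ℝ) * t)
    with hd₂
  set E : ℝ → ℂ := fun t => Complex.exp (-(p * Real.exp t)) * Complex.exp ((-β : ℝ) * t) with hE
  have hI₁ : IntegrableOn d₁ (Ioi b) := integrableOn_Ioi_cexp_neg_mul_exp hp _ b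
  have hI₂ : IntegrableOn d₂ (Ioi b) := integrableOn_Ioi_cexp_neg_mul_exp hp _ b
  have htail : -p * (∫ t in Ioi b, d₁ t) - β * (∫ t in Ioi b, d₂ t) = -E b := by
    have hder : ∀ t : ℝ, HasDerivAt E (-p * d₁ t - β * d₂ t) t := fun t => by
      have h := (((((Real.hasDerivAt_exp t).ofReal_comp).const_mul p).neg.cexp)).mul
        (((Complex.ofRealCLM.hasDerivAt (x := t)).const_mul ((-β : ℝ) : ℂ)).cexp)
      refine h.congr_deriv ?_
      simp only [hd₁, hd₂, Complex.ofRealCLM_apply, Pi.neg_apply]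
      rw [show ((1 - β : ℝ) : ℂ) * t = t + (-β : ℝ) * t by push_cast; ring,
        show ((1 - (β + 1) : ℝ) : ℂ) * t = (-β : ℝ) * t by push_cast; ring, Complex.exp_add]
      push_cast
      ring
    have hlim : Tendsto E atTop (𝓝 0) := by
      rw [tendsto_zero_iff_norm_tendsto_zero]
      refine (tendsto_exp_neg_mul_exp_atTop hp (-β)).congr fun t => ?_
      simp only [hE]
      rw [norm_mul, norm_exp_neg_mul_ofReal, norm_exp_real_mul]
    have h := integral_Ioi_of_hasDerivAt_of_tendsto (hder b).continuousAt.continuousWithinAt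
      (fun t _ => hder t) ((hI₁.const_mul (-p)).sub (hI₂.const_mul (β : ℂ))) hlim
    rw [integral_sub (hI₁.const_mul _) (hI₂.const_mul _), integral_const_mul,
      integral_const_mul] at h
    rw [h, zero_sub]
  have hGE : G (b + (π : ℝ) * Complex.I) - G (b + (-π : ℝ) * Complex.I) =
      -(2 * Complex.I * Real.sin (β * π)) * E b := by
    simp only [hG, hE, cexp_sub_pi_mul_I, cexp_add_pi_mul_I]
    rw [← cexp_sub_cexp_neg, mul_add, mul_add, Complex.exp_add, Complex.exp_add]
    push_cast
    ring_nf
  have hsin : Real.sin ((β + 1) * π) = -Real.sin (β * π) := by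
    rw [add_mul, one_mul, Real.sin_add_pi]
  rw [hGE] at harc
  change β * ((∫ φ in -π..π, A₂ (b + φ * Complex.I)) +
    2 * Real.sin ((β + 1) * π) * ∫ t in Ioi b, d₂ t) =
    p * ((∫ φ in -π..π, A₁ (b + φ * Complex.I)) + 2 * Real.sin (β * π) * ∫ t in Ioi b, d₁ t)
  rw [hsin]
  push_cast at harc ⊢
  linear_combination -harc + 2 * Complex.sin (β * π) * htail -
    2 * Complex.sin (β * π) * E b * Complex.I_mul_I

lemma hankel {u : ℂ} (hu : |u.im| < π / 2) (b : ℝ) {β : ℝ} (hβ : 0 < β) :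
    (∫ φ in -π..π, Complex.exp (Complex.exp u * Complex.exp (b + φ * Complex.I)) *
        Complex.exp ((1 - β : ℝ) * (b + φ * Complex.I))) +
      2 * Real.sin (β * π) * ∫ t in Ioi b, Complex.exp (-(Complex.exp u * Real.exp t)) *
        Complex.exp ((1 - β : ℝ) * t) =
      2 * π * (Complex.exp ((β - 1) * u) / Real.Gamma β) := by
  have key : ∀ n : ℕ, ∀ β : ℝ, 0 < β → β ≤ n + 1 →
    (∫ φ in -π..π, Complex.exp (Complex.exp u * Complex.exp (b + φ * Complex.I)) *
        Complex.exp ((1 - β : ℝ) * (b + φ * Complex.I))) +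
      2 * Real.sin (β * π) * ∫ t in Ioi b, Complex.exp (-(Complex.exp u * Real.exp t)) *
        Complex.exp ((1 - β : ℝ) * t) =
      2 * π * (Complex.exp ((β - 1) * u) / Real.Gamma β) := by
    intro n
    induction n with
    | zero =>
      intro β h0 h1
      rcases eq_or_lt_of_le h1 with h | h
      · have hb1 : β = 1 := by simpa using h
        subst hb1
        have := integral_arc_cexp (Complex.exp u) b
        simpa using this
      · exact hankel_base hu b (by simpa using h)
    | succ n ih =>
      intro β h0 h1
      by_cases hb : β ≤ 1
      · exact ih β h0 (by have : (0 : ℝ) ≤ n := n.cast_nonneg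
                          linarith)
      · push Not at hb
        have hpos : 0 < β - 1 := by linarith
        have h := ih (β - 1) hpos (by push_cast at h1; linarith)
        have hs := hankel_step (exp_re_pos hu) b (β - 1)
        rw [h, sub_add_cancel] at hs
        have hne : ((β - 1 : ℝ) : ℂ) ≠ 0 := by exact_mod_cast hpos.ne'
        refine mul_left_cancel₀ hne (hs.trans ?_)
        have hG : Real.Gamma β = (β - 1) * Real.Gamma (β - 1) := by
          have := Real.Gamma_add_one hpos.ne'
          rwa [sub_add_cancel] at this
        have hG0 : (Real.Gamma (β - 1) : ℂ) ≠ 0 := by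
          exact_mod_cast (Real.Gamma_pos_of_pos hpos).ne'
        rw [hG, show ((β : ℂ) - 1) * u = u + (((β - 1 : ℝ) : ℂ) - 1) * u by push_cast; ring,
          Complex.exp_add]
        push_cast at hne ⊢
        field_simp
  obtain ⟨n, hn⟩ := exists_nat_ge β
  exact key n β hβ (by linarith)

/-! ### The pole of the kernel -/

lemma HasSum.of_eq {M : Type*} [AddCommMonoid M] [TopologicalSpace M] {f g : ℕ → M} {a b : M}
    (h : HasSum f a) (hfg : ∀ n, f n = g n) (hab : a = b) : HasSum g b :=
  hab ▸ (funext hfg : f = g) ▸ h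

lemma hasSum_geometric_exp_neg {α : ℝ} (hα : 0 < α) {w : ℂ} (hw : 0 < w.re) :
    HasSum (fun n : ℕ => Complex.exp ((1 - α * ((n : ℝ) + 1) : ℝ) * w))
      (Complex.exp w / (Complex.exp (α * w) - 1)) := by
  have hq : ‖Complex.exp (-(α * w))‖ < 1 := by
    rw [Complex.norm_exp, Real.exp_lt_one_iff]; simp; positivity
  have h := (hasSum_geometric_of_norm_lt_one hq).mul_left
    (Complex.exp w * Complex.exp (-(α * w)))
  have hne : (1 : ℂ) - Complex.exp (-(α * w)) ≠ 0 := fun h0 => by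
    rw [← sub_eq_zero.1 h0] at hq; simp at hq
  have h1 : Complex.exp (α * w) * Complex.exp (-(α * w)) = 1 := by
    rw [← Complex.exp_add]; simp
  have hne' : Complex.exp (α * w) - 1 ≠ 0 := fun h0 => hne (by
    rw [sub_eq_zero.1 h0, one_mul] at h1
    rw [h1, sub_self])
  have h2 : Complex.exp w * Complex.exp (-(α * w)) * (1 - Complex.exp (-(α * w)))⁻¹ =
      Complex.exp w / (Complex.exp (α * w) - 1) := by
    rw [← div_eq_mul_inv, div_eq_div_iff hne hne']
    linear_combination Complex.exp w * h1
  rw [h2] at h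
  refine h.of_eq (fun n => ?_) rfl
  rw [← Complex.exp_nat_mul, ← Complex.exp_add, ← Complex.exp_add]
  push_cast
  ring_nf

lemma hasSum_arc {α b : ℝ} (hα : 0 < α) (hb : 0 < b) (p : ℂ) :
    HasSum (fun n : ℕ => ∫ φ in -π..π, Complex.exp (p * Complex.exp (b + φ * Complex.I)) *
        Complex.exp ((1 - α * ((n : ℝ) + 1) : ℝ) * (b + φ * Complex.I)))
      (∫ φ in -π..π, Complex.exp (p * Complex.exp (b + φ * Complex.I)) *
        (Complex.exp (b + φ * Complex.I) / (Complex.exp (α * (b + φ * Complex.I)) - 1))) := by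
  have hsum : Summable fun n : ℕ => Real.exp ((1 - α * ((n : ℝ) + 1)) * b) := by
    have := (hasSum_geometric_exp_neg hα (w := (b : ℂ)) (by simpa using hb)).summable.norm
    refine this.congr fun n => ?_
    exact norm_exp_real_mul _ _
  have h := hasSum_integral_of_sum_norm_le (μ := volume.restrict (Ioc (-π) π))
    (F := fun n (φ : ℝ) => Complex.exp (p * Complex.exp (b + φ * Complex.I)) *
        Complex.exp ((1 - α * ((n : ℝ) + 1) : ℝ) * (b + φ * Complex.I)))
    (g := fun _ => Real.exp (‖p‖ * Real.exp b) * ∑' n : ℕ, Real.exp ((1 - α * ((n : ℝ) + 1)) * b))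
    (fun n => Continuous.aestronglyMeasurable (by fun_prop)) (integrable_const _)
    (ae_of_all _ fun φ s => ?_)
  · simp only [intervalIntegral.integral_of_le (neg_le_self Real.pi_pos.le)]
    refine h.of_eq (fun _ => rfl) (integral_congr_ae (ae_of_all _ fun φ => ?_))
    simp only
    rw [tsum_mul_left, (hasSum_geometric_exp_neg hα (by simpa using hb)).tsum_eq]
  · have h1 : ∀ n : ℕ, ‖Complex.exp (p * Complex.exp (b + φ * Complex.I)) *
        Complex.exp ((1 - α * ((n : ℝ) + 1) : ℝ) * (b + φ * Complex.I))‖ ≤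
        Real.exp (‖p‖ * Real.exp b) * Real.exp ((1 - α * ((n : ℝ) + 1)) * b) := fun n => by
      rw [norm_mul]
      refine mul_le_mul ((Complex.norm_exp_le_exp_norm _).trans_eq ?_) (le_of_eq ?_)
        (norm_nonneg _) (Real.exp_pos _).le
      · simp [Complex.norm_exp]
      · rw [Complex.norm_exp]; simp
    refine (Finset.sum_le_sum fun n _ => h1 n).trans ?_
    rw [← Finset.mul_sum]
    exact mul_le_mul_of_nonneg_left (hsum.sum_le_tsum s fun _ _ => (Real.exp_pos _).le)
      (Real.exp_pos _).le

lemma hasSum_cexp (z : ℂ) : HasSum (fun n : ℕ => z ^ n / (n.factorial : ℂ)) (Complex.exp z) := by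
  rw [Complex.exp_eq_exp_ℂ]
  exact NormedSpace.expSeries_div_hasSum_exp z

lemma integral_arc_pole {u : ℂ} (hu : |u.im| < π / 2) {b : ℝ} (hb : 0 < b) :
    ∫ φ in -π..π, Complex.exp (Complex.exp u * Complex.exp (b + φ * Complex.I)) *
        (Complex.exp (b + φ * Complex.I) / (Complex.exp (b + φ * Complex.I) - 1)) =
      2 * π * Complex.exp (Complex.exp u) := by
  have h1 := hasSum_arc one_pos hb (Complex.exp u)
  have h2 := (hasSum_cexp (Complex.exp u)).mul_left (2 * π : ℂ)
  simp only [Complex.ofReal_one, one_mul] at h1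
  refine h1.unique (h2.of_eq (fun n => ?_) rfl)
  have h := hankel hu b (β := (n : ℝ) + 1) (by positivity)
  have hs : Real.sin (((n : ℝ) + 1) * π) = 0 := by exact_mod_cast Real.sin_nat_mul_pi (n + 1)
  rw [hs, Real.Gamma_nat_eq_factorial] at h
  rw [← Complex.exp_nat_mul]
  simpa using h.symm

/-- The function `e^w / (e^{αw} - 1) - e^w / (α (e^w - 1))`, with its singularity at `0`
removed. -/
noncomputable def poleFree (α : ℝ) (w : ℂ) : ℂ :=
  Complex.exp w * dslope (fun z => α * dslope Complex.exp 0 z -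
    dslope (fun z => Complex.exp (α * z)) 0 z) 0 w /
    (α * dslope (fun z => Complex.exp (α * z)) 0 w * dslope Complex.exp 0 w)

lemma differentiable_dslope {f : ℂ → ℂ} (hf : Differentiable ℂ f) (c : ℂ) :
    Differentiable ℂ (dslope f c) := by
  rw [← differentiableOn_univ] at hf ⊢
  exact (Complex.differentiableOn_dslope univ_mem).2 hf

lemma hasDerivAt_cexp_const_mul_zero (α : ℝ) :
    HasDerivAt (fun z : ℂ => Complex.exp (α * z)) α 0 := by
  simpa using ((hasDerivAt_id (0 : ℂ)).const_mul (α : ℂ)).cexp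

lemma cexp_mul_ne_one {α : ℝ} (h0 : 0 < α) (h2 : α < 2) {w : ℂ} (hw : w ≠ 0) (him : |w.im| ≤ π) :
    Complex.exp (α * w) - 1 ≠ 0 := fun h => by
  obtain ⟨k, hk⟩ := Complex.exp_eq_one_iff.1 (sub_eq_zero.1 h)
  have him2 := congrArg Complex.im hk
  simp at him2
  have hk0 : k = 0 := by
    have h3 : |(k : ℝ)| * (2 * π) < 1 * (2 * π) := by
      rw [← abs_of_pos (by positivity : (0 : ℝ) < 2 * π), ← abs_mul, ← him2, abs_mul,
        abs_of_pos h0, abs_of_pos (by positivity : (0 : ℝ) < 2 * π)]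
      nlinarith [Real.pi_pos]
    have h4 : |(k : ℝ)| < 1 := lt_of_mul_lt_mul_right h3 (by positivity)
    rw [← Int.cast_abs] at h4
    exact Int.abs_lt_one_iff.1 (by exact_mod_cast h4)
  rw [hk0] at hk
  have hα : (α : ℂ) ≠ 0 := by exact_mod_cast h0.ne'
  simp [hα, hw] at hk

lemma poleFree_eq {α : ℝ} (h0 : 0 < α) (h2 : α < 2) {w : ℂ} (hw : w ≠ 0) (him : |w.im| ≤ π) :
    poleFree α w = Complex.exp w / (Complex.exp (α * w) - 1) -
      1 / α * (Complex.exp w / (Complex.exp w - 1)) := by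
  have hα : (α : ℂ) ≠ 0 := by exact_mod_cast h0.ne'
  have h3 := cexp_mul_ne_one h0 h2 hw him
  have h4 : Complex.exp w - 1 ≠ 0 := by
    simpa using cexp_mul_ne_one one_pos one_lt_two hw him
  have hd := (hasDerivAt_cexp_const_mul_zero α).deriv
  have hd' : deriv Complex.exp 0 = 1 := by simp
  simp only [poleFree, dslope_of_ne _ hw, dslope_same, slope_def_field, hd, hd']
  simp
  field_simp

lemma differentiableOn_poleFree {α : ℝ} (h0 : 0 < α) (h2 : α < 2) :
    DifferentiableOn ℂ (poleFree α) {w | |w.im| ≤ π} := by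
  have hα : (α : ℂ) ≠ 0 := by exact_mod_cast h0.ne'
  have hA : Differentiable ℂ (dslope (fun z : ℂ => Complex.exp (α * z)) 0) :=
    differentiable_dslope (by fun_prop) 0
  have hB : Differentiable ℂ (dslope Complex.exp 0) := differentiable_dslope (by fun_prop) 0
  have hn := differentiable_dslope ((hB.const_mul (α : ℂ)).sub hA) 0
  have hnum := (Complex.differentiable_exp.mul hn).differentiableOn (s := {w | |w.im| ≤ π})
  refine hnum.div (((hA.const_mul (α : ℂ)).mul hB).differentiableOn) fun w hw => ?_
  rcases eq_or_ne w 0 with rfl | hw0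
  · simp [(hasDerivAt_cexp_const_mul_zero α).deriv, hα]
  · have h3 := cexp_mul_ne_one h0 h2 hw0 hw
    have h4 : Complex.exp w - 1 ≠ 0 := by
      simpa using cexp_mul_ne_one one_pos one_lt_two hw0 hw
    simp only [dslope_of_ne _ hw0, slope_def_field]
    simpa [hα, hw0] using ⟨h3, h4⟩

/-- The kernel `s ^ α / (s ^ (2α) - 2 s ^ α cos (πα) + 1)` at `s = exp t`. -/
noncomputable def kernelExp (α t : ℝ) : ℝ :=
  Real.exp (α * t) / (Real.exp (α * t) ^ 2 - 2 * Real.exp (α * t) * Real.cos (π * α) + 1)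

lemma kernel_denom_pos {θ : ℝ} (hs : Real.sin θ ≠ 0) (y : ℝ) :
    0 < y ^ 2 - 2 * y * Real.cos θ + 1 := by
  nlinarith [Real.sin_sq_add_cos_sq θ, sq_nonneg (y - Real.cos θ), pow_pos (abs_pos.2 hs) 2,
    sq_abs (Real.sin θ)]

lemma sin_pi_mul_ne_zero_of_lt {α : ℝ} (h1 : 1 < α) (h2 : α < 2) : Real.sin (π * α) ≠ 0 := by
  have : 0 < Real.sin (π * α - π) :=
    Real.sin_pos_of_pos_of_lt_pi (by nlinarith [Real.pi_pos]) (by nlinarith [Real.pi_pos])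
  rw [Real.sin_sub_pi] at this
  linarith

lemma poleFree_jump {α : ℝ} (h1 : 1 < α) (h2 : α < 2) (t : ℝ) :
    poleFree α (t + (-π : ℝ) * Complex.I) - poleFree α (t + (π : ℝ) * Complex.I) =
      -(2 * Complex.I * Real.sin (π * α)) * (Real.exp t * kernelExp α t : ℝ) := by
  have hpi := Real.pi_pos
  have e1 : ∀ c : ℝ, Complex.exp (α * (t + c * Complex.I)) =
      Real.exp (α * t) * (Complex.cos (c * α) + Complex.sin (c * α) * Complex.I) := fun c => by
    rw [← Complex.exp_mul_I, Complex.ofReal_exp, ← Complex.exp_add]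
    push_cast
    ring_nf
  have hne : ∀ c : ℝ, c ≠ 0 → (t + c * Complex.I : ℂ) ≠ 0 := fun c hc h => by
    have := congrArg Complex.im h
    simp [hc] at this
  have n1 := cexp_mul_ne_one (by linarith) h2 (hne (-π) (by linarith)) (by simp [abs_of_pos hpi])
  have n2 := cexp_mul_ne_one (by linarith) h2 (hne π (by linarith)) (by simp [abs_of_pos hpi])
  rw [poleFree_eq (by linarith) h2 (hne _ (by linarith)) (by simp [abs_of_pos hpi]),
    poleFree_eq (by linarith) h2 (hne _ (by linarith)) (by simp [abs_of_pos hpi]),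
    cexp_sub_pi_mul_I, cexp_add_pi_mul_I, sub_sub_sub_cancel_right]
  have hD := (kernel_denom_pos (sin_pi_mul_ne_zero_of_lt h1 h2) (Real.exp (α * t))).ne'
  have hD' : ((Real.exp (α * t) ^ 2 - 2 * Real.exp (α * t) * Real.cos (π * α) + 1 : ℝ) : ℂ) ≠ 0 :=
    by exact_mod_cast hD
  rw [e1] at n1 n2 ⊢
  rw [e1, kernelExp]
  push_cast at n1 n2 hD' ⊢
  simp only [neg_mul, Complex.cos_neg, Complex.sin_neg] at n1 n2 ⊢
  have hsc := Complex.sin_sq_add_cos_sq (π * α)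
  generalize Complex.cos (π * α) = C at *
  generalize Complex.sin (π * α) = S at *
  generalize Complex.exp (α * t) = y at *
  rw [div_sub_div _ _ n1 n2, ← mul_div_assoc, ← mul_div_assoc, ← neg_div,
    div_eq_div_iff (mul_ne_zero n1 n2) hD']
  have hI := Complex.I_mul_I
  have : (y * (C + -(S * Complex.I)) - 1) * (y * (C + S * Complex.I) - 1) =
      y ^ 2 - 2 * y * C + 1 := by
    linear_combination y ^ 2 * hsc - y ^ 2 * S ^ 2 * hI
  rw [this]
  ring

lemma kernelExp_nonneg {α : ℝ} (h1 : 1 < α) (h2 : α < 2) (t : ℝ) : 0 ≤ kernelExp α t :=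
  div_nonneg (Real.exp_pos _).le (kernel_denom_pos (sin_pi_mul_ne_zero_of_lt h1 h2) _).le

lemma kernelExp_le {α : ℝ} (h1 : 1 < α) (h2 : α < 2) (t : ℝ) :
    kernelExp α t ≤ Real.exp (α * t) / Real.sin (π * α) ^ 2 := by
  have hs := sin_pi_mul_ne_zero_of_lt h1 h2
  refine div_le_div_of_nonneg_left (Real.exp_pos _).le (by positivity) ?_
  nlinarith [Real.sin_sq_add_cos_sq (π * α), sq_nonneg (Real.exp (α * t) - Real.cos (π * α))]

lemma kernelExp_le' {α : ℝ} (h1 : 1 < α) (h2 : α < 2) (t : ℝ) :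
    kernelExp α t ≤ Real.exp (-(α * t)) / Real.sin (π * α) ^ 2 := by
  have hs := sin_pi_mul_ne_zero_of_lt h1 h2
  rw [kernelExp, div_le_div_iff₀ (kernel_denom_pos hs _) (by positivity)]
  have hy : Real.exp (α * t) * Real.exp (-(α * t)) = 1 := by rw [← Real.exp_add]; simp
  have hle : Real.sin (π * α) ^ 2 * Real.exp (α * t) ^ 2 ≤
      Real.exp (α * t) ^ 2 - 2 * Real.exp (α * t) * Real.cos (π * α) + 1 := by
    nlinarith [Real.sin_sq_add_cos_sq (π * α),
      sq_nonneg (Real.exp (α * t) * Real.cos (π * α) - 1)]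
  calc Real.exp (α * t) * Real.sin (π * α) ^ 2
      = Real.exp (-(α * t)) * (Real.sin (π * α) ^ 2 * Real.exp (α * t) ^ 2) := by
        linear_combination -Real.exp (α * t) * Real.sin (π * α) ^ 2 * hy
    _ ≤ _ := mul_le_mul_of_nonneg_left hle (Real.exp_pos _).le

lemma continuous_kernelExp {α : ℝ} (h1 : 1 < α) (h2 : α < 2) : Continuous (kernelExp α) := by
  unfold kernelExp
  refine Continuous.div (by fun_prop) (by fun_prop) fun t =>
    (kernel_denom_pos (sin_pi_mul_ne_zero_of_lt h1 h2) _).ne'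

lemma integrable_exp_mul_kernelExp {α : ℝ} (h1 : 1 < α) (h2 : α < 2) :
    Integrable fun t : ℝ => Real.exp t * kernelExp α t := by
  have hc := continuous_kernelExp h1 h2
  have hs := sin_pi_mul_ne_zero_of_lt h1 h2
  rw [← integrableOn_univ, ← Iic_union_Ioi (a := (0 : ℝ))]
  refine IntegrableOn.union ?_ ?_
  · refine ((integrableOn_exp_mul_Iic (a := 1 + α) (by linarith) 0).div_const
      (Real.sin (π * α) ^ 2)).mono' (by fun_prop) (ae_of_all _ fun t => ?_)
    rw [Real.norm_of_nonneg (mul_nonneg (Real.exp_pos _).le (kernelExp_nonneg h1 h2 t)), add_mul,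
      one_mul, Real.exp_add, mul_div_assoc]
    exact mul_le_mul_of_nonneg_left (kernelExp_le h1 h2 t) (Real.exp_pos _).le
  · refine ((integrableOn_exp_mul_Ioi (a := 1 - α) (by linarith) 0).div_const
      (Real.sin (π * α) ^ 2)).mono' (by fun_prop) (ae_of_all _ fun t => ?_)
    rw [Real.norm_of_nonneg (mul_nonneg (Real.exp_pos _).le (kernelExp_nonneg h1 h2 t)), sub_mul,
      one_mul, sub_eq_add_neg, Real.exp_add, mul_div_assoc]
    exact mul_le_mul_of_nonneg_left (kernelExp_le' h1 h2 t) (Real.exp_pos _).le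

lemma integrable_cexp_mul_kernelExp {α : ℝ} (h1 : 1 < α) (h2 : α < 2) {p : ℂ} (hp : 0 ≤ p.re) :
    Integrable fun t : ℝ => Complex.exp (-(p * Real.exp t)) * (Real.exp t * kernelExp α t : ℝ) := by
  have hc := continuous_kernelExp h1 h2
  refine (integrable_exp_mul_kernelExp h1 h2).mono' (by fun_prop) (ae_of_all _ fun t => ?_)
  rw [norm_mul, norm_exp_neg_mul_ofReal, Complex.norm_real,
    Real.norm_of_nonneg (mul_nonneg (Real.exp_pos _).le (kernelExp_nonneg h1 h2 t))]
  exact mul_le_of_le_one_left (mul_nonneg (Real.exp_pos _).le (kernelExp_nonneg h1 h2 t))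
    (Real.exp_le_one_iff.2 (by have := Real.exp_pos t; simp; positivity))

lemma norm_div_cexp_sub_one_le {c a : ℝ} (hc : 0 < c) (ha : a < 0) (φ : ℝ) :
    ‖Complex.exp (a + φ * Complex.I) / (Complex.exp (c * (a + φ * Complex.I)) - 1)‖ ≤
      Real.exp a / (1 - Real.exp (c * a)) := by
  have h1 : Real.exp (c * a) < 1 := Real.exp_lt_one_iff.2 (by nlinarith)
  rw [norm_div, Complex.norm_exp]
  simp only [Complex.add_re, Complex.ofReal_re, Complex.mul_re, Complex.I_re, mul_zero,
    Complex.ofReal_im, Complex.I_im, mul_one, sub_zero, add_zero]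
  refine div_le_div_of_nonneg_left (Real.exp_pos _).le (by linarith) ?_
  rw [norm_sub_rev]
  refine le_trans (le_of_eq ?_) (norm_sub_norm_le _ _)
  rw [norm_one, Complex.norm_exp]
  simp

/-- The arc integral of the kernel `e^w / (e^{αw} - 1)`, in terms of its residue at `0` and its
jump across the cut. -/
lemma integral_arc_kernel {α : ℝ} (h1 : 1 < α) (h2 : α < 2) {u : ℂ} (hu : |u.im| < π / 2) {b : ℝ}
    (hb : 0 < b) :
    ∫ φ in -π..π, Complex.exp (Complex.exp u * Complex.exp (b + φ * Complex.I)) *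
        (Complex.exp (b + φ * Complex.I) / (Complex.exp (α * (b + φ * Complex.I)) - 1)) =
      2 * π / α * Complex.exp (Complex.exp u) + 2 * Real.sin (π * α) *
        ∫ t in Iic b, Complex.exp (-(Complex.exp u * Real.exp t)) *
          (Real.exp t * kernelExp α t : ℝ) := by
  have h0 : 0 < α := by linarith
  have hpi := Real.pi_pos
  set p := Complex.exp u with hpdef
  have hp : 0 < p.re := exp_re_pos hu
  set g : ℂ → ℂ := fun w => Complex.exp (p * Complex.exp w) * poleFree α w with hgdef
  set d : ℝ → ℂ := fun t => Complex.exp (-(p * Real.exp t)) * (Real.exp t * kernelExp α t : ℝ)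
    with hddef
  have hstripset : {w : ℂ | w.im ∈ uIcc (-π) π} = {w | |w.im| ≤ π} := by
    ext w; simp [uIcc_of_le (neg_le_self hpi.le), abs_le]
  have hgd : DifferentiableOn ℂ g {w | w.im ∈ uIcc (-π) π} := by
    rw [hstripset]
    exact DifferentiableOn.mul (by fun_prop) (differentiableOn_poleFree h0 h2)
  have hline : ∀ y : ℝ, |y| ≤ π → Continuous fun t : ℝ => g (t + y * Complex.I) := fun y hy => by
    refine hgd.continuousOn.comp_continuous (by fun_prop) fun t => ?_
    rw [hstripset]; simpa using hy
  have harc : ∀ a : ℝ, ContinuousOn (fun φ : ℝ => g (a + φ * Complex.I)) (uIcc (-π) π) := fun a =>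
    hgd.continuousOn.comp (by fun_prop) fun φ hφ => by simpa using hφ
  have hd : Integrable d := integrable_cexp_mul_kernelExp h1 h2 hp.le
  have hdiff : ∀ t : ℝ, g (t + (-π : ℝ) * Complex.I) - g (t + (π : ℝ) * Complex.I) =
      -(2 * Complex.I * Real.sin (π * α)) * d t := fun t => by
    simp only [hgdef, hddef, cexp_sub_pi_mul_I, cexp_add_pi_mul_I]
    rw [← mul_sub, poleFree_jump h1 h2, mul_neg]
    ring
  have hstrip : ∀ a : ℝ, -(2 * Complex.I * Real.sin (π * α)) * (∫ t in a..b, d t) =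
      Complex.I * (∫ φ in -π..π, g (a + φ * Complex.I)) -
        Complex.I * ∫ φ in -π..π, g (b + φ * Complex.I) := fun a => by
    rw [← integral_strip_boundary hgd, ← intervalIntegral.integral_const_mul,
      ← intervalIntegral.integral_sub]
    · exact intervalIntegral.integral_congr fun t _ => (hdiff t).symm
    · exact (hline (-π) (by simp [abs_of_pos hpi])).intervalIntegrable _ _
    · exact (hline π (by simp [abs_of_pos hpi])).intervalIntegrable _ _
  have hval : ∀ a : ℝ, a ≠ 0 → ∀ φ ∈ uIcc (-π) π, g (a + φ * Complex.I) =
      Complex.exp (p * Complex.exp (a + φ * Complex.I)) *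
        (Complex.exp (a + φ * Complex.I) / (Complex.exp (α * (a + φ * Complex.I)) - 1)) -
      1 / α * (Complex.exp (p * Complex.exp (a + φ * Complex.I)) *
        (Complex.exp (a + φ * Complex.I) / (Complex.exp (a + φ * Complex.I) - 1))) := by
    intro a ha φ hφ
    simp only [hgdef]
    rw [poleFree_eq h0 h2]
    · ring
    · intro h
      have := congrArg Complex.re h
      simp [ha] at this
    · rw [uIcc_of_le (neg_le_self hpi.le)] at hφ
      simpa [abs_le] using hφ
  have hleft : Tendsto (fun a : ℝ => Complex.I * ∫ φ in -π..π, g (a + φ * Complex.I))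
      atBot (𝓝 0) := by
    rw [tendsto_zero_iff_norm_tendsto_zero]
    have hE : ∀ c : ℝ, 0 < c → Tendsto (fun a : ℝ => Real.exp (c * a)) atBot (𝓝 0) := fun c hc =>
      Real.tendsto_exp_atBot.comp (tendsto_id.const_mul_atBot hc)
    have hR : ∀ c : ℝ, 0 < c → Tendsto (fun a : ℝ => Real.exp a / (1 - Real.exp (c * a))) atBot
        (𝓝 (0 / (1 - 0))) := fun c hc =>
      Real.tendsto_exp_atBot.div ((hE c hc).const_sub 1) (by norm_num)
    have hlim : Tendsto (fun a : ℝ => Real.exp (‖p‖ * Real.exp a) *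
        (Real.exp a / (1 - Real.exp (α * a)) + 1 / α * (Real.exp a / (1 - Real.exp (1 * a)))) *
          |π - -π|) atBot
        (𝓝 (Real.exp (‖p‖ * 0) * (0 / (1 - 0) + 1 / α * (0 / (1 - 0))) * |π - -π|)) := by
      refine Tendsto.mul_const _ (Tendsto.mul ?_ ((hR α h0).add ((hR 1 one_pos).const_mul _)))
      exact (Real.continuous_exp.tendsto _).comp (Real.tendsto_exp_atBot.const_mul _)
    refine squeeze_zero' (Eventually.of_forall fun _ => norm_nonneg _) ?_ (by simpa using hlim)
    filter_upwards [eventually_lt_atBot 0] with a ha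
    rw [norm_mul, Complex.norm_I, one_mul]
    refine (intervalIntegral.norm_integral_le_of_norm_le_const
      (C := Real.exp (‖p‖ * Real.exp a) *
        (Real.exp a / (1 - Real.exp (α * a)) + 1 / α * (Real.exp a / (1 - Real.exp (1 * a)))))
      fun φ hφ => ?_).trans_eq (by simp)
    have hx : ‖Complex.exp (p * Complex.exp (a + φ * Complex.I))‖ ≤
        Real.exp (‖p‖ * Real.exp a) :=
      (Complex.norm_exp_le_exp_norm _).trans_eq (by simp [Complex.norm_exp])
    have hy1 := norm_div_cexp_sub_one_le h0 ha φ
    have hy2 := norm_div_cexp_sub_one_le one_pos ha φ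
    rw [Complex.ofReal_one, one_mul] at hy2
    rw [hval a ha.ne φ (uIoc_subset_uIcc hφ), mul_left_comm (1 / α : ℂ), ← mul_sub, norm_mul]
    refine mul_le_mul hx ((norm_sub_le _ _).trans (add_le_add hy1 ?_)) (norm_nonneg _)
      (Real.exp_pos _).le
    rw [norm_mul]
    refine mul_le_mul (le_of_eq ?_) hy2 (norm_nonneg _) (by positivity)
    simp [abs_of_pos h0]
  have h3 := tendsto_nhds_unique
    (((intervalIntegral_tendsto_integral_Iic b hd.integrableOn tendsto_id).const_mul
    (-(2 * Complex.I * (Real.sin (π * α) : ℂ)))).congr fun a => hstrip a)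
    (hleft.sub_const (Complex.I * ∫ φ in -π..π, g (b + φ * Complex.I)))
  have hbden : ∀ c : ℝ, 0 < c → ∀ φ : ℝ, Complex.exp (c * (b + φ * Complex.I)) - 1 ≠ 0 := by
    intro c hc φ h
    have h' := congrArg norm (sub_eq_zero.1 h)
    rw [Complex.norm_exp] at h'
    simp at h'
    exact hc.ne' (h'.resolve_right hb.ne')
  have hright : (∫ φ in -π..π, g (b + φ * Complex.I)) =
      (∫ φ in -π..π, Complex.exp (p * Complex.exp (b + φ * Complex.I)) *
        (Complex.exp (b + φ * Complex.I) / (Complex.exp (α * (b + φ * Complex.I)) - 1))) -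
      1 / α * (2 * π * Complex.exp p) := by
    rw [← integral_arc_pole hu hb, ← intervalIntegral.integral_const_mul,
      ← intervalIntegral.integral_sub]
    · exact intervalIntegral.integral_congr (hval b hb.ne')
    · refine Continuous.intervalIntegrable ?_ _ _
      exact Continuous.mul (by fun_prop) (Continuous.div (by fun_prop) (by fun_prop) (hbden α h0))
    · refine Continuous.intervalIntegrable ?_ _ _
      have := hbden 1 one_pos
      simp only [Complex.ofReal_one, one_mul] at this
      exact continuous_const.mul (Continuous.mul (by fun_prop)
        (Continuous.div (by fun_prop) (by fun_prop) this))
  rw [hright] at h3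
  change _ = _ + 2 * Real.sin (π * α) * (∫ t in Iic b, d t)
  generalize (∫ t in Iic b, d t) = L at h3 ⊢
  generalize (∫ φ in -π..π, Complex.exp (p * Complex.exp (b + φ * Complex.I)) *
        (Complex.exp (b + φ * Complex.I) / (Complex.exp (α * (b + φ * Complex.I)) - 1))) = X at *
  linear_combination -Complex.I * h3 + (X - 1 / α * (2 * π * Complex.exp p)
    - 2 * Real.sin (π * α) * L) * Complex.I_mul_I

lemma hasSum_kernelExp {α : ℝ} (h1 : 1 < α) (h2 : α < 2) {t : ℝ} (ht : 0 < t) :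
    HasSum (fun n : ℕ => (Real.sin (α * ((n : ℝ) + 1) * π) : ℂ) *
        Complex.exp ((1 - α * ((n : ℝ) + 1) : ℝ) * t))
      (Real.sin (π * α) * (Real.exp t * kernelExp α t : ℝ)) := by
  have h0 : 0 < α := by linarith
  have hpi := Real.pi_pos
  have hs : ∀ y : ℝ, |y| = π →
      HasSum (fun n : ℕ => Complex.exp ((1 - α * ((n : ℝ) + 1) : ℝ) * (t + y * Complex.I)))
        (poleFree α (t + y * Complex.I) +
          1 / α * (Complex.exp (t + y * Complex.I) / (Complex.exp (t + y * Complex.I) - 1))) := by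
    intro y hy
    have hne : (t + y * Complex.I : ℂ) ≠ 0 := fun h => by
      have := congrArg Complex.re h
      simp [ht.ne'] at this
    rw [poleFree_eq h0 h2 hne (by simp [hy]), sub_add_cancel]
    exact hasSum_geometric_exp_neg h0 (by simpa using ht)
  have h := ((hs (-π) (by simp [abs_of_pos hpi])).sub (hs π (abs_of_pos hpi))).mul_left
    (Complex.I / 2)
  refine h.of_eq (fun n => ?_) ?_
  · set c := 1 - α * ((n : ℝ) + 1) with hc
    have hsin : Real.sin (α * ((n : ℝ) + 1) * π) = Real.sin (c * π) := by
      rw [hc, sub_mul, one_mul, Real.sin_pi_sub]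
    have e := cexp_sub_cexp_neg c
    rw [hsin, mul_add, mul_add, Complex.exp_add, Complex.exp_add, ← mul_sub,
      show (c : ℂ) * ((-π : ℝ) * Complex.I) = -(c * π * Complex.I) by push_cast; ring,
      ← mul_assoc (c : ℂ), e]
    linear_combination -(Complex.exp (c * t) * Real.sin (c * π)) * Complex.I_mul_I
  · rw [cexp_sub_pi_mul_I, cexp_add_pi_mul_I, add_sub_add_right_eq_sub, poleFree_jump h1 h2]
    linear_combination -(Real.sin (π * α) * (Real.exp t * kernelExp α t : ℝ)) * Complex.I_mul_I

lemma hasSum_tail {α : ℝ} (h1 : 1 < α) (h2 : α < 2) {p : ℂ} (hp : 0 < p.re) {b : ℝ}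
    (hb : 0 < b) :
    HasSum (fun n : ℕ => 2 * Real.sin (α * ((n : ℝ) + 1) * π) *
        ∫ t in Ioi b, Complex.exp (-(p * Real.exp t)) *
          Complex.exp ((1 - α * ((n : ℝ) + 1) : ℝ) * t))
      (2 * Real.sin (π * α) * ∫ t in Ioi b, Complex.exp (-(p * Real.exp t)) *
        (Real.exp t * kernelExp α t : ℝ)) := by
  have h0 : 0 < α := by linarith
  have hsum : Summable fun n : ℕ => Real.exp (-α * b * ((n : ℝ) + 1)) := by
    have := ((summable_geometric_of_lt_one (Real.exp_pos (-α * b)).le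
      (Real.exp_lt_one_iff.2 (by nlinarith))).mul_left (Real.exp (-α * b)))
    refine this.congr fun n => ?_
    rw [← Real.exp_nat_mul, ← Real.exp_add]; ring_nf
  have h := hasSum_integral_of_sum_norm_le (μ := volume.restrict (Ioi b))
    (F := fun n (t : ℝ) => 2 * Real.sin (α * ((n : ℝ) + 1) * π) *
      (Complex.exp (-(p * Real.exp t)) * Complex.exp ((1 - α * ((n : ℝ) + 1) : ℝ) * t)))
    (g := fun t => 2 * (Real.exp (-(p.re * Real.exp t)) * Real.exp (1 * t)) *
      ∑' n : ℕ, Real.exp (-α * b * ((n : ℝ) + 1)))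
    (fun n => by fun_prop)
    (((integrableOn_Ioi_exp_neg_mul_exp hp 1 b).const_mul 2).mul_const _) ?_
  · refine h.of_eq (fun n => integral_const_mul _ _) ?_
    rw [← integral_const_mul]
    refine setIntegral_congr_fun measurableSet_Ioi fun t ht => ?_
    have ht0 : 0 < t := hb.trans ht
    refine (((hasSum_kernelExp h1 h2 ht0).mul_left
      (2 * Complex.exp (-(p * Real.exp t)))).of_eq (fun n => ?_) ?_).tsum_eq
    · ring
    · ring
  · refine (ae_restrict_iff' measurableSet_Ioi).2 (ae_of_all _ fun t ht s => ?_)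
    have hle : ∀ n : ℕ, ‖2 * Real.sin (α * ((n : ℝ) + 1) * π) *
        (Complex.exp (-(p * Real.exp t)) * Complex.exp ((1 - α * ((n : ℝ) + 1) : ℝ) * t))‖ ≤
        2 * (Real.exp (-(p.re * Real.exp t)) * Real.exp (1 * t)) *
          Real.exp (-α * b * ((n : ℝ) + 1)) := fun n => by
      rw [norm_mul, norm_mul, norm_mul, norm_exp_neg_mul_ofReal, norm_exp_real_mul,
        Complex.norm_real, mul_assoc, mul_assoc, mul_assoc, Complex.norm_two]
      refine mul_le_mul_of_nonneg_left ?_ zero_le_two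
      refine (mul_le_of_le_one_left (by positivity) (Real.abs_sin_le_one _)).trans ?_
      rw [mul_assoc]
      refine mul_le_mul_of_nonneg_left ?_ (Real.exp_pos _).le
      rw [← Real.exp_add]
      refine Real.exp_le_exp.2 ?_
      have : (0 : ℝ) < α * ((n : ℝ) + 1) := by positivity
      nlinarith [mem_Ioi.1 ht]
    refine (Finset.sum_le_sum fun n _ => hle n).trans ?_
    rw [← Finset.mul_sum]
    exact mul_le_mul_of_nonneg_left (hsum.sum_le_tsum s fun _ _ => (Real.exp_pos _).le)
      (by positivity)

/-- The Mittag-Leffler type series `∑ p^{αn-1} / Γ(αn)` at `p = e^u`: an exponential and the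
Laplace transform of the kernel. -/
lemma hasSum_mittagLeffler {α : ℝ} (h1 : 1 < α) (h2 : α < 2) {u : ℂ} (hu : |u.im| < π / 2) :
    HasSum (fun n : ℕ => Complex.exp ((α * ((n : ℝ) + 1) - 1 : ℝ) * u) /
        Real.Gamma (α * ((n : ℝ) + 1)))
      (1 / α * Complex.exp (Complex.exp u) + Real.sin (π * α) / π *
        ∫ t : ℝ, Complex.exp (-(Complex.exp u * Real.exp t)) *
          (Real.exp t * kernelExp α t : ℝ)) := by
  have h0 : 0 < α := by linarith
  have hpi : (π : ℂ) ≠ 0 := by exact_mod_cast Real.pi_ne_zero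
  have h := ((hasSum_arc h0 one_pos (Complex.exp u)).add
    (hasSum_tail h1 h2 (exp_re_pos hu) one_pos)).mul_left (1 / (2 * π) : ℂ)
  refine h.of_eq (fun n => ?_) ?_
  · rw [hankel hu 1 (by positivity : 0 < α * ((n : ℝ) + 1))]
    push_cast
    field_simp
  · have hI := integrable_cexp_mul_kernelExp h1 h2 (exp_re_pos hu).le
    rw [integral_arc_kernel h1 h2 hu one_pos,
      ← intervalIntegral.integral_Iic_add_Ioi (b := 1) hI.integrableOn hI.integrableOn]
    field_simp
    ring

/-! ### Gamma integrals along a ray in the left half-plane -/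

lemma cexp_mul_cexp_cexp_eq {α : ℝ} (hα : 0 < α) (ψ c t : ℝ) :
    Complex.exp (c * (t + ψ * Complex.I)) *
      Complex.exp (Complex.exp (α * (t + ψ * Complex.I))) =
    Complex.exp (c * (ψ * Complex.I)) *
      (Complex.exp (-(Complex.exp ((α * ψ - π : ℝ) * Complex.I) * Real.exp (α * t))) *
        Complex.exp ((c / α : ℝ) * (α * t : ℝ))) := by
  have hα' : (α : ℂ) ≠ 0 := by exact_mod_cast hα.ne'
  have e1 : -(Complex.exp ((α * ψ - π : ℝ) * Complex.I) * Real.exp (α * t)) =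
      Complex.exp (α * (t + ψ * Complex.I)) := by
    rw [Complex.ofReal_exp, ← Complex.exp_add, ← neg_one_mul, ← Complex.exp_pi_mul_I,
      ← Complex.exp_add]
    push_cast; ring_nf
  have e2 : ((c / α : ℝ) : ℂ) * (α * t : ℝ) = c * t := by
    push_cast
    field_simp
  rw [e1, e2, mul_add (c : ℂ), Complex.exp_add (c * t)]
  ring

lemma integrable_cexp_mul_cexp_cexp {α ψ c : ℝ} (hα : 0 < α) (hψ : |α * ψ - π| < π / 2)
    (hc : 0 < c) :
    Integrable fun t : ℝ => Complex.exp (c * (t + ψ * Complex.I)) *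
      Complex.exp (Complex.exp (α * (t + ψ * Complex.I))) := by
  have hu : |((α * ψ - π : ℝ) * Complex.I).im| < π / 2 := by simpa using hψ
  have h := ((integrable_cexp_neg_mul_exp (exp_re_pos hu) (div_pos hc hα)).comp_mul_left'
    hα.ne').const_mul (Complex.exp (c * (ψ * Complex.I)))
  exact h.congr (ae_of_all _ fun t => (cexp_mul_cexp_cexp_eq hα ψ c t).symm)

lemma integral_cexp_mul_cexp_cexp {α ψ c : ℝ} (hα : 0 < α) (hψ : |α * ψ - π| < π / 2)
    (hc : 0 < c) :
    ∫ t : ℝ, Complex.exp (c * (t + ψ * Complex.I)) *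
      Complex.exp (Complex.exp (α * (t + ψ * Complex.I))) =
      1 / α * Real.Gamma (c / α) * Complex.exp ((c / α * π : ℝ) * Complex.I) := by
  have hu : |((α * ψ - π : ℝ) * Complex.I).im| < π / 2 := by simpa using hψ
  have hα' : (α : ℂ) ≠ 0 := by exact_mod_cast hα.ne'
  simp only [cexp_mul_cexp_cexp_eq hα]
  rw [integral_const_mul, Measure.integral_comp_mul_left (fun x : ℝ =>
    Complex.exp (-(Complex.exp ((α * ψ - π : ℝ) * Complex.I) * Real.exp x)) *
        Complex.exp ((c / α : ℝ) * x)) α, integral_cexp_neg_mul_exp hu (div_pos hc hα),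
    abs_of_pos (inv_pos.2 hα), Complex.real_smul]
  have e : Complex.exp ((c / α * π : ℝ) * Complex.I) = Complex.exp (c * (ψ * Complex.I)) *
      Complex.exp (-((c / α : ℝ) * ((α * ψ - π : ℝ) * Complex.I))) := by
    rw [← Complex.exp_add]
    congr 1
    push_cast
    field_simp
    ring
  rw [e]
  push_cast
  ring

lemma exists_mul_exp_le {α : ℝ} (h1 : 1 < α) {A ε : ℝ} (hA : 0 < A) (hε : 0 < ε) :
    ∃ C : ℝ, ∀ t : ℝ, A * Real.exp t ≤ ε * Real.exp (α * t) + C := by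
  set T := Real.log (A / ε) / (α - 1) with hT
  have h0 : 0 < α - 1 := by linarith
  refine ⟨A * Real.exp T, fun t => ?_⟩
  rcases le_total t T with h | h
  · have := mul_le_mul_of_nonneg_left (Real.exp_le_exp.2 h) hA.le
    have : 0 < ε * Real.exp (α * t) := by positivity
    linarith
  · have e : A ≤ ε * Real.exp ((α - 1) * t) := by
      rw [← div_le_iff₀' hε, ← Real.log_le_iff_le_exp (div_pos hA hε)]
      rw [hT, div_le_iff₀ h0] at h
      linarith
    have e2 : Real.exp (α * t) = Real.exp ((α - 1) * t) * Real.exp t := by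
      rw [← Real.exp_add]; ring_nf
    have : 0 < A * Real.exp T := by positivity
    rw [e2]
    nlinarith [mul_le_mul_of_nonneg_right e (Real.exp_pos t).le]

lemma integrable_exp_neg_mul_exp_mul {α q c : ℝ} (hα : 0 < α) (hq : 0 < q) (hc : 0 < c) :
    Integrable fun t : ℝ => Real.exp (c * t) * Real.exp (-(q * Real.exp (α * t))) := by
  refine ((integrable_exp_neg_mul_exp hq (div_pos hc hα)).comp_mul_left' hα.ne').congr
    (ae_of_all _ fun t => ?_)
  simp only
  rw [mul_comm, ← mul_assoc, div_mul_cancel₀ _ hα.ne']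

lemma integrable_exp_mul_exp_exp {α q : ℝ} (h1 : 1 < α) (hq : 0 < q) (ζ : ℝ) :
    Integrable fun t : ℝ => Real.exp (α * t) * Real.exp (-(q * Real.exp (α * t))) *
      Real.exp (Real.exp (t + ζ)) := by
  have h0 : 0 < α := by linarith
  obtain ⟨C, hC⟩ := exists_mul_exp_le h1 (Real.exp_pos ζ) (half_pos hq)
  refine ((integrable_exp_neg_mul_exp_mul h0 (half_pos hq) h0).mul_const (Real.exp C)).mono'
    (by fun_prop) (ae_of_all _ fun t => ?_)
  rw [Real.norm_of_nonneg (by positivity)]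
  simp only [← Real.exp_add]
  refine Real.exp_le_exp.2 ?_
  have := hC t
  rw [← Real.exp_add, add_comm ζ] at this
  linarith

lemma norm_cexp_ray (c t ψ : ℝ) :
    ‖Complex.exp (c * (t + ψ * Complex.I))‖ = Real.exp (c * t) := by
  rw [Complex.norm_exp]; simp

lemma norm_cexp_cexp_ray (α t ψ : ℝ) :
    ‖Complex.exp (Complex.exp (α * (t + ψ * Complex.I)))‖ =
      Real.exp (-(-Real.cos (α * ψ) * Real.exp (α * t))) := by
  rw [Complex.norm_exp, Complex.exp_re]
  simp [mul_comm]

lemma cos_neg_of_abs_sub_pi {θ : ℝ} (h : |θ - π| < π / 2) : 0 < -Real.cos θ := by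
  rw [← Real.cos_sub_pi]
  exact Real.cos_pos_of_mem_Ioo (by rw [abs_lt] at h; exact h)

lemma hasSum_ray_exp {α ψ : ℝ} (h1 : 1 < α) (hψ : |α * ψ - π| < π / 2) (ζ : ℝ) :
    HasSum (fun k : ℕ => (Real.exp (k * ζ) / k.factorial : ℝ) * (1 / α *
        Real.Gamma (1 + k / α) * Complex.exp (((1 + k / α) * π : ℝ) * Complex.I)))
      (∫ t : ℝ, Complex.exp (α * (t + ψ * Complex.I)) *
        Complex.exp (Complex.exp (α * (t + ψ * Complex.I))) *
        Complex.exp (Complex.exp (t + ψ * Complex.I + ζ))) := by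
  have h0 : 0 < α := by linarith
  have h := hasSum_integral_of_sum_norm_le (μ := volume)
    (F := fun (k : ℕ) (t : ℝ) => Complex.exp (α * (t + ψ * Complex.I)) *
        Complex.exp (Complex.exp (α * (t + ψ * Complex.I))) *
        (Complex.exp (t + ψ * Complex.I + ζ) ^ k / k.factorial))
    (fun n => by fun_prop) (integrable_exp_mul_exp_exp h1 (cos_neg_of_abs_sub_pi hψ) ζ)
    (ae_of_all _ fun t s => ?_)
  · refine h.of_eq (fun k => ?_) (integral_congr_ae (ae_of_all _ fun t => ?_))
    · have e := integral_cexp_mul_cexp_cexp h0 hψ (c := α + k) (by positivity)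
      have e2 : (α + k) / α = 1 + k / α := by field_simp
      rw [e2] at e
      rw [← e, ← integral_const_mul]
      refine integral_congr_ae (ae_of_all _ fun t => ?_)
      simp only
      rw [← Complex.exp_nat_mul, mul_add (k : ℂ), Complex.exp_add, Complex.ofReal_add, add_mul,
        Complex.exp_add]
      push_cast
      ring
    · simp only
      rw [tsum_mul_left, (hasSum_cexp _).tsum_eq]
  · simp only [norm_mul, norm_cexp_ray, norm_cexp_cexp_ray]
    rw [← Finset.mul_sum]
    refine mul_le_mul_of_nonneg_left ?_ (by positivity)
    have e : ∀ k : ℕ, ‖Complex.exp (t + ψ * Complex.I + ζ) ^ k / (k.factorial : ℂ)‖ =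
        Real.exp (t + ζ) ^ k / k.factorial := fun k => by
      rw [norm_div, norm_pow, Complex.norm_exp]; simp
    simp only [e]
    exact sum_le_hasSum s (fun k _ => by positivity)
      (by rw [Real.exp_eq_exp_ℝ]; exact NormedSpace.expSeries_div_hasSum_exp _)

lemma sum_norm_mittagLeffler_le {α : ℝ} (h1 : 1 < α) (h2 : α < 2) (t y : ℝ) (s : Finset ℕ) :
    ∑ n ∈ s, ‖Complex.exp ((α * ((n : ℝ) + 1) - 1 : ℝ) * (t + y * Complex.I)) /
        (Real.Gamma (α * ((n : ℝ) + 1)) : ℂ)‖ ≤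
      (1 / α + ∫ τ : ℝ, Real.exp τ * kernelExp α τ) * Real.exp (Real.exp t) := by
  have h0 : 0 < α := by linarith
  have hpi := Real.pi_pos
  have h := Complex.hasSum_re (hasSum_mittagLeffler h1 h2 (u := (t : ℂ)) (by simp; positivity))
  have e : ∀ n : ℕ, ‖Complex.exp ((α * ((n : ℝ) + 1) - 1 : ℝ) * (t + y * Complex.I)) /
        (Real.Gamma (α * ((n : ℝ) + 1)) : ℂ)‖ =
      (Complex.exp ((α * ((n : ℝ) + 1) - 1 : ℝ) * t) / Real.Gamma (α * ((n : ℝ) + 1))).re := by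
    intro n
    have hG : 0 < Real.Gamma (α * ((n : ℝ) + 1)) := Real.Gamma_pos_of_pos (by positivity)
    rw [norm_div, norm_cexp_ray, Complex.norm_real, Real.norm_of_nonneg hG.le,
      ← Complex.ofReal_mul, ← Complex.ofReal_exp, ← Complex.ofReal_div, Complex.ofReal_re]
  simp only [e]
  refine (sum_le_hasSum s (fun n _ => ?_) h).trans ?_
  · rw [← e]; exact norm_nonneg _
  refine (Complex.re_le_norm _).trans ((norm_add_le _ _).trans ?_)
  rw [add_mul]
  refine add_le_add (le_of_eq ?_) ?_
  · rw [norm_mul, Complex.norm_exp, ← Complex.ofReal_exp, Complex.ofReal_re]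
    simp [abs_of_pos h0]
  · have hnn : ∀ τ, 0 ≤ Real.exp τ * kernelExp α τ := fun τ =>
      mul_nonneg (Real.exp_pos _).le (kernelExp_nonneg h1 h2 τ)
    have hI : ‖∫ τ : ℝ, Complex.exp (-(Complex.exp t * Real.exp τ)) *
        (Real.exp τ * kernelExp α τ : ℝ)‖ ≤ ∫ τ : ℝ, Real.exp τ * kernelExp α τ := by
      refine norm_integral_le_of_norm_le (integrable_exp_mul_kernelExp h1 h2)
        (ae_of_all _ fun τ => ?_)
      rw [norm_mul, norm_exp_neg_mul_ofReal, Complex.norm_real, Real.norm_of_nonneg (hnn τ)]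
      refine mul_le_of_le_one_left (hnn τ) (Real.exp_le_one_iff.2 ?_)
      rw [← Complex.ofReal_exp, Complex.ofReal_re]
      have := Real.exp_pos t
      have := Real.exp_pos τ
      simp; positivity
    have hc : ‖(Real.sin (π * α) / π : ℂ)‖ ≤ 1 := by
      rw [norm_div, Complex.norm_real, Complex.norm_real, Real.norm_of_nonneg hpi.le,
        div_le_one hpi]
      exact (Real.abs_sin_le_one _).trans (by linarith [Real.pi_gt_three])
    rw [norm_mul]
    calc _ ≤ 1 * ∫ τ : ℝ, Real.exp τ * kernelExp α τ :=
          mul_le_mul hc hI (norm_nonneg _) zero_le_one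
      _ ≤ _ := by
          rw [mul_comm]
          exact mul_le_mul_of_nonneg_left (Real.one_le_exp (Real.exp_pos _).le)
            (integral_nonneg hnn)

/-- The Laplace transform of the kernel at `e^u`. -/
noncomputable def laplaceKernel (α : ℝ) (u : ℂ) : ℂ :=
  ∫ τ : ℝ, Complex.exp (-(Complex.exp u * Real.exp τ)) * (Real.exp τ * kernelExp α τ : ℝ)

lemma hasSum_ray_mittagLeffler {α ψ : ℝ} (h1 : 1 < α) (h2 : α < 2) (hψ : |α * ψ - π| < π / 2)
    (hψ' : |ψ| < π / 2) (ζ : ℝ) :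
    HasSum (fun n : ℕ => (Real.exp ((α * ((n : ℝ) + 1) - 1) * ζ) /
        Real.Gamma (α * ((n : ℝ) + 1)) : ℝ) * (1 / α *
        Real.Gamma ((n : ℝ) + 2 - 1 / α) *
          Complex.exp ((((n : ℝ) + 2 - 1 / α) * π : ℝ) * Complex.I)))
      (∫ t : ℝ, Complex.exp (α * (t + ψ * Complex.I)) *
        Complex.exp (Complex.exp (α * (t + ψ * Complex.I))) *
        (1 / α * Complex.exp (Complex.exp (t + ψ * Complex.I + ζ)) +
          Real.sin (π * α) / π * laplaceKernel α (t + ψ * Complex.I + ζ))) := by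
  have h0 : 0 < α := by linarith
  have h := hasSum_integral_of_sum_norm_le (μ := volume)
    (F := fun (n : ℕ) (t : ℝ) => Complex.exp (α * (t + ψ * Complex.I)) *
        Complex.exp (Complex.exp (α * (t + ψ * Complex.I))) *
        (Complex.exp ((α * ((n : ℝ) + 1) - 1 : ℝ) * (t + ψ * Complex.I + ζ)) /
          (Real.Gamma (α * ((n : ℝ) + 1)) : ℂ)))
    (fun n => by fun_prop) ((integrable_exp_mul_exp_exp h1 (cos_neg_of_abs_sub_pi hψ) ζ).mul_const
      (1 / α + ∫ τ : ℝ, Real.exp τ * kernelExp α τ))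
    (ae_of_all _ fun t s => ?_)
  · refine h.of_eq (fun n => ?_) (integral_congr_ae (ae_of_all _ fun t => ?_))
    · have hc : 0 < α * ((n : ℝ) + 2) - 1 := by nlinarith [n.cast_nonneg (α := ℝ)]
      have e := integral_cexp_mul_cexp_cexp h0 hψ hc
      have e2 : (α * ((n : ℝ) + 2) - 1) / α = (n : ℝ) + 2 - 1 / α := by field_simp
      rw [e2] at e
      rw [← e, ← integral_const_mul]
      refine integral_congr_ae (ae_of_all _ fun t => ?_)
      simp only
      have e3 : ((α * ((n : ℝ) + 2) - 1 : ℝ) : ℂ) = α + (α * ((n : ℝ) + 1) - 1 : ℝ) := by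
        push_cast; ring
      rw [mul_add (((α * ((n : ℝ) + 1) - 1 : ℝ)) : ℂ), Complex.exp_add, e3, add_mul,
        Complex.exp_add]
      push_cast
      ring
    · simp only
      rw [tsum_mul_left, (hasSum_mittagLeffler h1 h2 (by simpa using hψ')).tsum_eq]
      rfl
  · simp only [norm_mul, norm_cexp_ray, norm_cexp_cexp_ray]
    rw [← Finset.mul_sum, mul_assoc _ (Real.exp (Real.exp _)),
      mul_comm (Real.exp (Real.exp _)) (1 / α + _)]
    refine mul_le_mul_of_nonneg_left ?_ (by positivity)
    have e := sum_norm_mittagLeffler_le h1 h2 (t + ζ) ψ s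
    have e' : ((t + ζ : ℝ) : ℂ) + ψ * Complex.I = t + ψ * Complex.I + ζ := by push_cast; ring
    rwa [e'] at e

lemma im_ofReal_mul_cexp (r θ : ℝ) : ((r : ℂ) * Complex.exp (θ * Complex.I)).im =
    r * Real.sin θ := by
  rw [Complex.im_ofReal_mul, Complex.exp_ofReal_mul_I_im]

lemma hasSum_im_ray_exp {α ψ : ℝ} (h1 : 1 < α) (hψ : |α * ψ - π| < π / 2) (ζ : ℝ) :
    HasSum (fun k : ℕ => π / α * (Real.exp (k * ζ) / (Real.Gamma (-k / α) * k.factorial)))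
      (∫ t : ℝ, Complex.exp (α * (t + ψ * Complex.I)) *
        Complex.exp (Complex.exp (α * (t + ψ * Complex.I))) *
        Complex.exp (Complex.exp (t + ψ * Complex.I + ζ))).im := by
  have h0 : 0 < α := by linarith
  have h := Complex.hasSum_im (hasSum_ray_exp h1 hψ ζ)
  refine h.of_eq (fun k => ?_) rfl
  have hs := sin_mul_Gamma_one_sub (s := -k / α)
    (lt_of_le_of_lt (div_nonpos_of_nonpos_of_nonneg (by simp) h0.le) one_pos)
  have e1 : 1 - -(k : ℝ) / α = 1 + k / α := by ring
  have e2 : Real.sin ((1 + k / α) * π) = Real.sin (π * (-k / α)) := by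
    rw [show (1 + k / α) * π = π - π * (-k / α) by ring, Real.sin_pi_sub]
  rw [e1] at hs
  rw [show ((Real.exp (k * ζ) / k.factorial : ℝ) : ℂ) * (1 / α * Real.Gamma (1 + k / α) *
      Complex.exp (((1 + k / α) * π : ℝ) * Complex.I)) =
    ((Real.exp (k * ζ) / k.factorial * (1 / α * Real.Gamma (1 + k / α)) : ℝ) : ℂ) *
      Complex.exp (((1 + k / α) * π : ℝ) * Complex.I) by push_cast; ring,
    im_ofReal_mul_cexp, e2]
  generalize Real.sin (π * (-k / α)) = S at hs ⊢
  linear_combination Real.exp (k * ζ) / k.factorial * (1 / α) * hs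

lemma hasSum_im_ray_mittagLeffler {α ψ : ℝ} (h1 : 1 < α) (h2 : α < 2)
    (hψ : |α * ψ - π| < π / 2) (hψ' : |ψ| < π / 2) (ζ : ℝ) :
    HasSum (fun n : ℕ => π / α * (Real.exp ((α * ((n : ℝ) + 1) - 1) * ζ) /
        (Real.Gamma (α * ((n : ℝ) + 1)) * Real.Gamma (1 / α - ((n : ℝ) + 1)))))
      (∫ t : ℝ, Complex.exp (α * (t + ψ * Complex.I)) *
        Complex.exp (Complex.exp (α * (t + ψ * Complex.I))) *
        (1 / α * Complex.exp (Complex.exp (t + ψ * Complex.I + ζ)) +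
          Real.sin (π * α) / π * laplaceKernel α (t + ψ * Complex.I + ζ))).im := by
  have h0 : 0 < α := by linarith
  have h := Complex.hasSum_im (hasSum_ray_mittagLeffler h1 h2 hψ hψ' ζ)
  refine h.of_eq (fun n => ?_) rfl
  have hlt : 1 / α < 1 := by rw [div_lt_one h0]; exact h1
  have hs := sin_mul_Gamma_one_sub (s := 1 / α - ((n : ℝ) + 1))
    (by linarith [n.cast_nonneg (α := ℝ)])
  have e1 : 1 - (1 / α - ((n : ℝ) + 1)) = (n : ℝ) + 2 - 1 / α := by ring
  have e2 : Real.sin (((n : ℝ) + 2 - 1 / α) * π) = Real.sin (π * (1 / α - ((n : ℝ) + 1))) := by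
    rw [← Real.sin_pi_sub]; ring_nf
  rw [e1] at hs
  rw [show ((Real.exp ((α * ((n : ℝ) + 1) - 1) * ζ) / Real.Gamma (α * ((n : ℝ) + 1)) : ℝ) : ℂ) *
      (1 / α * Real.Gamma ((n : ℝ) + 2 - 1 / α) *
      Complex.exp ((((n : ℝ) + 2 - 1 / α) * π : ℝ) * Complex.I)) =
    ((Real.exp ((α * ((n : ℝ) + 1) - 1) * ζ) / Real.Gamma (α * ((n : ℝ) + 1)) *
      (1 / α * Real.Gamma ((n : ℝ) + 2 - 1 / α)) : ℝ) : ℂ) *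
      Complex.exp ((((n : ℝ) + 2 - 1 / α) * π : ℝ) * Complex.I) by push_cast; ring,
    im_ofReal_mul_cexp, e2]
  rw [div_mul_eq_div_div, ← mul_div_assoc, ← mul_div_assoc]
  linear_combination Real.exp ((α * ((n : ℝ) + 1) - 1) * ζ) / Real.Gamma (α * ((n : ℝ) + 1)) *
    (1 / α) * hs

lemma re_cexp_ray_pos {ψ : ℝ} (hψ' : |ψ| < π / 2) (t σ : ℝ) :
    0 < (Complex.exp (t + ψ * Complex.I + σ)).re :=
  exp_re_pos (by simpa using hψ')

/-- The Laplace transform of `w ↦ e^{αw} exp(e^{αw})` along a ray, as a function of `log s`. -/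
noncomputable def rayLaplace (α ψ σ : ℝ) : ℂ :=
  ∫ t : ℝ, Complex.exp (α * (t + ψ * Complex.I)) *
    Complex.exp (Complex.exp (α * (t + ψ * Complex.I))) *
    Complex.exp (-Complex.exp (t + ψ * Complex.I + σ))

lemma integrable_ray_prod {α ψ : ℝ} (h1 : 1 < α) (h2 : α < 2) (hψ : |α * ψ - π| < π / 2)
    (hψ' : |ψ| < π / 2) (ζ : ℝ) :
    Integrable (fun q : ℝ × ℝ => (Complex.exp (α * (q.1 + ψ * Complex.I)) *
        Complex.exp (Complex.exp (α * (q.1 + ψ * Complex.I))) *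
        Complex.exp (-Complex.exp (q.1 + ψ * Complex.I + (q.2 + ζ : ℝ)))) *
        (Real.exp q.2 * kernelExp α q.2 : ℝ)) (volume.prod volume) := by
  have h0 : 0 < α := by linarith
  have hc := continuous_kernelExp h1 h2
  refine ((integrable_exp_neg_mul_exp_mul h0 (cos_neg_of_abs_sub_pi hψ) h0).mul_prod
    (integrable_exp_mul_kernelExp h1 h2)).mono' ?_ (ae_of_all _ fun q => ?_)
  · exact Continuous.aestronglyMeasurable (by fun_prop)
  · have hnn : 0 ≤ Real.exp q.2 * kernelExp α q.2 :=
      mul_nonneg (Real.exp_pos _).le (kernelExp_nonneg h1 h2 _)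
    rw [norm_mul, norm_mul, norm_mul, norm_cexp_ray, norm_cexp_cexp_ray, Complex.norm_real,
      Real.norm_of_nonneg hnn]
    refine mul_le_mul_of_nonneg_right (mul_le_of_le_one_right (by positivity) ?_) hnn
    rw [Complex.norm_exp, Real.exp_le_one_iff, Complex.neg_re]
    exact neg_nonpos.2 (re_cexp_ray_pos hψ' _ _).le

lemma cexp_mul_ofReal_exp (u : ℂ) (τ : ℝ) :
    Complex.exp u * Real.exp τ = Complex.exp (u + τ) := by
  rw [Complex.exp_add, Complex.ofReal_exp]

lemma ray_mul_laplaceKernel (α ψ ζ t : ℝ) (E : ℂ) :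
    ∫ τ : ℝ, E * Complex.exp (-Complex.exp (t + ψ * Complex.I + (τ + ζ : ℝ))) *
        (Real.exp τ * kernelExp α τ : ℝ) = E * laplaceKernel α (t + ψ * Complex.I + ζ) := by
  rw [laplaceKernel, ← integral_const_mul]
  refine integral_congr_ae (ae_of_all _ fun τ => ?_)
  simp only [cexp_mul_ofReal_exp]
  push_cast
  ring_nf

lemma integral_ray_laplaceKernel {α ψ : ℝ} (h1 : 1 < α) (h2 : α < 2) (hψ : |α * ψ - π| < π / 2)
    (hψ' : |ψ| < π / 2) (ζ : ℝ) :
    (∫ t : ℝ, Complex.exp (α * (t + ψ * Complex.I)) *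
        Complex.exp (Complex.exp (α * (t + ψ * Complex.I))) *
        laplaceKernel α (t + ψ * Complex.I + ζ)).im =
      ∫ τ : ℝ, Real.exp τ * kernelExp α τ * (rayLaplace α ψ (τ + ζ)).im := by
  have hF := integrable_ray_prod h1 h2 hψ hψ' ζ
  have h := integral_integral_swap (f := fun t τ : ℝ => (Complex.exp (α * (t + ψ * Complex.I)) *
        Complex.exp (Complex.exp (α * (t + ψ * Complex.I))) *
        Complex.exp (-Complex.exp (t + ψ * Complex.I + (τ + ζ : ℝ)))) *
        (Real.exp τ * kernelExp α τ : ℝ)) hF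
  have hG := hF.integral_prod_right
  simp only [ray_mul_laplaceKernel, integral_mul_const] at h hG
  rw [h]
  refine (integral_im hG).symm.trans (integral_congr_ae (ae_of_all _ fun τ => ?_))
  simp only [rayLaplace]
  rw [mul_comm]
  exact Complex.im_ofReal_mul _ _

lemma hittingDensity_eq_integral {α ψ : ℝ} (h1 : 1 < α) (h2 : α < 2) (hψ : |α * ψ - π| < π / 2)
    (hψ' : |ψ| < π / 2) {x : ℝ} (hx : 0 < x) :
    hittingDensity α x = -(α / π) ^ 2 * Real.sin (π * α) / x *
      ∫ τ : ℝ, Real.exp τ * kernelExp α τ * (rayLaplace α ψ (τ + -(Real.log x) / α)).im := by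
  have h0 : 0 < α := by linarith
  have hpi := Real.pi_pos
  set ζ := -(Real.log x) / α with hζ
  have hxζ : x⁻¹ = Real.exp (α * ζ) := by
    rw [hζ, mul_div_cancel₀ _ h0.ne', Real.exp_neg, Real.exp_log hx]
  have hpow : ∀ y : ℝ, x ^ y = x⁻¹ * Real.exp (-(α * y + α) * ζ) := fun y => by
    rw [hxζ, Real.rpow_def_of_pos hx, ← Real.exp_add, hζ]
    congr 1
    field_simp
    ring
  set E : ℝ → ℂ := fun t => Complex.exp (α * (t + ψ * Complex.I)) *
        Complex.exp (Complex.exp (α * (t + ψ * Complex.I))) with hE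
  have hA := hasSum_im_ray_exp h1 hψ ζ
  have hB := hasSum_im_ray_mittagLeffler h1 h2 hψ hψ' ζ
  have hI1 : Integrable fun t : ℝ => E t * Complex.exp (Complex.exp (t + ψ * Complex.I + ζ)) := by
    refine (integrable_exp_mul_exp_exp h1 (cos_neg_of_abs_sub_pi hψ) ζ).mono'
      (by fun_prop) (ae_of_all _ fun t => ?_)
    simp only [hE]
    rw [norm_mul, norm_mul, norm_cexp_ray, norm_cexp_cexp_ray]
    refine mul_le_mul_of_nonneg_left ((Complex.norm_exp_le_exp_norm _).trans_eq ?_) (by positivity)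
    rw [Complex.norm_exp]; simp
  have hI2 : Integrable fun t : ℝ => E t * laplaceKernel α (t + ψ * Complex.I + ζ) := by
    have := (integrable_ray_prod h1 h2 hψ hψ' ζ).integral_prod_left
    simpa only [ray_mul_laplaceKernel] using this
  have hsplit : (∫ t : ℝ, E t * (1 / α * Complex.exp (Complex.exp (t + ψ * Complex.I + ζ)) +
          Real.sin (π * α) / π * laplaceKernel α (t + ψ * Complex.I + ζ))) =
      (1 / α : ℝ) * (∫ t : ℝ, E t * Complex.exp (Complex.exp (t + ψ * Complex.I + ζ))) +
      (Real.sin (π * α) / π : ℝ) * ∫ t : ℝ, E t * laplaceKernel α (t + ψ * Complex.I + ζ) := by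
    rw [← integral_const_mul, ← integral_const_mul,
      ← integral_add (hI1.const_mul _) (hI2.const_mul _)]
    refine integral_congr_ae (ae_of_all _ fun t => ?_)
    push_cast
    ring
  change HasSum _ (∫ t : ℝ, E t * _).im at hA
  change HasSum _ (∫ t : ℝ, E t * _).im at hB
  rw [hsplit, Complex.add_im, Complex.im_ofReal_mul, Complex.im_ofReal_mul,
    integral_ray_laplaceKernel h1 h2 hψ hψ'] at hB
  have hA' := (hasSum_nat_add_iff' 1).2 hA
  have hA0 : ∑ k ∈ Finset.range 1, π / α * (Real.exp ((k : ℕ) * ζ) /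
      (Real.Gamma (-(k : ℕ) / α) * k.factorial)) = 0 := by simp [Real.Gamma_zero]
  rw [hA0, sub_zero] at hA'
  have hA2 := hA'.mul_left (α / π * x⁻¹)
  have hB2 := hB.mul_left (-α * (α / π * x⁻¹))
  have t1 : HasSum (fun n : ℕ => (-α) * x ^ (1 / α - ((n : ℝ) + 1) - 1) /
      (Real.Gamma (α * ((n : ℝ) + 1)) * Real.Gamma (1 / α - ((n : ℝ) + 1)))) _ :=
    hB2.of_eq (fun n => by
      rw [hpow, show -(α * (1 / α - ((n : ℝ) + 1) - 1) + α) * ζ = (α * ((n : ℝ) + 1) - 1) * ζ by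
        field_simp; ring]
      field_simp) rfl
  have t2 : HasSum (fun n : ℕ => x ^ (-((n : ℝ) + 1) / α - 1) /
      (Real.Gamma (-((n : ℝ) + 1) / α) * (Nat.factorial (n + 1) : ℝ))) _ :=
    hA2.of_eq (fun n => by
      rw [hpow, show -(α * (-((n : ℝ) + 1) / α - 1) + α) * ζ = ((n + 1 : ℕ) : ℝ) * ζ by
        push_cast; field_simp; ring]
      push_cast
      field_simp) rfl
  rw [hittingDensity, t1.tsum_eq, t2.tsum_eq]
  field_simp
  ring

/-! ### Moments of the ray Laplace transform -/

/-- The exponential function minus its Taylor polynomial of degree `K - 1`. -/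
noncomputable def expTail (K : ℕ) (y : ℂ) : ℂ :=
  Complex.exp y - ∑ k ∈ Finset.range K, y ^ k / k.factorial

lemma expTail_zero (y : ℂ) : expTail 0 y = Complex.exp y := by simp [expTail]

lemma expTail_succ (K : ℕ) (y : ℂ) : expTail (K + 1) y = expTail K y - y ^ K / K.factorial := by
  rw [expTail, expTail, Finset.sum_range_succ]; ring

@[fun_prop]
lemma continuous_expTail (K : ℕ) : Continuous (expTail K) := by
  unfold expTail
  fun_prop

lemma expTail_succ_apply_zero (K : ℕ) : expTail (K + 1) 0 = 0 := by
  simp [expTail, Finset.sum_range_succ']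

lemma hasDerivAt_expTail (K : ℕ) (y : ℂ) : HasDerivAt (expTail (K + 1)) (expTail K y) y := by
  induction K with
  | zero =>
    have : expTail (0 + 1) = fun y => Complex.exp y - 1 := by
      funext y; simp [expTail]
    rw [this, expTail_zero]
    exact (Complex.hasDerivAt_exp y).sub_const 1
  | succ K ih =>
    have : expTail (K + 1 + 1) = fun y => expTail (K + 1) y - y ^ (K + 1) / (K + 1).factorial := by
      funext y; exact expTail_succ _ _
    rw [this, expTail_succ K]
    refine (ih.sub ((hasDerivAt_pow (K + 1) y).div_const _)).congr_deriv ?_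
    rw [Nat.factorial_succ]
    have : ((K : ℂ) + 1) ≠ 0 := by exact_mod_cast K.succ_ne_zero
    push_cast
    field_simp

lemma norm_expTail_le (K : ℕ) {y : ℂ} (hy : y.re ≤ 0) : ‖expTail K y‖ ≤ ‖y‖ ^ K := by
  induction K generalizing y with
  | zero => rw [expTail_zero, Complex.norm_exp]; simpa using hy
  | succ K ih =>
    have hd : ∀ s ∈ Icc (0 : ℝ) 1, HasDerivWithinAt (fun s : ℝ => expTail (K + 1) (s * y))
        (expTail K (s * y) * y) (Icc 0 1) s := fun s _ => by
      have h := (hasDerivAt_expTail K (s * y)).comp s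
        ((Complex.ofRealCLM.hasDerivAt (x := s)).mul_const y)
      exact (h.congr_deriv (by simp)).hasDerivWithinAt
    have := norm_image_sub_le_of_norm_deriv_le_segment_01' hd (C := ‖y‖ ^ (K + 1)) fun s hs => by
      have hre : ((s : ℂ) * y).re ≤ 0 := by
        rw [Complex.re_ofReal_mul]; exact mul_nonpos_of_nonneg_of_nonpos hs.1 hy
      rw [norm_mul, pow_succ]
      refine mul_le_mul_of_nonneg_right ((ih hre).trans ?_) (norm_nonneg _)
      rw [norm_mul, Complex.norm_real, Real.norm_of_nonneg hs.1]
      exact pow_le_pow_left₀ (by have := hs.1; positivity)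
        (mul_le_of_le_one_left (norm_nonneg _) hs.2.le) _
    simpa [expTail_succ_apply_zero] using this

lemma norm_expTail_succ_le (K : ℕ) {y : ℂ} (hy : y.re ≤ 0) :
    ‖expTail (K + 1) y‖ ≤ 2 * ‖y‖ ^ K := by
  rw [expTail_succ, two_mul]
  refine (norm_sub_le _ _).trans (add_le_add (norm_expTail_le K hy) ?_)
  rw [norm_div, norm_pow, Complex.norm_natCast]
  exact div_le_self (by positivity) (by exact_mod_cast K.factorial_pos)

lemma re_cexp_ray_nonpos {α ψ : ℝ} (hψ : |α * ψ - π| < π / 2) (t : ℝ) :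
    (Complex.exp (α * (t + ψ * Complex.I))).re ≤ 0 := by
  have := cos_neg_of_abs_sub_pi hψ
  rw [Complex.exp_re]
  refine mul_nonpos_of_nonneg_of_nonpos (Real.exp_pos _).le ?_
  simp
  linarith

lemma norm_cexp_neg_ray (t ψ σ : ℝ) :
    ‖Complex.exp (-Complex.exp (t + ψ * Complex.I + σ))‖ =
      Real.exp (-(Real.cos ψ * Real.exp σ * Real.exp t)) := by
  rw [Complex.norm_exp, Complex.neg_re, Complex.exp_re]
  simp [Real.exp_add]
  ring

lemma norm_tail_integrand_le {α ψ : ℝ} (hψ : |α * ψ - π| < π / 2) (K : ℕ) (t σ : ℝ) :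
    ‖Complex.exp (α * (t + ψ * Complex.I)) * expTail K (Complex.exp (α * (t + ψ * Complex.I))) *
      Complex.exp (-Complex.exp (t + ψ * Complex.I + σ))‖ ≤
      Real.exp (-(Real.cos ψ * Real.exp σ * Real.exp t)) * Real.exp (α * (K + 1) * t) := by
  rw [norm_mul, norm_mul, norm_cexp_ray, norm_cexp_neg_ray, mul_comm]
  refine mul_le_mul_of_nonneg_left ?_ (by positivity)
  refine (mul_le_mul_of_nonneg_left (norm_expTail_le K (re_cexp_ray_nonpos hψ t))
    (Real.exp_pos _).le).trans_eq ?_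
  rw [norm_cexp_ray, ← Real.exp_nat_mul, ← Real.exp_add]
  ring_nf

lemma integrable_tail_integrand {α ψ : ℝ} (hα : 0 < α) (hψ : |α * ψ - π| < π / 2)
    (hψ' : |ψ| < π / 2) (K : ℕ) (σ : ℝ) :
    Integrable fun t : ℝ => Complex.exp (α * (t + ψ * Complex.I)) *
      expTail K (Complex.exp (α * (t + ψ * Complex.I))) *
      Complex.exp (-Complex.exp (t + ψ * Complex.I + σ)) := by
  have hc := Real.cos_pos_of_mem_Ioo (abs_lt.1 hψ')
  exact (integrable_exp_neg_mul_exp (mul_pos hc (Real.exp_pos σ))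
    (show 0 < α * (K + 1) by positivity)).mono' (by fun_prop)
    (ae_of_all _ fun t => norm_tail_integrand_le hψ K t σ)

lemma integral_cexp_mul_cexp_neg_ray {ψ c : ℝ} (hψ' : |ψ| < π / 2) (hc : 0 < c) (σ : ℝ) :
    ∫ t : ℝ, Complex.exp (c * (t + ψ * Complex.I)) *
      Complex.exp (-Complex.exp (t + ψ * Complex.I + σ)) =
      (Real.Gamma c * Real.exp (-(c * σ)) : ℝ) := by
  have h := integral_cexp_neg_mul_exp (u := σ + ψ * Complex.I) (by simpa using hψ') hc
  calc _ = ∫ t : ℝ, Complex.exp (c * (ψ * Complex.I)) *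
        (Complex.exp (-(Complex.exp (σ + ψ * Complex.I) * Real.exp t)) * Complex.exp (c * t)) := by
        refine integral_congr_ae (ae_of_all _ fun t => ?_)
        simp only [cexp_mul_ofReal_exp]
        rw [mul_add, Complex.exp_add, show (t : ℂ) + ψ * Complex.I + σ = σ + ψ * Complex.I + t by ring]
        ring
    _ = _ := by
        rw [integral_const_mul, h, mul_add, neg_add, Complex.exp_add]
        rw [show ∀ a b c d : ℂ, a * (b * (c * d)) = b * c * (a * d) by intros; ring, ← Complex.exp_add]
        push_cast
        simp

lemma im_rayLaplace {α ψ : ℝ} (hα : 0 < α) (hψ : |α * ψ - π| < π / 2)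
    (hψ' : |ψ| < π / 2) (K : ℕ) (σ : ℝ) :
    (rayLaplace α ψ σ).im = (∫ t : ℝ, Complex.exp (α * (t + ψ * Complex.I)) *
      expTail K (Complex.exp (α * (t + ψ * Complex.I))) *
      Complex.exp (-Complex.exp (t + ψ * Complex.I + σ))).im := by
  induction K with
  | zero => simp only [expTail_zero, rayLaplace]
  | succ K ih =>
    have hc : 0 < α * (K + 1) := by positivity
    have e : ∀ t : ℝ, Complex.exp (α * (t + ψ * Complex.I)) *
        expTail (K + 1) (Complex.exp (α * (t + ψ * Complex.I))) *
        Complex.exp (-Complex.exp (t + ψ * Complex.I + σ)) =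
        Complex.exp (α * (t + ψ * Complex.I)) *
        expTail K (Complex.exp (α * (t + ψ * Complex.I))) *
        Complex.exp (-Complex.exp (t + ψ * Complex.I + σ)) -
        (1 / K.factorial : ℝ) * (Complex.exp ((α * (K + 1) : ℝ) * (t + ψ * Complex.I)) *
        Complex.exp (-Complex.exp (t + ψ * Complex.I + σ))) := fun t => by
      rw [expTail_succ, show ((α * (K + 1) : ℝ) : ℂ) * (t + ψ * Complex.I) =
        α * (t + ψ * Complex.I) + K * (α * (t + ψ * Complex.I)) by push_cast; ring,
        Complex.exp_add (α * (t + ψ * Complex.I)), Complex.exp_nat_mul]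
      push_cast
      ring
    have hint : Integrable fun t : ℝ => Complex.exp ((α * (K + 1) : ℝ) * (t + ψ * Complex.I)) *
        Complex.exp (-Complex.exp (t + ψ * Complex.I + σ)) := by
      refine (integrable_exp_neg_mul_exp (mul_pos (Real.cos_pos_of_mem_Ioo (abs_lt.1 hψ'))
        (Real.exp_pos σ)) hc).mono' (by fun_prop) (ae_of_all _ fun t => ?_)
      rw [norm_mul, norm_cexp_ray, norm_cexp_neg_ray, mul_comm]
    simp only [e]
    rw [integral_sub (integrable_tail_integrand hα hψ hψ' K σ) (hint.const_mul _),
      integral_const_mul, integral_cexp_mul_cexp_neg_ray hψ' hc, ← Complex.ofReal_mul,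
      Complex.sub_im, Complex.ofReal_im, sub_zero, ih]

lemma integral_exp_neg_mul_exp_mul_exp (q c σ : ℝ) :
    ∫ t : ℝ, Real.exp (-(q * Real.exp σ * Real.exp t)) * Real.exp (c * t) =
      (∫ t : ℝ, Real.exp (-(q * Real.exp t)) * Real.exp (c * t)) * Real.exp (-(c * σ)) := by
  rw [← integral_add_right_eq_self (fun t : ℝ => Real.exp (-(q * Real.exp t)) *
    Real.exp (c * t)) σ, ← integral_mul_const]
  refine integral_congr_ae (ae_of_all _ fun t => ?_)
  simp only [mul_assoc q, ← Real.exp_add, add_comm σ]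
  ring_nf

lemma integrable_of_norm_le_exp {E : Type*} [NormedAddCommGroup E] [SecondCountableTopology E]
    {f : ℝ → E} (hf : Continuous f) {a b C D : ℝ} (ha : 0 < a) (hb : b < 0)
    (hC : ∀ t, ‖f t‖ ≤ C * Real.exp (a * t)) (hD : ∀ t, ‖f t‖ ≤ D * Real.exp (b * t)) :
    Integrable f := by
  rw [← integrableOn_univ, ← Iic_union_Ioi (a := (0 : ℝ)), integrableOn_union]
  exact ⟨((integrableOn_exp_mul_Iic ha 0).const_mul C).mono' hf.aestronglyMeasurable
      (ae_of_all _ hC),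
    ((integrableOn_exp_mul_Ioi hb 0).const_mul D).mono' hf.aestronglyMeasurable
      (ae_of_all _ hD)⟩

lemma abs_im_rayLaplace_le {α ψ : ℝ} (hα : 0 < α) (hψ : |α * ψ - π| < π / 2)
    (hψ' : |ψ| < π / 2) (K : ℕ) :
    ∃ C : ℝ, ∀ σ, |(rayLaplace α ψ σ).im| ≤ C * Real.exp (-(α * (K + 1)) * σ) := by
  have hc := Real.cos_pos_of_mem_Ioo (abs_lt.1 hψ')
  have hc' : 0 < α * (K + 1) := by positivity
  refine ⟨∫ t : ℝ, Real.exp (-(Real.cos ψ * Real.exp t)) * Real.exp (α * (K + 1) * t), fun σ => ?_⟩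
  rw [im_rayLaplace hα hψ hψ' K]
  refine (Complex.abs_im_le_norm _).trans ((norm_integral_le_of_norm_le
    (integrable_exp_neg_mul_exp (mul_pos hc (Real.exp_pos σ)) hc')
    (ae_of_all _ fun t => norm_tail_integrand_le hψ K t σ)).trans_eq ?_)
  rw [integral_exp_neg_mul_exp_mul_exp, neg_mul]

lemma norm_ray_integrand_le {α ψ : ℝ} (hψ' : |ψ| < π / 2) (σ t : ℝ) :
    ‖Complex.exp (α * (t + ψ * Complex.I)) *
      Complex.exp (Complex.exp (α * (t + ψ * Complex.I))) *
      Complex.exp (-Complex.exp (t + ψ * Complex.I + σ))‖ ≤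
      Real.exp (α * t) * Real.exp (-(-Real.cos (α * ψ) * Real.exp (α * t))) := by
  rw [norm_mul, norm_mul, norm_cexp_ray, norm_cexp_cexp_ray]
  refine mul_le_of_le_one_right (by positivity) ?_
  rw [Complex.norm_exp, Real.exp_le_one_iff, Complex.neg_re]
  exact neg_nonpos.2 (re_cexp_ray_pos hψ' _ _).le

lemma abs_im_rayLaplace_le_const {α ψ : ℝ} (hα : 0 < α) (hψ : |α * ψ - π| < π / 2)
    (hψ' : |ψ| < π / 2) : ∃ C : ℝ, ∀ σ, |(rayLaplace α ψ σ).im| ≤ C :=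
  ⟨_, fun σ => (Complex.abs_im_le_norm _).trans (norm_integral_le_of_norm_le
    (integrable_exp_neg_mul_exp_mul hα (cos_neg_of_abs_sub_pi hψ) hα)
    (ae_of_all _ fun t => norm_ray_integrand_le hψ' σ t))⟩

lemma continuous_rayLaplace {α ψ : ℝ} (hα : 0 < α) (hψ : |α * ψ - π| < π / 2)
    (hψ' : |ψ| < π / 2) : Continuous (rayLaplace α ψ) :=
  continuous_of_dominated (fun σ => by fun_prop)
    (fun σ => ae_of_all _ fun t => norm_ray_integrand_le hψ' σ t)
    (integrable_exp_neg_mul_exp_mul hα (cos_neg_of_abs_sub_pi hψ) hα)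
    (ae_of_all _ fun t => by fun_prop)

lemma integrable_exp_mul_im_rayLaplace {α ψ : ℝ} (h1 : 1 < α) (hψ : |α * ψ - π| < π / 2)
    (hψ' : |ψ| < π / 2) (m : ℕ) :
    Integrable fun τ : ℝ => Real.exp ((α * m + 1) * τ) * (rayLaplace α ψ τ).im := by
  have h0 : 0 < α := by linarith
  have hc : Continuous fun τ : ℝ => Real.exp ((α * m + 1) * τ) * (rayLaplace α ψ τ).im :=
    Continuous.mul (by fun_prop) (Complex.continuous_im.comp (continuous_rayLaplace h0 hψ hψ'))
  obtain ⟨C, hC⟩ := abs_im_rayLaplace_le_const h0 hψ hψ'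
  obtain ⟨D, hD⟩ := abs_im_rayLaplace_le h0 hψ hψ' m
  refine integrable_of_norm_le_exp hc (a := α * m + 1) (b := 1 - α) (C := C) (D := D)
    (by positivity) (by linarith) (fun τ => ?_) (fun τ => ?_)
  · rw [norm_mul, Real.norm_of_nonneg (Real.exp_pos _).le, mul_comm]
    exact mul_le_mul_of_nonneg_right (hC τ) (Real.exp_pos _).le
  · rw [norm_mul, Real.norm_of_nonneg (Real.exp_pos _).le]
    refine (mul_le_mul_of_nonneg_left (hD τ) (Real.exp_pos _).le).trans_eq ?_
    rw [mul_left_comm, ← Real.exp_add]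
    ring_nf

lemma norm_cexp_mul_expTail_le {θ : ℝ} (hθ : |θ - π| < π / 2) (c : ℝ) (m : ℕ) (v : ℝ) :
    ‖Complex.exp (c * (v + θ * Complex.I)) * expTail m (Complex.exp (v + θ * Complex.I))‖ ≤
      1 * Real.exp ((c + m) * v) := by
  have hre := re_cexp_ray_nonpos (α := 1) (ψ := θ) (by simpa using hθ) v
  simp only [Complex.ofReal_one, one_mul] at hre
  have hn := norm_cexp_ray 1 v θ
  simp only [Complex.ofReal_one, one_mul] at hn
  rw [norm_mul, norm_cexp_ray, one_mul, add_mul, Real.exp_add, Real.exp_nat_mul, ← hn]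
  exact mul_le_mul_of_nonneg_left (norm_expTail_le m hre) (Real.exp_pos _).le

lemma norm_cexp_mul_expTail_succ_le {θ : ℝ} (hθ : |θ - π| < π / 2) (c : ℝ) (m : ℕ) (v : ℝ) :
    ‖Complex.exp (c * (v + θ * Complex.I)) * expTail (m + 1) (Complex.exp (v + θ * Complex.I))‖ ≤
      2 * Real.exp ((c + m) * v) := by
  have hre := re_cexp_ray_nonpos (α := 1) (ψ := θ) (by simpa using hθ) v
  simp only [Complex.ofReal_one, one_mul] at hre
  have hn := norm_cexp_ray 1 v θ
  simp only [Complex.ofReal_one, one_mul] at hn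
  rw [norm_mul, norm_cexp_ray, add_mul, Real.exp_add, Real.exp_nat_mul, ← hn, mul_left_comm]
  exact mul_le_mul_of_nonneg_left (norm_expTail_succ_le m hre) (Real.exp_pos _).le

lemma tendsto_zero_atBot_of_norm_le_exp {E : Type*} [NormedAddCommGroup E] {f : ℝ → E} {a C : ℝ}
    (ha : 0 < a) (hC : ∀ t, ‖f t‖ ≤ C * Real.exp (a * t)) : Tendsto f atBot (𝓝 0) := by
  refine squeeze_zero_norm hC ?_
  simpa using (Real.tendsto_exp_atBot.comp (tendsto_id.const_mul_atBot ha)).const_mul C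

lemma tendsto_zero_atTop_of_norm_le_exp {E : Type*} [NormedAddCommGroup E] {f : ℝ → E} {b C : ℝ}
    (hb : b < 0) (hC : ∀ t, ‖f t‖ ≤ C * Real.exp (b * t)) : Tendsto f atTop (𝓝 0) := by
  refine squeeze_zero_norm hC ?_
  simpa using (Real.tendsto_exp_atBot.comp (tendsto_id.const_mul_atTop_of_neg hb)).const_mul C

/-- The Cauchy–Saalschütz formula, integrating along a ray in the left half-plane. -/
lemma integral_cexp_mul_expTail {θ : ℝ} (hθ : |θ - π| < π / 2) (m : ℕ) {c : ℝ}
    (hc : -(m : ℝ) < c) (hc' : c < 1 - m) :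
    (Integrable fun v : ℝ => Complex.exp (c * (v + θ * Complex.I)) *
      expTail m (Complex.exp (v + θ * Complex.I))) ∧
    ∫ v : ℝ, Complex.exp (c * (v + θ * Complex.I)) *
      expTail m (Complex.exp (v + θ * Complex.I)) =
      Real.Gamma c * Complex.exp ((c * π : ℝ) * Complex.I) := by
  induction m generalizing c with
  | zero =>
    have hc0 : 0 < c := by simpa using hc
    have h1 := integrable_cexp_mul_cexp_cexp (α := 1) (ψ := θ) one_pos (by simpa using hθ) hc0
    have h2 := integral_cexp_mul_cexp_cexp (α := 1) (ψ := θ) one_pos (by simpa using hθ) hc0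
    simp only [expTail_zero]
    constructor
    · simpa using h1
    · simpa using h2
  | succ m ih =>
    push_cast at hc hc'
    have hc0 : c ≠ 0 := by have := m.cast_nonneg (α := ℝ); intro h; subst h; linarith
    obtain ⟨hi, he⟩ := ih (c := c + 1) (by linarith) (by linarith)
    have hb1 := norm_cexp_mul_expTail_le hθ c (m + 1)
    have hb2 := norm_cexp_mul_expTail_succ_le hθ c m
    have ha : 0 < c + ((m + 1 : ℕ) : ℝ) := by push_cast; linarith
    have hb : c + (m : ℝ) < 0 := by linarith
    have hint := integrable_of_norm_le_exp (by fun_prop) ha hb hb1 hb2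
    refine ⟨hint, ?_⟩
    have hd : ∀ v : ℝ, HasDerivAt (fun v : ℝ => Complex.exp (c * (v + θ * Complex.I)) *
        expTail (m + 1) (Complex.exp (v + θ * Complex.I)))
        (c * (Complex.exp (c * (v + θ * Complex.I)) *
          expTail (m + 1) (Complex.exp (v + θ * Complex.I))) +
        Complex.exp ((c + 1 : ℝ) * (v + θ * Complex.I)) *
          expTail m (Complex.exp (v + θ * Complex.I))) v := fun v => by
      have hw : HasDerivAt (fun v : ℝ => (v : ℂ) + θ * Complex.I) 1 v :=
        (Complex.ofRealCLM.hasDerivAt (x := v)).add_const _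
      have h1 := (hw.const_mul (c : ℂ)).cexp
      have h2 := (hasDerivAt_expTail m (Complex.exp (v + θ * Complex.I))).comp v hw.cexp
      refine (h1.mul h2).congr_deriv ?_
      push_cast
      rw [add_mul, one_mul, Complex.exp_add (c * _), Function.comp_apply]
      ring
    have h := integral_of_hasDerivAt_of_tendsto hd ((hint.const_mul (c : ℂ)).add hi)
      (tendsto_zero_atBot_of_norm_le_exp ha hb1) (tendsto_zero_atTop_of_norm_le_exp hb hb2)
    rw [integral_add (hint.const_mul (c : ℂ)) hi, integral_const_mul, he, sub_zero,
      Real.Gamma_add_one hc0, add_mul c 1 π, one_mul, Complex.ofReal_add (c * π), add_mul (_ : ℂ),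
      Complex.exp_add, Complex.exp_pi_mul_I] at h
    have hcc : (c : ℂ) ≠ 0 := by exact_mod_cast hc0
    refine mul_left_cancel₀ hcc ?_
    push_cast at h ⊢
    linear_combination h

lemma integral_ray_mul_expTail {α ψ : ℝ} (h1 : 1 < α) (hψ : |α * ψ - π| < π / 2) (K : ℕ) :
    ∫ t : ℝ, Complex.exp (α * (t + ψ * Complex.I)) *
      expTail (K + 1) (Complex.exp (α * (t + ψ * Complex.I))) *
      Complex.exp (-((α * (K + 1) + 1 : ℝ) * (t + ψ * Complex.I))) =
    (1 / α * Real.Gamma (-K - 1 / α) : ℝ) *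
      Complex.exp (((-K - 1 / α) * π : ℝ) * Complex.I) := by
  have h0 : 0 < α := by linarith
  have hlt : 1 / α < 1 := by rw [div_lt_one h0]; exact h1
  have hpos : 0 < 1 / α := by positivity
  have hJ := (integral_cexp_mul_expTail hψ (K + 1) (c := -K - 1 / α) (by push_cast; linarith)
    (by push_cast; linarith)).2
  have hcv := Measure.integral_comp_mul_left (fun v : ℝ =>
    Complex.exp ((-K - 1 / α : ℝ) * (v + (α * ψ : ℝ) * Complex.I)) *
      expTail (K + 1) (Complex.exp (v + (α * ψ : ℝ) * Complex.I))) α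
  rw [hJ, abs_of_pos (inv_pos.2 h0)] at hcv
  have hne : (α : ℂ) ≠ 0 := by exact_mod_cast h0.ne'
  calc _ = _ := by
        refine integral_congr_ae (ae_of_all _ fun t => ?_)
        simp only
        rw [mul_right_comm, ← Complex.exp_add]
        push_cast
        congr 2
        · field_simp
          ring
        · ring_nf
    _ = _ := hcv
    _ = _ := by
        rw [Complex.real_smul]
        push_cast
        ring

lemma integrable_tail_prod {α ψ : ℝ} (h1 : 1 < α) (hψ : |α * ψ - π| < π / 2)
    (hψ' : |ψ| < π / 2) (K : ℕ) :
    Integrable (fun q : ℝ × ℝ => (Complex.exp (α * (q.1 + ψ * Complex.I)) *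
        expTail (K + 1) (Complex.exp (α * (q.1 + ψ * Complex.I))) *
        Complex.exp (-Complex.exp (q.1 + ψ * Complex.I + q.2))) *
        (Real.exp ((α * (K + 1) + 1) * q.2) : ℝ)) (volume.prod volume) := by
  have h0 : 0 < α := by linarith
  have hcos := Real.cos_pos_of_mem_Ioo (abs_lt.1 hψ')
  have hp : 0 < α * (K + 1) + 1 := by positivity
  have hn : ∀ t τ : ℝ, ‖(Complex.exp (α * (t + ψ * Complex.I)) *
        expTail (K + 1) (Complex.exp (α * (t + ψ * Complex.I))) *
        Complex.exp (-Complex.exp (t + ψ * Complex.I + τ))) *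
        (Real.exp ((α * (K + 1) + 1) * τ) : ℝ)‖ =
      ‖Complex.exp (α * (t + ψ * Complex.I)) *
        expTail (K + 1) (Complex.exp (α * (t + ψ * Complex.I)))‖ *
      (Real.exp (-(Real.cos ψ * Real.exp t * Real.exp τ)) *
        Real.exp ((α * (K + 1) + 1) * τ)) := fun t τ => by
    rw [norm_mul, norm_mul, norm_cexp_neg_ray, Complex.norm_real,
      Real.norm_of_nonneg (Real.exp_pos _).le, mul_right_comm _ (Real.exp τ)]
    ring
  have hcont : ∀ t : ℝ, Integrable fun τ : ℝ =>
      Real.exp (-(Real.cos ψ * Real.exp t * Real.exp τ)) *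
        Real.exp ((α * (K + 1) + 1) * τ) := fun t =>
    integrable_exp_neg_mul_exp (mul_pos hcos (Real.exp_pos t)) hp
  rw [integrable_prod_iff (Continuous.aestronglyMeasurable (by fun_prop))]
  refine ⟨ae_of_all _ fun t => ((hcont t).const_mul _).mono' (by fun_prop)
    (ae_of_all _ fun τ => (hn t τ).le), ?_⟩
  simp only [hn, integral_const_mul, integral_exp_neg_mul_exp_mul_exp]
  set M := ∫ t : ℝ, Real.exp (-(Real.cos ψ * Real.exp t)) * Real.exp ((α * (K + 1) + 1) * t)
  have hM : 0 ≤ M := integral_nonneg fun t => by positivity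
  refine integrable_of_norm_le_exp (by fun_prop) (a := α - 1) (b := -1) (C := M) (D := 2 * M)
    (by linarith) (by norm_num) (fun t => ?_) (fun t => ?_)
  all_goals
    rw [norm_mul, norm_norm, norm_mul, norm_cexp_ray,
      Real.norm_of_nonneg (mul_nonneg hM (Real.exp_pos _).le)]
  · refine (mul_le_mul_of_nonneg_right (mul_le_mul_of_nonneg_left
      (norm_expTail_le (K + 1) (re_cexp_ray_nonpos hψ t)) (Real.exp_pos _).le)
      (mul_nonneg hM (Real.exp_pos _).le)).trans_eq ?_
    rw [norm_cexp_ray, ← Real.exp_nat_mul, mul_left_comm, ← Real.exp_add, ← Real.exp_add]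
    push_cast
    ring_nf
  · refine (mul_le_mul_of_nonneg_right (mul_le_mul_of_nonneg_left
      (norm_expTail_succ_le K (re_cexp_ray_nonpos hψ t)) (Real.exp_pos _).le)
      (mul_nonneg hM (Real.exp_pos _).le)).trans_eq ?_
    rw [norm_cexp_ray, ← Real.exp_nat_mul, mul_left_comm _ 2, mul_assoc 2,
      ← Real.exp_add, mul_left_comm _ M, mul_assoc 2, mul_left_comm _ M,
      ← mul_assoc 2 M, ← Real.exp_add]
    ring_nf

lemma integral_exp_mul_im_rayLaplace {α ψ : ℝ} (h1 : 1 < α) (hψ : |α * ψ - π| < π / 2)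
    (hψ' : |ψ| < π / 2) (K : ℕ) :
    ∫ τ : ℝ, Real.exp ((α * (K + 1) + 1) * τ) * (rayLaplace α ψ τ).im =
      Real.Gamma (α * (K + 1) + 1) * (1 / α * Real.Gamma (-K - 1 / α)) *
        Real.sin ((-K - 1 / α) * π) := by
  have h0 : 0 < α := by linarith
  have hp : 0 < α * (K + 1) + 1 := by positivity
  have hF := integrable_tail_prod h1 hψ hψ' K
  have h := integral_integral_swap (f := fun t τ : ℝ => (Complex.exp (α * (t + ψ * Complex.I)) *
        expTail (K + 1) (Complex.exp (α * (t + ψ * Complex.I))) *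
        Complex.exp (-Complex.exp (t + ψ * Complex.I + τ))) *
        (Real.exp ((α * (K + 1) + 1) * τ) : ℝ)) hF
  have hG := hF.integral_prod_right
  simp only [integral_mul_const] at h hG
  have hinner : ∀ t : ℝ, ∫ τ : ℝ, (Complex.exp (α * (t + ψ * Complex.I)) *
        expTail (K + 1) (Complex.exp (α * (t + ψ * Complex.I))) *
        Complex.exp (-Complex.exp (t + ψ * Complex.I + τ))) *
        (Real.exp ((α * (K + 1) + 1) * τ) : ℝ) =
      Real.Gamma (α * (K + 1) + 1) * (Complex.exp (α * (t + ψ * Complex.I)) *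
        expTail (K + 1) (Complex.exp (α * (t + ψ * Complex.I))) *
        Complex.exp (-((α * (K + 1) + 1 : ℝ) * (t + ψ * Complex.I)))) := fun t => by
    have e := integral_cexp_neg_mul_exp (u := t + ψ * Complex.I) (by simpa using hψ') hp
    simp only [cexp_mul_ofReal_exp] at e
    rw [mul_left_comm, ← e, ← integral_const_mul]
    refine integral_congr_ae (ae_of_all _ fun τ => ?_)
    push_cast
    ring
  simp only [hinner, integral_const_mul, integral_ray_mul_expTail h1 hψ] at h
  rw [← mul_assoc, ← Complex.ofReal_mul] at h
  rw [← im_ofReal_mul_cexp, h]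
  refine Eq.trans (integral_congr_ae (ae_of_all _ fun τ => ?_)) (integral_im hG)
  simp only
  rw [im_rayLaplace h0 hψ hψ' (K + 1), mul_comm (∫ t : ℝ, _) _]
  exact (Complex.im_ofReal_mul _ _).symm

/-! ### The expansion at zero -/

lemma sum_sin_mul_pow_mul (θ y : ℝ) (N : ℕ) :
    Real.sin θ * y = (∑ k ∈ Finset.range N, Real.sin ((k + 1) * θ) * y ^ (k + 1)) *
      (y ^ 2 - 2 * y * Real.cos θ + 1) +
      y ^ (N + 1) * (Real.sin ((N + 1) * θ) - y * Real.sin (N * θ)) := by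
  induction N with
  | zero => simp; ring
  | succ N ih =>
    rw [ih, Finset.sum_range_succ]
    have e1 : Real.sin ((N + 1 + 1) * θ) =
        Real.sin ((N + 1) * θ) * Real.cos θ + Real.cos ((N + 1) * θ) * Real.sin θ := by
      rw [← Real.sin_add]; ring_nf
    have e2 : Real.sin (N * θ) =
        Real.sin ((N + 1) * θ) * Real.cos θ - Real.cos ((N + 1) * θ) * Real.sin θ := by
      rw [← Real.sin_sub]; ring_nf
    push_cast
    rw [e1, e2]
    ring

lemma abs_sin_mul_div_sub_sum_le {θ y : ℝ} (hs : Real.sin θ ≠ 0) (hy : 0 ≤ y) (N : ℕ) :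
    |Real.sin θ * (y / (y ^ 2 - 2 * y * Real.cos θ + 1)) -
      ∑ k ∈ Finset.range N, Real.sin ((k + 1) * θ) * y ^ (k + 1)| ≤
      2 / Real.sin θ ^ 2 * y ^ (N + 1) := by
  have hD := kernel_denom_pos hs y
  have hsq : 0 < Real.sin θ ^ 2 := by positivity
  have hnum : |Real.sin ((N + 1) * θ) - y * Real.sin (N * θ)| ≤ 1 + y := by
    refine (abs_sub _ _).trans (add_le_add (Real.abs_sin_le_one _) ?_)
    rw [abs_mul, abs_of_nonneg hy]
    exact mul_le_of_le_one_right hy (Real.abs_sin_le_one _)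
  have hden : (1 + y) * Real.sin θ ^ 2 ≤ 2 * (y ^ 2 - 2 * y * Real.cos θ + 1) := by
    have hid := Real.sin_sq_add_cos_sq θ
    rcases le_total y 1 with h | h
    · nlinarith [sq_nonneg (y - Real.cos θ)]
    · have : y ^ 2 * Real.sin θ ^ 2 ≤ y ^ 2 - 2 * y * Real.cos θ + 1 := by
        rw [show Real.sin θ ^ 2 = 1 - Real.cos θ ^ 2 by linarith]
        nlinarith [sq_nonneg (1 - y * Real.cos θ)]
      nlinarith [mul_le_mul_of_nonneg_right (show 1 + y ≤ 2 * y ^ 2 by nlinarith) hsq.le]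
  have e : Real.sin θ * (y / (y ^ 2 - 2 * y * Real.cos θ + 1)) -
      ∑ k ∈ Finset.range N, Real.sin ((k + 1) * θ) * y ^ (k + 1) =
      y ^ (N + 1) * ((Real.sin ((N + 1) * θ) - y * Real.sin (N * θ)) /
        (y ^ 2 - 2 * y * Real.cos θ + 1)) := by
    rw [← mul_div_assoc, sum_sin_mul_pow_mul θ y N, add_div, mul_div_cancel_right₀ _ hD.ne']
    ring
  rw [e, abs_mul, abs_of_nonneg (pow_nonneg hy _), mul_comm (2 / _)]
  refine mul_le_mul_of_nonneg_left ?_ (pow_nonneg hy _)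
  rw [abs_div, abs_of_pos hD, div_le_div_iff₀ hD hsq]
  exact (mul_le_mul_of_nonneg_right hnum hsq.le).trans hden

lemma coeff_eq {α : ℝ} (h1 : 1 < α) (k : ℕ) :
    -(α / π) ^ 2 * (Real.sin ((k + 1) * (π * α)) *
      (Real.Gamma (α * (k + 1) + 1) * (1 / α * Real.Gamma (-k - 1 / α)) *
        Real.sin ((-k - 1 / α) * π))) =
    α / (Real.Gamma (-α * (k + 1)) * Real.Gamma (1 / α + (k + 1))) := by
  have h0 : 0 < α := by linarith
  have hpi := Real.pi_pos
  have hlt : 1 / α < 1 := by rw [div_lt_one h0]; exact h1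
  have hpos : 0 < 1 / α := by positivity
  have e1 := sin_mul_Gamma_one_sub (s := -α * (k + 1)) (by nlinarith [k.cast_nonneg (α := ℝ)])
  rw [show π * (-α * (k + 1)) = -((k + 1) * (π * α)) by ring, Real.sin_neg,
    show 1 - -α * ((k : ℝ) + 1) = α * (k + 1) + 1 by ring] at e1
  have hsin : Real.sin ((-k - 1 / α) * π) ≠ 0 := by
    rw [Ne, Real.sin_eq_zero_iff]
    rintro ⟨n, hn⟩
    have hn' := mul_right_cancel₀ hpi.ne' hn
    have a1 : (0 : ℝ) < ((-k - n : ℤ) : ℝ) := by push_cast; linarith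
    have a2 : ((-k - n : ℤ) : ℝ) < 1 := by push_cast; linarith
    have b1 : (0 : ℤ) < -k - n := by exact_mod_cast a1
    have b2 : (-k - n : ℤ) < 1 := by exact_mod_cast a2
    omega
  have e2 := Real.Gamma_mul_Gamma_one_sub (-k - 1 / α)
  rw [show 1 - (-(k : ℝ) - 1 / α) = 1 / α + (k + 1) by ring, mul_comm π,
    eq_div_iff hsin] at e2
  have hG : Real.Gamma (1 / α + (k + 1)) ≠ 0 := (Real.Gamma_pos_of_pos (by positivity)).ne'
  have e2' : Real.Gamma (-k - 1 / α) * Real.sin ((-k - 1 / α) * π) =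
      π / Real.Gamma (1 / α + (k + 1)) := by
    rw [eq_div_iff hG]; linear_combination e2
  calc _ = (α / π) ^ 2 * (1 / α) * (-Real.sin ((k + 1) * (π * α)) * Real.Gamma (α * (k + 1) + 1)) *
        (Real.Gamma (-k - 1 / α) * Real.sin ((-k - 1 / α) * π)) := by ring
    _ = _ := by
        rw [e1, e2', div_mul_eq_div_div α]
        field_simp

lemma exp_mul_kernelExp_comp_sub (α x τ : ℝ) (hα : 0 < α) (hx : 0 < x) :
    Real.exp (τ - -(Real.log x) / α) * kernelExp α (τ - -(Real.log x) / α) =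
      x ^ (1 / α) * (Real.exp τ * (x * Real.exp (α * τ) /
        ((x * Real.exp (α * τ)) ^ 2 - 2 * (x * Real.exp (α * τ)) * Real.cos (π * α) + 1))) := by
  have e1 : Real.exp (α * (τ - -(Real.log x) / α)) = x * Real.exp (α * τ) := by
    rw [show α * (τ - -(Real.log x) / α) = Real.log x + α * τ by field_simp; ring, Real.exp_add,
      Real.exp_log hx]
  have e2 : Real.exp (τ - -(Real.log x) / α) = x ^ (1 / α) * Real.exp τ := by
    rw [Real.rpow_def_of_pos hx, ← Real.exp_add]; ring_nf
  rw [kernelExp, e1, e2, mul_assoc]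

lemma exists_abs_hittingDensity_sub_sum_le {α : ℝ} (h1 : 1 < α) (h2 : α < 2) (N : ℕ) :
    ∃ C : ℝ, ∀ x : ℝ, 0 < x → |hittingDensity α x - ∑ k ∈ Finset.range N,
      α * x ^ (1 / α + k) / (Real.Gamma (-α * (k + 1)) * Real.Gamma (1 / α + (k + 1)))| ≤
      C * x ^ (1 / α + N) := by
  have h0 : 0 < α := by linarith
  have hpi := Real.pi_pos
  obtain ⟨ψ, hψ, hψ'⟩ : ∃ ψ : ℝ, |α * ψ - π| < π / 2 ∧ |ψ| < π / 2 := by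
    refine ⟨π / 4 + π / (4 * α), ?_, ?_⟩
    · rw [show α * (π / 4 + π / (4 * α)) - π = π * (α - 3) / 4 by field_simp; ring, abs_lt]
      constructor <;> nlinarith
    · have : π / (4 * α) < π / 4 := by
        apply div_lt_div_of_pos_left hpi <;> linarith
      rw [abs_of_pos (by positivity)]
      linarith
  have hs := sin_pi_mul_ne_zero_of_lt h1 h2
  set f : ℝ → ℝ := fun τ => (rayLaplace α ψ τ).im with hf
  have hfc : Continuous f := Complex.continuous_im.comp (continuous_rayLaplace h0 hψ hψ')
  have hfi : ∀ m : ℕ, Integrable fun τ => Real.exp ((α * m + 1) * τ) * f τ :=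
    integrable_exp_mul_im_rayLaplace h1 hψ hψ'
  set C := ∫ τ, ‖Real.exp ((α * (N + 1 : ℕ) + 1) * τ) * f τ‖ with hC
  refine ⟨(α / π) ^ 2 * (2 / Real.sin (π * α) ^ 2 * C), fun x hx => ?_⟩
  set Y : ℝ → ℝ := fun τ => x * Real.exp (α * τ) with hY
  have hY0 : ∀ τ, 0 ≤ Y τ := fun τ => by positivity
  set g : ℝ → ℝ := fun τ => Real.sin (π * α) * (Y τ / (Y τ ^ 2 - 2 * Y τ * Real.cos (π * α) + 1)) *
    (Real.exp τ * f τ) with hg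
  set S : ℕ → ℝ → ℝ := fun k τ => Real.sin ((k + 1) * (π * α)) * x ^ (k + 1) *
    (Real.exp ((α * (k + 1 : ℕ) + 1) * τ) * f τ) with hS
  have hexp : ∀ (k : ℕ) (τ : ℝ), Real.exp ((α * k + 1) * τ) = Real.exp (α * τ) ^ k * Real.exp τ :=
    fun k τ => by rw [← Real.exp_nat_mul, ← Real.exp_add]; ring_nf
  have hSi : ∀ k, Integrable (S k) := fun k => (hfi (k + 1)).const_mul _
  have hgc : Continuous g := by
    have hYc : Continuous Y := by fun_prop
    exact (continuous_const.mul (hYc.div (by fun_prop)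
      fun τ => (kernel_denom_pos hs _).ne')).mul (by fun_prop)
  have hbound : ∀ τ, ‖g τ - ∑ k ∈ Finset.range N, S k τ‖ ≤ 2 / Real.sin (π * α) ^ 2 * x ^ (N + 1) *
      ‖Real.exp ((α * (N + 1 : ℕ) + 1) * τ) * f τ‖ := fun τ => by
    have hsum : ∑ k ∈ Finset.range N, S k τ =
        (∑ k ∈ Finset.range N, Real.sin ((k + 1) * (π * α)) * Y τ ^ (k + 1)) *
          (Real.exp τ * f τ) := by
      rw [Finset.sum_mul]
      refine Finset.sum_congr rfl fun k _ => ?_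
      simp only [hS, hY, hexp, mul_pow]
      ring
    rw [hsum, hg, ← sub_mul, norm_mul]
    refine (mul_le_mul_of_nonneg_right (abs_sin_mul_div_sub_sum_le hs (hY0 τ) N)
      (norm_nonneg _)).trans_eq ?_
    rw [hexp, mul_assoc (_ ^ (N + 1)) (Real.exp τ), norm_mul (_ ^ _),
      Real.norm_of_nonneg (pow_nonneg (Real.exp_pos (α * τ)).le _), mul_pow]
    ring
  have hRi : Integrable fun τ => g τ - ∑ k ∈ Finset.range N, S k τ :=
    ((hfi (N + 1)).norm.const_mul _).mono'
      (hgc.sub (by simp only [hS]; fun_prop)).aestronglyMeasurable (ae_of_all _ hbound)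
  have hsi : Integrable fun τ => ∑ k ∈ Finset.range N, S k τ :=
    integrable_finsetSum _ fun k _ => hSi k
  have hgi : Integrable g := (hRi.add hsi).congr (ae_of_all _ fun τ => by simp)
  have hR : |(∫ τ, g τ) - ∑ k ∈ Finset.range N, ∫ τ, S k τ| ≤
      2 / Real.sin (π * α) ^ 2 * x ^ (N + 1) * C := by
    rw [← integral_finsetSum _ fun k _ => hSi k, ← integral_sub hgi hsi, hC,
      ← integral_const_mul]
    exact norm_integral_le_of_norm_le ((hfi (N + 1)).norm.const_mul _) (ae_of_all _ hbound)
  have hh : hittingDensity α x = -(α / π) ^ 2 * (x ^ (1 / α) / x) * ∫ τ, g τ := by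
    rw [hittingDensity_eq_integral h1 h2 hψ hψ' hx,
      ← integral_sub_right_eq_self (fun τ => Real.exp τ * kernelExp α τ *
        (rayLaplace α ψ (τ + -(Real.log x) / α)).im) (-(Real.log x) / α)]
    simp only [sub_add_cancel, exp_mul_kernelExp_comp_sub α x _ h0 hx]
    rw [mul_div_assoc, mul_assoc, mul_assoc, div_mul_eq_mul_div, div_mul_eq_mul_div,
      ← integral_const_mul, ← integral_const_mul]
    congr 3
    funext τ
    simp only [hg, hY, hf]
    ring
  have hpow : ∀ k : ℕ, x ^ (1 / α + (k : ℝ)) = x ^ (1 / α) / x * x ^ (k + 1) := fun k => by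
    rw [Real.rpow_add hx, Real.rpow_natCast, pow_succ]
    field_simp
  have hcoef : ∑ k ∈ Finset.range N,
      α * x ^ (1 / α + (k : ℝ)) / (Real.Gamma (-α * (k + 1)) * Real.Gamma (1 / α + (k + 1))) =
      -(α / π) ^ 2 * (x ^ (1 / α) / x) * ∑ k ∈ Finset.range N, ∫ τ, S k τ := by
    rw [Finset.mul_sum]
    refine Finset.sum_congr rfl fun k _ => ?_
    have hM := integral_exp_mul_im_rayLaplace h1 hψ hψ' k
    simp only [hS, hf]
    push_cast
    rw [integral_const_mul, hM, hpow, mul_div_right_comm, ← coeff_eq h1 k]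
    ring
  rw [hh, hcoef, ← mul_sub, abs_mul, hpow N]
  have hx' : 0 ≤ x ^ (1 / α) / x := by positivity
  rw [abs_mul, abs_neg, abs_of_nonneg (sq_nonneg (α / π)), abs_of_nonneg hx']
  refine (mul_le_mul_of_nonneg_left hR (by positivity)).trans_eq ?_
  ring

lemma sum_Icc_eq_sum_range (α x : ℝ) (N : ℕ) :
    ∑ n ∈ Finset.Icc 1 N, α * x ^ (1 / α + (n : ℝ) - 1) /
          (Real.Gamma (-α * (n : ℝ)) * Real.Gamma (1 / α + (n : ℝ))) =
      ∑ k ∈ Finset.range N, α * x ^ (1 / α + (k : ℝ)) /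
        (Real.Gamma (-α * (k + 1)) * Real.Gamma (1 / α + (k + 1))) := by
  induction N with
  | zero => simp
  | succ N ih =>
    rw [Finset.sum_Icc_succ_top (by omega), ih, Finset.sum_range_succ]
    push_cast
    rw [show 1 / α + ((N : ℝ) + 1) - 1 = 1 / α + N by ring]

lemma Gamma_neg_ne_zero {α : ℝ} (h1 : 1 < α) (h2 : α < 2) : Real.Gamma (-α) ≠ 0 := by
  refine Real.Gamma_ne_zero fun m hm => ?_
  have e : α = m := neg_injective hm
  rw [e] at h1 h2
  have a1 : 1 < m := by exact_mod_cast h1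
  have a2 : m < 2 := by exact_mod_cast h2
  omega

lemma isBigO_hittingDensity_sub_sum {α : ℝ} (h1 : 1 < α) (h2 : α < 2) (N : ℕ) :
    (fun x : ℝ => hittingDensity α x -
        ∑ n ∈ Finset.Icc 1 N, α * x ^ (1 / α + (n : ℝ) - 1) /
          (Real.Gamma (-α * (n : ℝ)) * Real.Gamma (1 / α + (n : ℝ))))
      =O[nhdsWithin 0 (Set.Ioi 0)] fun x : ℝ => x ^ (1 / α + (N : ℝ)) := by
  obtain ⟨C, hC⟩ := exists_abs_hittingDensity_sub_sum_le h1 h2 N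
  refine IsBigO.of_bound C ?_
  filter_upwards [self_mem_nhdsWithin] with x hx
  rw [sum_Icc_eq_sum_range, Real.norm_of_nonneg (Real.rpow_nonneg (le_of_lt hx) _)]
  exact hC x hx

lemma isLittleO_rpow_add_one (a : ℝ) :
    (fun x : ℝ => x ^ (a + 1)) =o[nhdsWithin 0 (Set.Ioi 0)] fun x : ℝ => x ^ a := by
  have hx : Tendsto (fun x : ℝ => x) (nhdsWithin 0 (Set.Ioi 0)) (𝓝 0) :=
    tendsto_nhdsWithin_of_tendsto_nhds tendsto_id
  refine ((isLittleO_one_iff ℝ).2 hx |>.mul_isBigO (isBigO_refl (fun x : ℝ => x ^ a) _)).congr' ?_ ?_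
  · filter_upwards [self_mem_nhdsWithin] with x hx
    rw [Real.rpow_add_one (ne_of_gt hx), mul_comm]
  · exact Eventually.of_forall fun x => one_mul _

/-- For every `α ∈ (1,2)` and every integer `N ≥ 1`,
`h_α(x) − Σ_{n=1}^N α x^{1/α+n−1}/(Γ(−αn)Γ(1/α+n)) = O(x^{1/α+N})` as `x → 0⁺`;
in particular `h_α(x) ∼ α x^{1/α}/(Γ(−α)Γ(1+1/α))` as `x → 0⁺`. -/
theorem stmt_7 (α : ℝ) (hα : α ∈ Set.Ioo (1 : ℝ) 2) (N : ℕ) (hN : 1 ≤ N) :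
    ((fun x : ℝ => hittingDensity α x -
        ∑ n ∈ Finset.Icc 1 N, α * x ^ (1 / α + (n : ℝ) - 1) /
          (Real.Gamma (-α * (n : ℝ)) * Real.Gamma (1 / α + (n : ℝ))))
      =O[nhdsWithin 0 (Set.Ioi 0)] fun x : ℝ => x ^ (1 / α + (N : ℝ))) ∧
    Asymptotics.IsEquivalent (nhdsWithin 0 (Set.Ioi 0))
      (fun x : ℝ => hittingDensity α x)
      (fun x : ℝ => α * x ^ (1 / α) / (Real.Gamma (-α) * Real.Gamma (1 + 1 / α))) := by
  obtain ⟨h1, h2⟩ := hα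
  refine ⟨isBigO_hittingDensity_sub_sum h1 h2 N, ?_⟩
  have hc : α / (Real.Gamma (-α) * Real.Gamma (1 + 1 / α)) ≠ 0 :=
    div_ne_zero (by linarith) (mul_ne_zero (Gamma_neg_ne_zero h1 h2)
      (Real.Gamma_pos_of_pos (by positivity)).ne')
  have h := (isBigO_hittingDensity_sub_sum h1 h2 1).trans_isLittleO
    (by simpa using isLittleO_rpow_add_one (1 / α))
  refine (h.const_mul_right hc).congr (fun x => ?_) (fun x => ?_)
  · simp [add_comm α⁻¹ 1]
  · rw [one_div]; ring
end

section
/- For every α ∈ (1,2) and every real s with −1 < s < 1 − 1/α, s ≠ 0 and s ≠ −1/α, one has ∫₀^∞ t^s · f_{T_α}(t) dt = sin(παs)·sin(π/α) / (α·sin(πs)·sin(π(s+1/α))). -/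
open Real MeasureTheory Set

/-- Integrability of `t ^ (a - 1) / (1 + t)` on the positive half-line. -/
lemma integrableOn_rpow_sub_one_div_one_add {a : ℝ} (ha0 : 0 < a) (ha1 : a < 1) :
    IntegrableOn (fun t : ℝ => t ^ (a - 1) / (1 + t)) (Ioi 0) := by
  have hmeas : Measurable fun t : ℝ => t ^ (a - 1) / (1 + t) := by fun_prop
  rw [← Ioc_union_Ioi_eq_Ioi zero_le_one]
  refine IntegrableOn.union ?_ ?_
  · have h : IntegrableOn (fun t : ℝ => t ^ (a - 1)) (Ioc 0 1) := by
      rw [← intervalIntegrable_iff_integrableOn_Ioc_of_le zero_le_one]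
      exact intervalIntegral.intervalIntegrable_rpow' (by linarith)
    refine Integrable.mono' h hmeas.aestronglyMeasurable ?_
    filter_upwards [ae_restrict_mem measurableSet_Ioc] with t ht
    have ht0 : 0 < t := ht.1
    rw [Real.norm_of_nonneg (by positivity)]
    exact div_le_self (by positivity) (by linarith)
  · have h : IntegrableOn (fun t : ℝ => t ^ (a - 2)) (Ioi 1) :=
      integrableOn_Ioi_rpow_of_lt (by linarith) one_pos
    refine Integrable.mono' h hmeas.aestronglyMeasurable ?_
    filter_upwards [ae_restrict_mem measurableSet_Ioi] with t ht
    have ht0 : 0 < t := one_pos.trans ht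
    rw [Real.norm_of_nonneg (by positivity), div_le_iff₀ (by positivity),
      show a - 1 = (a - 2) + 1 by ring, rpow_add_one ht0.ne']
    have := rpow_pos_of_pos ht0 (a - 2)
    nlinarith

/-- The map `t ↦ t / (1 + t)` sends the positive half-line onto the open unit interval. -/
lemma image_div_one_add_Ioi : (fun t : ℝ => t / (1 + t)) '' Ioi 0 = Ioo 0 1 := by
  ext x
  constructor
  · rintro ⟨t, ht, rfl⟩
    have ht0 : 0 < t := ht
    exact ⟨by positivity, by rw [div_lt_one (by positivity)]; linarith⟩
  · rintro ⟨h0, h1⟩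
    have h : 0 < 1 - x := by linarith
    refine ⟨x / (1 - x), div_pos h0 h, ?_⟩
    field_simp
    ring

lemma integral_rpow_sub_one_div_one_add {a : ℝ} (ha0 : 0 < a) (ha1 : a < 1) :
    ∫ t in Ioi (0 : ℝ), t ^ (a - 1) / (1 + t) = π / sin (π * a) := by
  have hG := Complex.Gamma_mul_Gamma_eq_betaIntegral (s := (a : ℂ)) (t := ((1 - a : ℝ) : ℂ))
    (by simpa using ha0) (by simpa using ha1)
  rw [← Complex.ofReal_add, add_sub_cancel, Complex.ofReal_one, Complex.Gamma_one, one_mul,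
    Complex.Gamma_ofReal, Complex.Gamma_ofReal, ← Complex.ofReal_mul,
    Real.Gamma_mul_Gamma_one_sub] at hG
  have hB : Complex.betaIntegral a ((1 - a : ℝ) : ℂ)
      = ((∫ x in Ioo (0 : ℝ) 1, x ^ (a - 1) * (1 - x) ^ (-a) : ℝ) : ℂ) := by
    rw [Complex.betaIntegral, intervalIntegral.integral_of_le zero_le_one,
      integral_Ioc_eq_integral_Ioo, ← integral_complex_ofReal]
    refine setIntegral_congr_fun measurableSet_Ioo fun x hx => ?_
    simp only [Complex.ofReal_mul]
    rw [Complex.ofReal_cpow hx.1.le, Complex.ofReal_cpow (by linarith [hx.2])]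
    push_cast
    congr 2
    ring
  have hinj : InjOn (fun t : ℝ => t / (1 + t)) (Ioi 0) := by
    intro x hx y hy h
    have hx0 : 0 < x := hx
    have hy0 : 0 < y := hy
    simp only at h
    field_simp at h
    linarith
  have hd : ∀ t ∈ Ioi (0 : ℝ),
      HasDerivWithinAt (fun t : ℝ => t / (1 + t)) (1 / (1 + t) ^ 2) (Ioi 0) t := by
    intro t ht
    have ht0 : 0 < t := ht
    refine HasDerivAt.hasDerivWithinAt ?_
    convert! (hasDerivAt_id t).div ((hasDerivAt_id t).const_add 1) (by simp; positivity) using 1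
    simp
  rw [hB, Complex.ofReal_inj, ← image_div_one_add_Ioi,
    integral_image_eq_integral_abs_deriv_smul measurableSet_Ioi hd hinj] at hG
  rw [hG]
  refine setIntegral_congr_fun measurableSet_Ioi fun t ht => ?_
  have ht0 : 0 < t := ht
  have h1 : 0 < 1 + t := by positivity
  have h2 : 1 - t / (1 + t) = (1 + t)⁻¹ := by field_simp; ring
  simp only [smul_eq_mul]
  rw [h2, abs_of_pos (by positivity), div_rpow ht0.le h1.le, inv_rpow h1.le, rpow_neg h1.le,
    inv_inv, rpow_sub_one h1.ne']
  have := rpow_pos_of_pos h1 a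
  field_simp

/-- The Stieltjes transform of a power on the positive real axis. -/
lemma integral_rpow_sub_one_div_add {a x : ℝ} (ha0 : 0 < a) (ha1 : a < 1) (hx : 0 < x) :
    ∫ t in Ioi (0 : ℝ), t ^ (a - 1) / (t + x) = π / sin (π * a) * x ^ (a - 1) := by
  have h := integral_comp_mul_left_Ioi' (fun t : ℝ => t ^ (a - 1) / (t + x)) 0 hx
  rw [mul_zero] at h
  rw [← h, ← integral_rpow_sub_one_div_one_add ha0 ha1, smul_eq_mul, ← integral_const_mul,
    ← integral_mul_const]
  refine setIntegral_congr_fun measurableSet_Ioi fun t ht => ?_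
  have ht0 : 0 < t := ht
  rw [mul_rpow hx.le ht0.le]
  field_simp
  ring

/-- Locally uniform lower bound for `‖t + z‖`, `t > 0`, near a point of the slit plane. -/
lemma exists_one_add_le_mul_norm_add {w : ℂ} (hw : w ∈ Complex.slitPlane) :
    ∃ r > 0, ∃ K > 0, ∀ z ∈ Metric.ball w r, ∀ t : ℝ, 0 < t → 1 + t ≤ K * ‖(t : ℂ) + z‖ := by
  obtain ⟨ε, hε, hball⟩ := Metric.isOpen_iff.1 Complex.isOpen_slitPlane w hw
  have hr : 0 < ε / 2 := half_pos hε
  refine ⟨ε / 2, hr, 1 + (1 + (‖w‖ + ε / 2)) / (ε / 2), by positivity, fun z hz t ht => ?_⟩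
  rw [mem_ball_iff_norm] at hz
  have h1 : ε ≤ ‖(t : ℂ) + w‖ := by
    by_contra! h
    have hm : -(t : ℂ) ∈ Metric.ball w ε := by
      rwa [mem_ball_iff_norm, ← norm_neg, show -(-(t : ℂ) - w) = t + w by ring]
    rcases Complex.mem_slitPlane_iff.1 (hball hm) with h' | h' <;> simp at h'
    linarith
  have h2 : ‖(t : ℂ) + w‖ ≤ ‖(t : ℂ) + z‖ + ‖z - w‖ := by
    have := norm_sub_le ((t : ℂ) + z) (z - w)
    rwa [show (t : ℂ) + z - (z - w) = t + w by ring] at this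
  have h3 : t ≤ ‖(t : ℂ) + z‖ + ‖z - w‖ + ‖w‖ := by
    have := norm_sub_le ((t : ℂ) + w) w
    rw [add_sub_cancel_right, Complex.norm_of_nonneg ht.le] at this
    linarith
  have h4 : 1 + (‖w‖ + ε / 2) ≤ (1 + (‖w‖ + ε / 2)) / (ε / 2) * ‖(t : ℂ) + z‖ := by
    rw [div_mul_eq_mul_div, le_div_iff₀ hr]
    exact mul_le_mul_of_nonneg_left (by linarith) (by positivity)
  linarith

lemma integrableOn_rpow_sub_one_div_add {a : ℝ} (ha0 : 0 < a) (ha1 : a < 1) {w : ℂ}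
    (hw : w ∈ Complex.slitPlane) :
    IntegrableOn (fun t : ℝ => ((t ^ (a - 1) : ℝ) : ℂ) / (t + w)) (Ioi 0) := by
  obtain ⟨r, hr, K, hK, hb⟩ := exists_one_add_le_mul_norm_add hw
  have hmeas : Measurable fun t : ℝ => ((t ^ (a - 1) : ℝ) : ℂ) / (t + w) := by fun_prop
  refine Integrable.mono' ((integrableOn_rpow_sub_one_div_one_add ha0 ha1).const_mul K)
    hmeas.aestronglyMeasurable ?_
  filter_upwards [ae_restrict_mem measurableSet_Ioi] with t ht
  have ht0 : 0 < t := ht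
  have h := hb w (Metric.mem_ball_self hr) t ht0
  have hn : 0 < ‖(t : ℂ) + w‖ := pos_of_mul_pos_right (by linarith) hK.le
  rw [norm_div, Complex.norm_of_nonneg (by positivity), mul_div_assoc',
    div_le_div_iff₀ hn (by positivity)]
  have := rpow_pos_of_pos ht0 (a - 1)
  nlinarith

lemma differentiableOn_integral_rpow_sub_one_div_add {a : ℝ} (ha0 : 0 < a) (ha1 : a < 1) :
    DifferentiableOn ℂ (fun w : ℂ => ∫ t in Ioi (0 : ℝ), ((t ^ (a - 1) : ℝ) : ℂ) / (t + w))
      Complex.slitPlane := by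
  intro w hw
  obtain ⟨r, hr, K, hK, hb⟩ := exists_one_add_le_mul_norm_add hw
  have hn : ∀ z ∈ Metric.ball w r, ∀ t : ℝ, 0 < t → 0 < ‖(t : ℂ) + z‖ := fun z hz t ht =>
    pos_of_mul_pos_right (by linarith [hb z hz t ht]) hK.le
  have hmeas : ∀ z : ℂ, Measurable fun t : ℝ => ((t ^ (a - 1) : ℝ) : ℂ) / (t + z) := by
    intro z
    fun_prop
  have hmeas' : Measurable fun t : ℝ => -((t ^ (a - 1) : ℝ) : ℂ) / (t + w) ^ 2 := by fun_prop
  refine (hasDerivAt_integral_of_dominated_loc_of_deriv_le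
    (F' := fun (z : ℂ) (t : ℝ) => -((t ^ (a - 1) : ℝ) : ℂ) / (t + z) ^ 2)
    (bound := fun t : ℝ => K ^ 2 * (t ^ (a - 1) / (1 + t))) (Metric.ball_mem_nhds w hr)
    (.of_forall fun z => (hmeas z).aestronglyMeasurable)
    (integrableOn_rpow_sub_one_div_add ha0 ha1 hw) hmeas'.aestronglyMeasurable ?_
    ((integrableOn_rpow_sub_one_div_one_add ha0 ha1).const_mul _)
    ?_).2.differentiableAt.differentiableWithinAt
  · filter_upwards [ae_restrict_mem measurableSet_Ioi] with t ht z hz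
    have ht0 : 0 < t := ht
    have h := hb z hz t ht0
    have hz' := hn z hz t ht0
    rw [norm_div, norm_neg, Complex.norm_of_nonneg (by positivity), norm_pow, mul_div_assoc',
      div_le_div_iff₀ (by positivity) (by positivity)]
    have h2 : 1 + t ≤ (K * ‖(t : ℂ) + z‖) ^ 2 := by nlinarith
    calc t ^ (a - 1) * (1 + t) ≤ t ^ (a - 1) * (K * ‖(t : ℂ) + z‖) ^ 2 := by gcongr
      _ = _ := by ring
  · filter_upwards [ae_restrict_mem measurableSet_Ioi] with t ht z hz
    have hz' : (t : ℂ) + z ≠ 0 := norm_pos_iff.1 (hn z hz t ht)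
    convert! (hasDerivAt_const z ((t ^ (a - 1) : ℝ) : ℂ)).div
      ((hasDerivAt_id z).const_add (t : ℂ)) hz' using 1
    simp

/-- The Stieltjes transform of a power on the slit plane. -/
lemma integral_rpow_sub_one_div_add_of_mem_slitPlane {a : ℝ} (ha0 : 0 < a) (ha1 : a < 1) {w : ℂ}
    (hw : w ∈ Complex.slitPlane) :
    ∫ t in Ioi (0 : ℝ), ((t ^ (a - 1) : ℝ) : ℂ) / (t + w)
      = (π / sin (π * a) : ℝ) * w ^ ((a - 1 : ℝ) : ℂ) := by
  have hf := (differentiableOn_integral_rpow_sub_one_div_add ha0 ha1).analyticOnNhd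
    Complex.isOpen_slitPlane
  have hg : AnalyticOnNhd ℂ (fun w : ℂ => (π / sin (π * a) : ℝ) * w ^ ((a - 1 : ℝ) : ℂ))
      Complex.slitPlane := by
    refine DifferentiableOn.analyticOnNhd (fun z hz => ?_) Complex.isOpen_slitPlane
    exact ((differentiableAt_id.cpow_const hz).const_mul _).differentiableWithinAt
  refine hf.eqOn_of_preconnected_of_frequently_eq hg
    (Complex.starConvex_one_slitPlane.isPathConnected
      Complex.one_mem_slitPlane).isConnected.isPreconnected
    Complex.one_mem_slitPlane ?_ hw
  have htend : Filter.Tendsto (fun x : ℝ => (x : ℂ)) (nhdsWithin 1 (Ioi 1)) (nhdsWithin 1 {1}ᶜ) := by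
    refine tendsto_nhdsWithin_iff.2 ⟨?_, ?_⟩
    · exact (Complex.continuous_ofReal.tendsto' 1 1 (by simp)).mono_left nhdsWithin_le_nhds
    · filter_upwards [self_mem_nhdsWithin] with x hx
      simpa using ne_of_gt hx
  refine htend.frequently (Filter.Eventually.frequently ?_)
  filter_upwards [self_mem_nhdsWithin] with x hx
  have hx0 : 0 < x := one_pos.trans hx
  rw [← Complex.ofReal_cpow hx0.le, ← Complex.ofReal_mul,
    ← integral_rpow_sub_one_div_add ha0 ha1 hx0, ← integral_complex_ofReal]
  simp

lemma integral_rpow_div_sq_add_of_neg {a φ : ℝ} (ha0 : -1 < a) (ha1 : a < 0)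
    (hφ0 : 0 < φ) (hφ1 : φ < π) :
    ∫ t in Ioi (0 : ℝ), t ^ a / (t ^ 2 + 2 * t * cos φ + 1)
      = π * sin (φ * a) / (sin φ * sin (π * a)) := by
  have hs : 0 < sin φ := sin_pos_of_pos_of_lt_pi hφ0 hφ1
  have hmem : ∀ θ : ℝ, sin θ ≠ 0 → Complex.exp (θ * Complex.I) ∈ Complex.slitPlane := by
    intro θ h
    refine Complex.mem_slitPlane_iff.2 (Or.inr ?_)
    rwa [Complex.exp_ofReal_mul_I_im]
  have hcpow : ∀ θ : ℝ, -π < θ → θ ≤ π →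
      Complex.exp (θ * Complex.I) ^ (a : ℂ) = Complex.exp ((θ * a : ℝ) * Complex.I) := by
    intro θ h1 h2
    rw [Complex.cpow_def_of_ne_zero (Complex.exp_ne_zero _),
      Complex.log_exp (by simpa using h1) (by simpa using h2)]
    push_cast
    ring_nf
  have m1 := hmem φ hs.ne'
  have m2 := hmem (-φ) (by simpa using hs.ne')
  have ha : a + 1 - 1 = a := by ring
  have i1 := integrableOn_rpow_sub_one_div_add (a := a + 1) (by linarith) (by linarith) m1
  have i2 := integrableOn_rpow_sub_one_div_add (a := a + 1) (by linarith) (by linarith) m2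
  have e1 := integral_rpow_sub_one_div_add_of_mem_slitPlane (a := a + 1)
    (by linarith) (by linarith) m1
  have e2 := integral_rpow_sub_one_div_add_of_mem_slitPlane (a := a + 1)
    (by linarith) (by linarith) m2
  rw [ha] at i1 i2 e1 e2
  rw [hcpow _ (by linarith) (by linarith)] at e1 e2
  have key := integral_sub i2 i1
  rw [e1, e2, ← mul_sub] at key
  have hsum : ∀ θ : ℝ, Complex.exp ((-θ : ℝ) * Complex.I) - Complex.exp (θ * Complex.I)
      = -(2 * Complex.I * (sin θ : ℝ)) := by
    intro θ
    rw [Complex.exp_mul_I, Complex.exp_mul_I]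
    push_cast
    rw [Complex.cos_neg, Complex.sin_neg]
    ring
  have hcongr : ∫ t in Ioi (0 : ℝ), (((t ^ a : ℝ) : ℂ) / (t + Complex.exp ((-φ : ℝ) * Complex.I))
        - ((t ^ a : ℝ) : ℂ) / (t + Complex.exp (φ * Complex.I)))
      = ∫ t in Ioi (0 : ℝ), 2 * Complex.I * (sin φ : ℝ) *
        ((t ^ a / (t ^ 2 + 2 * t * cos φ + 1) : ℝ) : ℂ) := by
    refine setIntegral_congr_fun measurableSet_Ioi fun t ht => ?_
    have hne : ∀ θ : ℝ, sin θ ≠ 0 → (t : ℂ) + Complex.exp (θ * Complex.I) ≠ 0 := by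
      intro θ h h0
      have := congrArg Complex.im h0
      rw [Complex.add_im, Complex.exp_ofReal_mul_I_im] at this
      simp at this
      exact h this
    have n1 := hne φ hs.ne'
    have n2 := hne (-φ) (by simpa using hs.ne')
    have hprod : ((t : ℂ) + Complex.exp ((-φ : ℝ) * Complex.I)) *
        (t + Complex.exp (φ * Complex.I)) = ((t ^ 2 + 2 * t * cos φ + 1 : ℝ) : ℂ) := by
      have h1 : Complex.exp ((-φ : ℝ) * Complex.I) * Complex.exp (φ * Complex.I) = 1 := by
        rw [← Complex.exp_add]
        simp
      have h2 : Complex.exp ((-φ : ℝ) * Complex.I) + Complex.exp (φ * Complex.I)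
          = 2 * (cos φ : ℝ) := by
        rw [Complex.exp_mul_I, Complex.exp_mul_I]
        push_cast
        rw [Complex.cos_neg, Complex.sin_neg]
        ring
      push_cast at h1 h2 ⊢
      linear_combination h1 + t * h2
    rw [div_sub_div _ _ n2 n1, hprod, Complex.ofReal_div, mul_div_assoc']
    congr 1
    linear_combination -((t ^ a : ℝ) : ℂ) * hsum φ
  rw [hcongr, integral_const_mul, integral_complex_ofReal, neg_mul, hsum] at key
  have hsin : sin (π * (a + 1)) = -sin (π * a) := by
    rw [mul_add, mul_one, sin_add_pi]
  have hsa : sin (π * a) ≠ 0 := by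
    refine (sin_neg_of_neg_of_neg_pi_lt ?_ ?_).ne <;> nlinarith [pi_pos]
  have key2 : sin φ * ∫ t in Ioi (0 : ℝ), t ^ a / (t ^ 2 + 2 * t * cos φ + 1)
      = π / sin (π * a) * sin (φ * a) := by
    rw [hsin] at key
    have h2I : (2 * Complex.I : ℂ) ≠ 0 := by simp
    rw [← Complex.ofReal_inj]
    refine mul_left_cancel₀ h2I ?_
    rw [div_neg] at key
    push_cast at key ⊢
    linear_combination key
  field_simp at key2 ⊢
  linear_combination key2

/-- The Mellin transform of `t ↦ 1 / (t ^ 2 + 2 t cos φ + 1)`. -/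
lemma integral_rpow_div_sq_add {a φ : ℝ} (ha0 : -1 < a) (ha1 : a < 1) (ha : a ≠ 0)
    (hφ0 : 0 < φ) (hφ1 : φ < π) :
    ∫ t in Ioi (0 : ℝ), t ^ a / (t ^ 2 + 2 * t * cos φ + 1)
      = π * sin (φ * a) / (sin φ * sin (π * a)) := by
  rcases ha.lt_or_gt with h | h
  · exact integral_rpow_div_sq_add_of_neg ha0 h hφ0 hφ1
  · have h1 := integral_rpow_div_sq_add_of_neg (a := -a) (by linarith) (by linarith) hφ0 hφ1
    rw [mul_neg, mul_neg, sin_neg, sin_neg, mul_neg, mul_neg, neg_div_neg_eq] at h1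
    rw [← h1, ← integral_comp_rpow_Ioi _ (by norm_num : (-1 : ℝ) ≠ 0)]
    refine setIntegral_congr_fun measurableSet_Ioi fun t ht => ?_
    have ht0 : 0 < t := ht
    have hden : t ^ 2 * ((t⁻¹) ^ 2 + 2 * t⁻¹ * cos φ + 1) = t ^ 2 + 2 * t * cos φ + 1 := by
      field_simp
      ring
    simp only [smul_eq_mul]
    rw [rpow_neg_one, ← hden, inv_rpow ht0.le, ← rpow_neg ht0.le, abs_neg, abs_one, one_mul,
      show (-1 - 1 : ℝ) = -(2 : ℕ) by norm_num, rpow_neg ht0.le (2 : ℕ), rpow_natCast,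
      ← div_div, ← div_eq_inv_mul, div_right_comm]

lemma integrableOn_rpow_div_sq_add {a φ : ℝ} (ha0 : -1 < a) (ha1 : a < 1) (ha : a ≠ 0)
    (hφ0 : 0 < φ) (hφ1 : φ < π) :
    IntegrableOn (fun t : ℝ => t ^ a / (t ^ 2 + 2 * t * cos φ + 1)) (Ioi 0) := by
  have hsin : ∀ θ : ℝ, 0 < θ → θ ≤ π → sin (θ * a) ≠ 0 := by
    intro θ h0 h1
    rw [Ne, sin_eq_zero_iff_of_lt_of_lt (by nlinarith) (by nlinarith)]
    exact mul_ne_zero h0.ne' ha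
  refine Integrable.of_integral_ne_zero ?_
  rw [integral_rpow_div_sq_add ha0 ha1 ha hφ0 hφ1]
  exact div_ne_zero (mul_ne_zero pi_ne_zero (hsin φ hφ0 hφ1.le))
    (mul_ne_zero (sin_pos_of_pos_of_lt_pi hφ0 hφ1).ne' (hsin π pi_pos le_rfl))

/-- For every `α ∈ (1,2)` and every real `s` with `−1 < s < 1 − 1/α`,
`s ≠ 0`, `s ≠ −1/α`, one has
`∫₀^∞ t^s f_{T_α}(t) dt = sin(παs) sin(π/α) / (α sin(πs) sin(π(s+1/α)))`,
where `f_{T_α}(t) = −sin(πα)(1 + t^{1/α})/(πα(t² − 2t cos(πα) + 1))`. -/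
theorem stmt_10 (α s : ℝ) (hα : α ∈ Set.Ioo (1 : ℝ) 2)
    (hs1 : -1 < s) (hs2 : s < 1 - 1 / α) (hs3 : s ≠ 0) (hs4 : s ≠ -(1 / α)) :
    ∫ t in Set.Ioi (0 : ℝ),
        t ^ s * (-Real.sin (π * α) * (1 + t ^ (1 / α)) /
          (π * α * (t ^ 2 - 2 * t * Real.cos (π * α) + 1)))
      = Real.sin (π * α * s) * Real.sin (π / α) /
          (α * Real.sin (π * s) * Real.sin (π * (s + 1 / α))) := by
  obtain ⟨hα1, hα2⟩ := hα
  have hα0 : 0 < α := by linarith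
  have hinv0 : 0 < 1 / α := by positivity
  have hinv1 : 1 / α < 1 := by rwa [div_lt_one hα0]
  have hφ0 : 0 < π * α - π := by nlinarith [pi_pos]
  have hφ1 : π * α - π < π := by nlinarith [pi_pos]
  have hsα : sin (π * α) ≠ 0 := by
    have := sin_pos_of_pos_of_lt_pi hφ0 hφ1
    rw [sin_sub_pi] at this
    linarith
  have hu : s + 1 / α ≠ 0 := fun h => hs4 (by linarith)
  have i1 := integrableOn_rpow_div_sq_add hs1 (by linarith) hs3 hφ0 hφ1
  have i2 := integrableOn_rpow_div_sq_add (a := s + 1 / α) (by linarith) (by linarith) hu hφ0 hφ1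
  have e1 := integral_rpow_div_sq_add hs1 (by linarith) hs3 hφ0 hφ1
  have e2 := integral_rpow_div_sq_add (a := s + 1 / α) (by linarith) (by linarith) hu hφ0 hφ1
  have key := integral_add i1 i2
  have hcongr : ∫ t in Ioi (0 : ℝ), t ^ s * (-sin (π * α) * (1 + t ^ (1 / α)) /
      (π * α * (t ^ 2 - 2 * t * cos (π * α) + 1)))
      = ∫ t in Ioi (0 : ℝ), -sin (π * α) / (π * α) *
        (t ^ s / (t ^ 2 + 2 * t * cos (π * α - π) + 1)
          + t ^ (s + 1 / α) / (t ^ 2 + 2 * t * cos (π * α - π) + 1)) := by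
    refine setIntegral_congr_fun measurableSet_Ioi fun t ht => ?_
    rw [rpow_add ht, cos_sub_pi, mul_neg, ← sub_eq_add_neg, ← div_div]
    ring
  rw [hcongr, integral_const_mul, key, e1, e2, sin_sub_pi]
  have hsin : ∀ x : ℝ, -1 < x → x < 1 → x ≠ 0 → sin (π * x) ≠ 0 := by
    intro x h0 h1 hx
    rw [Ne, sin_eq_zero_iff_of_lt_of_lt (by nlinarith [pi_pos]) (by nlinarith [pi_pos])]
    exact mul_ne_zero pi_ne_zero hx
  have n1 := hsin s hs1 (by linarith) hs3
  have n2 := hsin (s + 1 / α) (by linarith) (by linarith) hu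
  have a1 : (π * α - π) * s = π * α * s - π * s := by ring
  have a2 : (π * α - π) * (s + 1 / α) = π - (π / α - (π * α * s - π * s)) := by
    field_simp
    ring
  have a3 : π * (s + 1 / α) = π * s + π / α := by ring
  have trig : sin (π * s + π / α) * sin (π * α * s - π * s)
      + sin (π * s) * sin (π / α - (π * α * s - π * s)) = sin (π * α * s) * sin (π / α) := by
    simp only [sin_sub, sin_add, cos_sub]
    linear_combination sin (π / α) * sin (π * α * s) * sin_sq_add_cos_sq (π * s)
  rw [a3] at n2
  rw [a1, a2, a3, sin_pi_sub, ← trig]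
  generalize sin (π * s + π / α) = A at *
  generalize sin (π * α * s - π * s) = B at *
  generalize sin (π / α - (π * α * s - π * s)) = C at *
  generalize sin (π * s) = D at *
  generalize sin (π * α) = E at *
  field_simp
  ring
end

section
/- For every α ∈ (1,2), the function f_{T_α} is nonnegative on (0,∞) and ∫₀^∞ f_{T_α}(t) dt = 1; that is, f_{T_α} is a probability density on (0,∞). -/
open Real MeasureTheory Set

theorem norm_cpow_mul_cexp_neg_mul {a r : ℂ} {t : ℝ} (ht : 0 < t) :
    ‖(t : ℂ) ^ a * Complex.exp (-(r * t))‖ = t ^ a.re * Real.exp (-(r.re * t)) := by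
  rw [norm_mul, Complex.norm_cpow_eq_rpow_re_of_pos ht, Complex.norm_exp]
  simp

theorem aestronglyMeasurable_cpow_mul_cexp_neg_mul (a r : ℂ) :
    AEStronglyMeasurable (fun t : ℝ => (t : ℂ) ^ a * Complex.exp (-(r * t)))
      (volume.restrict (Ioi 0)) := by
  have : Measurable (fun t : ℝ => (t : ℂ) ^ a * Complex.exp (-(r * t))) := by fun_prop
  exact this.aestronglyMeasurable

theorem integrableOn_rpow_mul_exp_neg_mul {s b : ℝ} (hs : -1 < s) (hb : 0 < b) :
    IntegrableOn (fun t : ℝ => t ^ s * Real.exp (-(b * t))) (Ioi 0) := by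
  simpa using integrableOn_rpow_mul_exp_neg_mul_rpow hs one_pos hb

theorem integrableOn_cpow_mul_cexp_neg_mul {a r : ℂ} (ha : -1 < a.re) (hr : 0 < r.re) :
    IntegrableOn (fun t : ℝ => (t : ℂ) ^ a * Complex.exp (-(r * t))) (Ioi 0) := by
  refine (integrableOn_rpow_mul_exp_neg_mul ha hr).mono'
    (aestronglyMeasurable_cpow_mul_cexp_neg_mul a r) ?_
  filter_upwards [ae_restrict_mem measurableSet_Ioi] with t ht
  exact (norm_cpow_mul_cexp_neg_mul ht).le

theorem differentiableAt_integral_cpow_mul_cexp_neg_mul {a r : ℂ} (ha : 0 < a.re)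
    (hr : 0 < r.re) :
    DifferentiableAt ℂ
      (fun z : ℂ => ∫ t : ℝ in Ioi 0, (t : ℂ) ^ (a - 1) * Complex.exp (-(z * t))) r := by
  have hball : ∀ z ∈ Metric.ball r (r.re / 2), r.re / 2 ≤ z.re := by
    intro z hz
    rw [Metric.mem_ball, dist_eq_norm] at hz
    have h := (abs_le.1 (Complex.abs_re_le_norm (z - r))).1
    rw [Complex.sub_re] at h
    linarith
  have key := hasDerivAt_integral_of_dominated_loc_of_deriv_le
    (μ := volume.restrict (Ioi (0 : ℝ))) (x₀ := r)
    (F := fun (z : ℂ) (t : ℝ) => (t : ℂ) ^ (a - 1) * Complex.exp (-(z * t)))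
    (F' := fun (z : ℂ) (t : ℝ) => (t : ℂ) ^ (a - 1) * (Complex.exp (-(z * t)) * (-t)))
    (bound := fun t => t ^ a.re * Real.exp (-(r.re / 2 * t)))
    (Metric.ball_mem_nhds r (half_pos hr))
    (Filter.Eventually.of_forall fun z => aestronglyMeasurable_cpow_mul_cexp_neg_mul _ z)
    (integrableOn_cpow_mul_cexp_neg_mul (by simpa using ha) hr)
    (by
      have : Measurable (fun t : ℝ => (t : ℂ) ^ (a - 1) * (Complex.exp (-(r * t)) * (-t))) := by
        fun_prop
      exact this.aestronglyMeasurable)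
    (by
      filter_upwards [ae_restrict_mem measurableSet_Ioi] with t ht z hz
      rw [mem_Ioi] at ht
      rw [← mul_assoc, norm_mul, norm_cpow_mul_cexp_neg_mul ht, norm_neg, Complex.norm_real,
        Real.norm_of_nonneg ht.le, mul_right_comm, Complex.sub_re, Complex.one_re,
        ← Real.rpow_add_one ht.ne', sub_add_cancel]
      gcongr
      exact hball z hz)
    (integrableOn_rpow_mul_exp_neg_mul (by linarith) (half_pos hr))
    (by
      filter_upwards with t z _
      have h : HasDerivAt (fun z : ℂ => -(z * t)) (-(t : ℂ)) z := by
        simpa using! ((hasDerivAt_id z).mul_const (t : ℂ)).neg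
      exact h.cexp.const_mul _)
  exact key.2.differentiableAt

theorem integral_cpow_mul_cexp_neg_mul {a r : ℂ} (ha : 0 < a.re) (hr : 0 < r.re) :
    ∫ t : ℝ in Ioi 0, (t : ℂ) ^ (a - 1) * Complex.exp (-(r * t)) =
      (1 / r) ^ a * Complex.Gamma a := by
  have hopen : IsOpen {z : ℂ | 0 < z.re} := isOpen_lt continuous_const Complex.continuous_re
  have hL : AnalyticOnNhd ℂ
      (fun z : ℂ => ∫ t : ℝ in Ioi 0, (t : ℂ) ^ (a - 1) * Complex.exp (-(z * t)))
      {z : ℂ | 0 < z.re} :=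
    DifferentiableOn.analyticOnNhd (fun z hz =>
      (differentiableAt_integral_cpow_mul_cexp_neg_mul ha hz).differentiableWithinAt) hopen
  have hR : AnalyticOnNhd ℂ (fun z : ℂ => (1 / z) ^ a * Complex.Gamma a) {z : ℂ | 0 < z.re} := by
    refine DifferentiableOn.analyticOnNhd (fun z hz => ?_) hopen
    have hz0 : z ≠ 0 := fun h => by simp [h] at hz
    have hs : 1 / z ∈ Complex.slitPlane := by
      refine Or.inl ?_
      rw [one_div, Complex.inv_re]
      exact div_pos hz (Complex.normSq_pos.2 hz0)
    exact (((differentiableAt_const _).div differentiableAt_id hz0).cpow_const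
      hs).mul_const _ |>.differentiableWithinAt
  have hpre : IsPreconnected {z : ℂ | 0 < z.re} :=
    (convex_halfSpace_re_gt 0).isPreconnected
  have hfreq : ∃ᶠ z in nhdsWithin (1 : ℂ) {1}ᶜ,
      ∫ t : ℝ in Ioi 0, (t : ℂ) ^ (a - 1) * Complex.exp (-(z * t)) =
        (1 / z) ^ a * Complex.Gamma a := by
    have ht : Filter.Tendsto (fun x : ℝ => (x : ℂ)) (nhdsWithin 1 {1}ᶜ)
        (nhdsWithin (1 : ℂ) {1}ᶜ) := by
      refine tendsto_nhdsWithin_of_tendsto_nhds_of_eventually_within _ ?_ ?_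
      · exact (Complex.continuous_ofReal.tendsto' 1 1 (by simp)).mono_left nhdsWithin_le_nhds
      · filter_upwards [self_mem_nhdsWithin] with x hx
        simpa using hx
    refine ht.frequently (Filter.Eventually.frequently ?_)
    filter_upwards [nhdsWithin_le_nhds (lt_mem_nhds (zero_lt_one' ℝ))] with x hx
    exact Complex.integral_cpow_mul_exp_neg_mul_Ioi ha hx
  exact hL.eqOn_of_preconnected_of_frequently_eq hR hpre (by simp) hfreq hr

/-- The integrand of the double integral representing `Γ(s) Γ(1 - s)` times a power. -/
theorem integrable_prod_cpow_mul_cexp {a b : ℂ} (ha : 0 < a.re) (hb : 0 < b.re) {s : ℂ}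
    (hs0 : 0 < s.re) (hs1 : s.re < 1) :
    Integrable (Function.uncurry fun t x : ℝ =>
      (t : ℂ) ^ (s - 1) * Complex.exp (-((a * t + b) * x)))
      ((volume.restrict (Ioi 0)).prod (volume.restrict (Ioi 0))) := by
  have hm : Measurable (Function.uncurry fun t x : ℝ =>
      (t : ℂ) ^ (s - 1) * Complex.exp (-((a * t + b) * x))) := by
    unfold Function.uncurry
    fun_prop
  have hfac (t x : ℝ) : (t : ℂ) ^ (s - 1) * Complex.exp (-((a * t + b) * x)) =
      (t : ℂ) ^ (s - 1) * Complex.exp (-((a * x) * t)) * Complex.exp (-(b * x)) := by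
    rw [mul_assoc, ← Complex.exp_add]
    ring_nf
  rw [integrable_prod_iff' hm.aestronglyMeasurable]
  simp only [Function.uncurry_apply_pair, hfac]
  constructor
  · filter_upwards [ae_restrict_mem measurableSet_Ioi] with x hx
    exact (integrableOn_cpow_mul_cexp_neg_mul (by simpa using hs0)
      (by simpa using mul_pos ha hx)).mul_const _
  · have h1 : IntegrableOn (fun x : ℝ =>
        (1 / a.re) ^ s.re * Real.Gamma s.re * (x ^ (-s.re) * Real.exp (-(b.re * x)))) (Ioi 0) :=
      (integrableOn_rpow_mul_exp_neg_mul (by linarith) hb).const_mul _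
    refine h1.congr_fun (fun x hx => ?_) measurableSet_Ioi
    rw [mem_Ioi] at hx
    have h2 : ∀ t ∈ Ioi (0 : ℝ),
        ‖(t : ℂ) ^ (s - 1) * Complex.exp (-((a * x) * t)) * Complex.exp (-(b * x))‖ =
        t ^ (s.re - 1) * Real.exp (-((a.re * x) * t)) * Real.exp (-(b.re * x)) := by
      intro t ht
      rw [norm_mul, norm_cpow_mul_cexp_neg_mul ht, Complex.norm_exp]
      simp
    dsimp only
    rw [setIntegral_congr_fun measurableSet_Ioi h2, integral_mul_const,
      Real.integral_rpow_mul_exp_neg_mul_Ioi hs0 (mul_pos ha hx), ← one_div_mul_one_div,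
      Real.mul_rpow (by positivity) (by positivity), one_div x, Real.inv_rpow hx.le,
      Real.rpow_neg hx.le]
    ring

theorem integral_cexp_neg_mul {c : ℂ} (hc : 0 < c.re) :
    ∫ x : ℝ in Ioi 0, Complex.exp (-(c * x)) = 1 / c := by
  have h := integral_exp_mul_complex_Ioi (a := -c) (by simpa using hc) 0
  simpa [neg_mul] using h

theorem integrableOn_cpow_div_add {a b : ℂ} (ha : 0 < a.re) (hb : 0 < b.re) {s : ℂ}
    (hs0 : 0 < s.re) (hs1 : s.re < 1) :
    IntegrableOn (fun t : ℝ => (t : ℂ) ^ (s - 1) / (a * t + b)) (Ioi 0) := by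
  have h := (integrable_prod_cpow_mul_cexp ha hb hs0 hs1).integral_prod_left
  refine IntegrableOn.congr_fun h (fun t ht => ?_) measurableSet_Ioi
  rw [mem_Ioi] at ht
  simp only [Function.uncurry_apply_pair]
  rw [integral_const_mul, integral_cexp_neg_mul, mul_one_div]
  simpa using add_pos (mul_pos ha ht) hb

theorem integral_cpow_div_add {a b : ℂ} (ha : 0 < a.re) (hb : 0 < b.re) {s : ℂ}
    (hs0 : 0 < s.re) (hs1 : s.re < 1) :
    ∫ t : ℝ in Ioi 0, (t : ℂ) ^ (s - 1) / (a * t + b) =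
      (1 / a) ^ s * (1 / b) ^ (1 - s) * (π / Complex.sin (π * s)) := by
  have hswap := integral_integral_swap (integrable_prod_cpow_mul_cexp ha hb hs0 hs1)
  have hL : ∀ t ∈ Ioi (0 : ℝ),
      ∫ x : ℝ in Ioi 0, (t : ℂ) ^ (s - 1) * Complex.exp (-((a * t + b) * x)) =
        (t : ℂ) ^ (s - 1) / (a * t + b) := by
    intro t ht
    rw [integral_const_mul, integral_cexp_neg_mul, mul_one_div]
    simpa using add_pos (mul_pos ha ht) hb
  have hR : ∀ x ∈ Ioi (0 : ℝ),
      ∫ t : ℝ in Ioi 0, (t : ℂ) ^ (s - 1) * Complex.exp (-((a * t + b) * x)) =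
        (1 / a) ^ s * Complex.Gamma s * ((x : ℂ) ^ ((1 - s) - 1) * Complex.exp (-(b * x))) := by
    intro x hx
    rw [mem_Ioi] at hx
    have hfac (t : ℝ) : (t : ℂ) ^ (s - 1) * Complex.exp (-((a * t + b) * x)) =
        (t : ℂ) ^ (s - 1) * Complex.exp (-((a * x) * t)) * Complex.exp (-(b * x)) := by
      rw [mul_assoc, ← Complex.exp_add]
      ring_nf
    have hpow : (1 / (a * x)) ^ s = (1 / a) ^ s * (x : ℂ) ^ (-s) := by
      have ha0 : 1 / a ≠ 0 := one_div_ne_zero fun h => by simp [h] at ha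
      have hx0 : (x : ℂ) ≠ 0 := Complex.ofReal_ne_zero.2 hx.ne'
      have h : (1 / (a * x) : ℂ) = ((x⁻¹ : ℝ) : ℂ) * (1 / a) := by
        push_cast
        field_simp
      rw [h, Complex.cpow_def_of_ne_zero
          (h ▸ one_div_ne_zero (mul_ne_zero (by simpa using ha0) hx0)),
        Complex.log_ofReal_mul (inv_pos.2 hx) ha0, Complex.cpow_def_of_ne_zero ha0,
        Complex.cpow_def_of_ne_zero hx0, ← Complex.exp_add, Real.log_inv, ← Complex.ofReal_log hx.le]
      push_cast
      ring_nf
    simp_rw [hfac]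
    rw [integral_mul_const, integral_cpow_mul_cexp_neg_mul hs0 (by simpa using mul_pos ha hx),
      hpow, show (1 - s) - 1 = -s by ring]
    ring
  rw [setIntegral_congr_fun measurableSet_Ioi hL, setIntegral_congr_fun measurableSet_Ioi hR,
    integral_const_mul, integral_cpow_mul_cexp_neg_mul (by simpa using hs1) hb] at hswap
  rw [hswap, ← Complex.Gamma_mul_Gamma_one_sub]
  ring

theorem sq_add_two_mul_mul_cos_add_one_pos {ψ t : ℝ} (hψ : 0 < Real.sin ψ) :
    0 < t ^ 2 + 2 * t * Real.cos ψ + 1 := by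
  nlinarith [sq_nonneg (t + Real.cos ψ), Real.sin_sq_add_cos_sq ψ, pow_pos hψ 2]

theorem im_exp_mul_cpow_div {ψ s t : ℝ} (hψ : ψ ∈ Ioo 0 π) (ht : 0 < t) :
    (Complex.exp (ψ / 2 * Complex.I) * ((t : ℂ) ^ ((s : ℂ) - 1) /
      (Complex.exp (-(ψ / 2 * Complex.I)) * t + Complex.exp (ψ / 2 * Complex.I)))).im =
    t ^ s * Real.sin ψ / (t ^ 2 + 2 * t * Real.cos ψ + 1) := by
  have hden := sq_add_two_mul_mul_cos_add_one_pos (t := t) (Real.sin_pos_of_mem_Ioo hψ)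
  set D := t ^ 2 + 2 * t * Real.cos ψ + 1 with hD
  set w := Complex.exp (ψ / 2 * Complex.I) with hw
  set v := Complex.exp (-(ψ / 2 * Complex.I)) with hv
  have hwv : w * v = 1 := by rw [hw, hv, ← Complex.exp_add]; simp
  have hw2 : w ^ 2 = Complex.exp (ψ * Complex.I) := by
    rw [hw, ← Complex.exp_nat_mul]
    congr 1
    push_cast
    ring
  have hv2 : v ^ 2 = Complex.exp (-ψ * Complex.I) := by
    rw [hv, ← Complex.exp_nat_mul]
    congr 1
    push_cast
    ring
  have hDc : (D : ℂ) = (v * t + w) * (w * t + v) := by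
    have hcos : 2 * Complex.cos ψ = w ^ 2 + v ^ 2 := by
      rw [hw2, hv2, Complex.two_cos]
    rw [hD]
    push_cast
    linear_combination (t : ℂ) * hcos - (t ^ 2 + 1 : ℂ) * hwv
  have hD0 : (D : ℂ) ≠ 0 := Complex.ofReal_ne_zero.2 hden.ne'
  have hne : v * t + w ≠ 0 := fun h => hD0 (by rw [hDc, h, zero_mul])
  have hpow : (t : ℂ) ^ ((s : ℂ) - 1) = ((t ^ (s - 1) : ℝ) : ℂ) := by
    rw [Complex.ofReal_cpow ht.le]
    push_cast
    rfl
  have heq : w * ((t : ℂ) ^ ((s : ℂ) - 1) / (v * t + w)) =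
      ((t ^ (s - 1) / D : ℝ) : ℂ) * (Complex.exp (ψ * Complex.I) * t + 1) := by
    rw [hpow, ← hw2, Complex.ofReal_div]
    field_simp
    rw [hDc]
    linear_combination ((t ^ (s - 1) : ℝ) : ℂ) * (v * t + w) * hwv
  rw [heq, Complex.im_ofReal_mul, Complex.add_im, Complex.im_mul_ofReal,
    Complex.exp_ofReal_mul_I_im, Complex.one_im, add_zero, Real.rpow_sub_one ht.ne']
  field_simp

theorem integrableOn_and_integral_rpow_mul_sin_div {ψ s : ℝ} (hψ : ψ ∈ Ioo 0 π)
    (hs : s ∈ Ioo 0 1) :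
    IntegrableOn (fun t : ℝ => t ^ s * Real.sin ψ / (t ^ 2 + 2 * t * Real.cos ψ + 1)) (Ioi 0) ∧
    ∫ t in Ioi (0 : ℝ), t ^ s * Real.sin ψ / (t ^ 2 + 2 * t * Real.cos ψ + 1) =
      π * Real.sin (s * ψ) / Real.sin (π * s) := by
  have hcos : 0 < Real.cos (ψ / 2) :=
    Real.cos_pos_of_mem_Ioo ⟨by linarith [hψ.1, Real.pi_pos], by linarith [hψ.2]⟩
  have hb : 0 < (Complex.exp (ψ / 2 * Complex.I)).re := by
    rw [Complex.exp_re]; simpa using hcos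
  have ha : 0 < (Complex.exp (-(ψ / 2 * Complex.I))).re := by
    rw [Complex.exp_re]; simpa using hcos
  have hint := (integrableOn_cpow_div_add ha hb (s := s) (by simpa using hs.1)
    (by simpa using hs.2)).const_mul (Complex.exp (ψ / 2 * Complex.I))
  have hval := integral_cpow_div_add ha hb (s := s) (by simpa using hs.1) (by simpa using hs.2)
  have hpt : EqOn _ _ (Ioi (0 : ℝ)) := fun t (ht : 0 < t) => im_exp_mul_cpow_div (s := s) hψ ht
  refine ⟨IntegrableOn.congr_fun hint.im hpt measurableSet_Ioi, ?_⟩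
  have hpow (z u : ℂ) (hz : -π < z.im) (hz' : z.im ≤ π) :
      Complex.exp z ^ u = Complex.exp (z * u) := by
    rw [Complex.cpow_def_of_ne_zero (Complex.exp_ne_zero _), Complex.log_exp hz hz']
  have him := integral_im hint
  simp only [RCLike.im_to_complex] at him
  rw [← setIntegral_congr_fun measurableSet_Ioi hpt, him, integral_const_mul, hval,
    one_div, one_div, ← Complex.exp_neg, ← Complex.exp_neg, neg_neg,
    hpow _ _ (by simp; linarith [hψ.1, Real.pi_pos]) (by simp; linarith [hψ.2, Real.pi_pos]),
    hpow _ _ (by simp; linarith [hψ.2, Real.pi_pos]) (by simp; linarith [hψ.1, Real.pi_pos]),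
    ← mul_assoc, ← Complex.exp_add, ← Complex.exp_add,
    show (ψ / 2 * Complex.I + (ψ / 2 * Complex.I * s + -(ψ / 2 * Complex.I) * (1 - s)) : ℂ) =
      ((s * ψ : ℝ) : ℂ) * Complex.I by push_cast; ring,
    show (π / Complex.sin (π * s) : ℂ) = ((π / Real.sin (π * s) : ℝ) : ℂ) by push_cast; rfl,
    Complex.im_mul_ofReal, Complex.exp_ofReal_mul_I_im]
  ring

theorem integrableOn_and_integral_sin_div {ψ : ℝ} (hψ : ψ ∈ Ioo 0 π) :
    IntegrableOn (fun t : ℝ => Real.sin ψ / (t ^ 2 + 2 * t * Real.cos ψ + 1)) (Ioi 0) ∧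
    ∫ t in Ioi (0 : ℝ), Real.sin ψ / (t ^ 2 + 2 * t * Real.cos ψ + 1) = ψ := by
  have hsin := Real.sin_pos_of_mem_Ioo hψ
  have hden (t : ℝ) := sq_add_two_mul_mul_cos_add_one_pos (t := t) hsin
  have hderiv (t : ℝ) : HasDerivAt (fun t => arctan ((t + Real.cos ψ) / Real.sin ψ))
      (Real.sin ψ / (t ^ 2 + 2 * t * Real.cos ψ + 1)) t := by
    convert! (((hasDerivAt_id t).add_const (Real.cos ψ)).div_const (Real.sin ψ)).arctan using 1
    have h : 1 + ((t + Real.cos ψ) / Real.sin ψ) ^ 2 =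
        (t ^ 2 + 2 * t * Real.cos ψ + 1) / Real.sin ψ ^ 2 := by
      field_simp
      linear_combination Real.sin_sq_add_cos_sq ψ
    rw [id, h]
    have := (hden t).ne'
    field_simp
  have hlim : Filter.Tendsto (fun t => arctan ((t + Real.cos ψ) / Real.sin ψ)) Filter.atTop
      (nhds (π / 2)) :=
    (tendsto_arctan_atTop.mono_right nhdsWithin_le_nhds).comp
      ((Filter.tendsto_atTop_add_const_right _ _ Filter.tendsto_id).atTop_div_const hsin)
  have hint := integrableOn_Ioi_deriv_of_nonneg' (a := 0) (fun t _ => hderiv t)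
    (fun t _ => div_nonneg hsin.le (hden t).le) hlim
  refine ⟨hint, ?_⟩
  rw [integral_Ioi_of_hasDerivAt_of_tendsto' (fun t _ => hderiv t) hint hlim, zero_add,
    ← Real.sin_pi_div_two_sub, ← Real.cos_pi_div_two_sub ψ, ← Real.tan_eq_sin_div_cos,
    Real.arctan_tan (by linarith [hψ.2]) (by linarith [hψ.1])]
  ring



/-- For every `α ∈ (1,2)`, the function
`f_{T_α}(t) = −sin(πα)(1 + t^{1/α})/(πα(t² − 2t cos(πα) + 1))`
is nonnegative on `(0,∞)` and integrates to `1` there; i.e. it is a probability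
density on `(0,∞)`. -/
theorem stmt_11 (α : ℝ) (hα : α ∈ Set.Ioo (1 : ℝ) 2) :
    (∀ t : ℝ, 0 < t →
      0 ≤ -Real.sin (π * α) * (1 + t ^ (1 / α)) /
            (π * α * (t ^ 2 - 2 * t * Real.cos (π * α) + 1))) ∧
    ∫ t in Set.Ioi (0 : ℝ),
        -Real.sin (π * α) * (1 + t ^ (1 / α)) /
          (π * α * (t ^ 2 - 2 * t * Real.cos (π * α) + 1)) = 1 := by
  obtain ⟨h1, h2⟩ := hα
  have hψ : π * α - π ∈ Ioo 0 π := ⟨by nlinarith [Real.pi_pos], by nlinarith [Real.pi_pos]⟩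
  have hs : 1 / α ∈ Ioo (0 : ℝ) 1 :=
    ⟨by positivity, (div_lt_one (by linarith)).2 h1⟩
  have hα0 : α ≠ 0 := by positivity
  have hsin := Real.sin_pos_of_mem_Ioo hψ
  have hcosα : Real.cos (π * α) = -Real.cos (π * α - π) := by rw [Real.cos_sub_pi, neg_neg]
  have hsinα : -Real.sin (π * α) = Real.sin (π * α - π) := by rw [Real.sin_sub_pi]
  have hdenα (t : ℝ) : t ^ 2 - 2 * t * Real.cos (π * α) + 1 =
      t ^ 2 + 2 * t * Real.cos (π * α - π) + 1 := by rw [hcosα]; ring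
  simp only [hsinα, hdenα]
  obtain ⟨hi0, hv0⟩ := integrableOn_and_integral_sin_div hψ
  obtain ⟨hi1, hv1⟩ := integrableOn_and_integral_rpow_mul_sin_div hψ hs
  refine ⟨fun t ht => ?_, ?_⟩
  · have := sq_add_two_mul_mul_cos_add_one_pos (t := t) hsin
    positivity
  · have hsplit (t : ℝ) : Real.sin (π * α - π) * (1 + t ^ (1 / α)) /
        (π * α * (t ^ 2 + 2 * t * Real.cos (π * α - π) + 1)) =
        (π * α)⁻¹ * (Real.sin (π * α - π) / (t ^ 2 + 2 * t * Real.cos (π * α - π) + 1) +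
          t ^ (1 / α) * Real.sin (π * α - π) /
            (t ^ 2 + 2 * t * Real.cos (π * α - π) + 1)) := by
      have := (sq_add_two_mul_mul_cos_add_one_pos (t := t) hsin).ne'
      field_simp
    have hsin_eq : Real.sin (1 / α * (π * α - π)) = Real.sin (π * (1 / α)) := by
      rw [← Real.sin_pi_sub]
      congr 1
      field_simp
      ring
    have hne : Real.sin (π * (1 / α)) ≠ 0 :=
      (Real.sin_pos_of_mem_Ioo ⟨mul_pos Real.pi_pos hs.1,
        by nlinarith [Real.pi_pos, hs.2]⟩).ne'
    simp_rw [hsplit]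
    rw [integral_const_mul, integral_add hi0 hi1, hv0, hv1, hsin_eq, mul_div_cancel_right₀ _ hne]
    field_simp
    ring
end
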